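/- arXiv:2102.03460 — 3 statements merged into one kernel-verified Lean document; each statement's English description precedes it below -/
import Mathlib

section
/- Let t ≥ 2 and j ≥ 1 be integers, and let p_j denote the j-th smallest prime congruent to 1 modulo t (such a prime exists by Dirichlet's theorem on primes in arithmetic progressions). Then p_j ≥ (1/2) · φ(t) · j · log j. -/
open scoped BigOperators

/-- The odd squarefree natural numbers below `2 * u`. -/
def oddSquarefree (u : ℕ) : Finset ℕ := {q ∈ Finset.range (2 * u) | Odd q ∧ Squarefree q}

/-- The sum of `1 / φ(q)` over the odd squarefree numbers below `2 * u`. -/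
noncomputable def sieveMain (u : ℕ) : ℝ := ∑ q ∈ oddSquarefree u, 1 / (q.totient : ℝ)

/-- The sum of `σ(q) / φ(q)` over the odd squarefree numbers below `2 * u`. -/
noncomputable def sieveError (u : ℕ) : ℝ :=
  ∑ q ∈ oddSquarefree u, (∑ d ∈ q.divisors, (d : ℝ)) / q.totient

lemma mem_oddSquarefree {u q : ℕ} :
    q ∈ oddSquarefree u ↔ q < 2 * u ∧ Odd q ∧ Squarefree q := by
  simp [oddSquarefree]

lemma pos_of_mem_oddSquarefree {u q : ℕ} (hq : q ∈ oddSquarefree u) : 0 < q :=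
  (mem_oddSquarefree.1 hq).2.1.pos

/-- The Ramanujan sum `c_q(x)`. -/
noncomputable def ramanujanSum (q x : ℕ) : ℝ :=
  ∑ a ∈ q.divisorsAntidiagonal, (ArithmeticFunction.moebius a.1 : ℝ) * if a.2 ∣ x then (a.2 : ℝ) else 0

lemma sum_moebius_mul_gcd (q e : ℕ) (hq : 0 < q) :
    ∑ a ∈ q.divisorsAntidiagonal, (ArithmeticFunction.moebius a.1 : ℝ) * (Nat.gcd a.2 e : ℝ) =
      if q ∣ e then (q.totient : ℝ) else 0 := by
  have key := (ArithmeticFunction.sum_eq_iff_sum_mul_moebius_eq (R := ℝ)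
    (f := fun i => if i ∣ e then (i.totient : ℝ) else 0) (g := fun n => (Nat.gcd n e : ℝ))).1 ?_ q hq
  · exact key
  · intro n hn
    rw [← Finset.sum_filter]
    have : (Nat.gcd n e : ℝ) = ((∑ d ∈ (Nat.gcd n e).divisors, d.totient : ℕ) : ℝ) := by
      rw [Nat.sum_totient]
    rw [this, Nat.cast_sum]
    refine Finset.sum_congr ?_ fun _ _ => rfl
    ext d
    simp only [Finset.mem_filter, Nat.mem_divisors, Nat.dvd_gcd_iff, ne_eq, Nat.gcd_eq_zero_iff]
    constructor
    · rintro ⟨⟨h1, h2⟩, h3⟩; exact ⟨⟨h1, h3⟩, fun h => h2 h.1⟩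
    · rintro ⟨⟨h1, h3⟩, h2⟩; exact ⟨⟨h1, hn.ne'⟩, h3⟩

lemma sum_moebius_mul_dvd (q r : ℕ) (hr : 0 < r) :
    ∑ a ∈ r.divisorsAntidiagonal, (ArithmeticFunction.moebius a.1 : ℝ) * (if q ∣ a.2 then 1 else 0) =
      if r = q then 1 else 0 := by
  have key := (ArithmeticFunction.sum_eq_iff_sum_mul_moebius_eq (R := ℝ)
    (f := fun i => if i = q then (1 : ℝ) else 0) (g := fun n => if q ∣ n then 1 else 0)).1 ?_ r hr
  · exact key
  · intro n hn
    simp [Finset.sum_ite_eq', hn.ne']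

lemma sum_moebius_mul_moebius_mul_gcd (q r : ℕ) (hq : 0 < q) (hr : 0 < r) :
    ∑ a ∈ q.divisorsAntidiagonal, ∑ b ∈ r.divisorsAntidiagonal,
      (ArithmeticFunction.moebius a.1 : ℝ) * (ArithmeticFunction.moebius b.1 : ℝ) *
        (Nat.gcd a.2 b.2 : ℝ) = if r = q then (q.totient : ℝ) else 0 := by
  rw [Finset.sum_comm]
  have : ∀ b ∈ r.divisorsAntidiagonal, ∑ a ∈ q.divisorsAntidiagonal,
      (ArithmeticFunction.moebius a.1 : ℝ) * (ArithmeticFunction.moebius b.1 : ℝ) *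
        (Nat.gcd a.2 b.2 : ℝ) =
      q.totient * ((ArithmeticFunction.moebius b.1 : ℝ) * (if q ∣ b.2 then 1 else 0)) := by
    intro b _
    have h := sum_moebius_mul_gcd q b.2 hq
    calc _ = (ArithmeticFunction.moebius b.1 : ℝ) * ∑ a ∈ q.divisorsAntidiagonal,
          (ArithmeticFunction.moebius a.1 : ℝ) * (Nat.gcd a.2 b.2 : ℝ) := by
          rw [Finset.mul_sum]; exact Finset.sum_congr rfl fun _ _ => by ring
      _ = _ := by rw [h]; split_ifs <;> ring
  rw [Finset.sum_congr rfl this, ← Finset.mul_sum, sum_moebius_mul_dvd q r hr]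
  simp

/-- The number of multiples of `m` among `N` consecutive integers is `N / m` up to `1`. -/
lemma abs_card_multiples_sub_le (b N m : ℕ) (hm : 0 < m) :
    |((({x ∈ Finset.Ioc b (b + N) | m ∣ x}).card : ℕ) : ℝ) - (N : ℝ) / m| ≤ 1 := by
  have hc : ({x ∈ Finset.Ioc b (b + N) | m ∣ x}).card + b / m = (b + N) / m := by
    rw [← Nat.Ioc_filter_dvd_card_eq_div, ← Nat.Ioc_filter_dvd_card_eq_div, ← Finset.card_union_of_disjoint]
    · congr 1
      ext x
      simp only [Finset.mem_union, Finset.mem_filter, Finset.mem_Ioc]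
      constructor
      · rintro (⟨h, h'⟩ | ⟨h, h'⟩) <;> exact ⟨by omega, h'⟩
      · rintro ⟨h, h'⟩
        by_cases hx : x ≤ b
        · exact Or.inr ⟨by omega, h'⟩
        · exact Or.inl ⟨by omega, h'⟩
    · rw [Finset.disjoint_left]
      intro x
      simp only [Finset.mem_filter, Finset.mem_Ioc]
      omega
  have hm' : (0 : ℝ) < m := by exact_mod_cast hm
  have hcr : ((({x ∈ Finset.Ioc b (b + N) | m ∣ x}).card : ℕ) : ℝ) + ((b / m : ℕ) : ℝ) =
      (((b + N) / m : ℕ) : ℝ) := by exact_mod_cast hc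
  have h1 : ((b / m : ℕ) : ℝ) ≤ (b : ℝ) / m := Nat.cast_div_le
  have h2 : (((b + N) / m : ℕ) : ℝ) ≤ ((b + N : ℕ) : ℝ) / m := Nat.cast_div_le
  have h3 : (b : ℝ) / m < ((b / m : ℕ) : ℝ) + 1 := by
    rw [div_lt_iff₀ hm']; rw [mul_comm]; exact_mod_cast Nat.lt_mul_div_succ b hm
  have h4 : ((b + N : ℕ) : ℝ) / m < (((b + N) / m : ℕ) : ℝ) + 1 := by
    rw [div_lt_iff₀ hm']; rw [mul_comm]; exact_mod_cast Nat.lt_mul_div_succ (b + N) hm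
  push_cast at h2 h4
  rw [add_div] at h2 h4
  rw [abs_le]
  constructor <;> linarith

lemma abs_moebius_le_one (n : ℕ) : |(ArithmeticFunction.moebius n : ℝ)| ≤ 1 := by
  exact_mod_cast ArithmeticFunction.abs_moebius_le_one (n := n)

/-- Approximate orthogonality of Ramanujan sums over an interval. -/
lemma abs_sum_ramanujanSum_mul_sub_le (b N q r : ℕ) (hq : 0 < q) (hr : 0 < r) :
    |∑ x ∈ Finset.Ioc b (b + N), ramanujanSum q x * ramanujanSum r x -
        N * (if r = q then (q.totient : ℝ) else 0)| ≤
      (∑ d ∈ q.divisors, (d : ℝ)) * ∑ d ∈ r.divisors, (d : ℝ) := by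
  have expand : ∑ x ∈ Finset.Ioc b (b + N), ramanujanSum q x * ramanujanSum r x =
      ∑ a ∈ q.divisorsAntidiagonal, ∑ c ∈ r.divisorsAntidiagonal,
        (ArithmeticFunction.moebius a.1 : ℝ) * (ArithmeticFunction.moebius c.1 : ℝ) * (a.2 * c.2) *
          (({x ∈ Finset.Ioc b (b + N) | Nat.lcm a.2 c.2 ∣ x}).card : ℝ) := by
    simp_rw [ramanujanSum, Finset.sum_mul_sum]
    rw [Finset.sum_comm]
    refine Finset.sum_congr rfl fun a _ => ?_
    rw [Finset.sum_comm]
    refine Finset.sum_congr rfl fun c _ => ?_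
    rw [Finset.card_filter, Nat.cast_sum, Finset.mul_sum]
    refine Finset.sum_congr rfl fun x _ => ?_
    simp only [Nat.lcm_dvd_iff]
    by_cases h1 : a.2 ∣ x <;> by_cases h2 : c.2 ∣ x <;> simp [h1, h2]
    ring
  rw [expand, ← sum_moebius_mul_moebius_mul_gcd q r hq hr, Finset.mul_sum,
    ← Finset.sum_sub_distrib]
  have hdiv : ∀ n : ℕ, ∑ d ∈ n.divisors, (d : ℝ) = ∑ a ∈ n.divisorsAntidiagonal, (a.2 : ℝ) :=
    fun n => (Nat.sum_divisorsAntidiagonal' (n := n) (fun _ d => (d : ℝ))).symm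
  rw [hdiv, hdiv, Finset.sum_mul_sum]
  refine (Finset.abs_sum_le_sum_abs _ _).trans (Finset.sum_le_sum fun a ha => ?_)
  rw [Finset.mul_sum, ← Finset.sum_sub_distrib]
  refine (Finset.abs_sum_le_sum_abs _ _).trans (Finset.sum_le_sum fun c hc => ?_)
  have ha2 : 0 < a.2 := Nat.pos_of_mem_divisors (Nat.snd_mem_divisors_of_mem_antidiagonal ha)
  have hc2 : 0 < c.2 := Nat.pos_of_mem_divisors (Nat.snd_mem_divisors_of_mem_antidiagonal hc)
  have hl : 0 < Nat.lcm a.2 c.2 := Nat.lcm_pos ha2 hc2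
  have hl' : (0 : ℝ) < (Nat.lcm a.2 c.2 : ℝ) := by exact_mod_cast hl
  have hgl : (Nat.gcd a.2 c.2 : ℝ) = (a.2 * c.2) / (Nat.lcm a.2 c.2 : ℝ) := by
    rw [eq_div_iff hl'.ne']; exact_mod_cast Nat.gcd_mul_lcm a.2 c.2
  have hcard := abs_card_multiples_sub_le b N _ hl
  have hrw : (ArithmeticFunction.moebius a.1 : ℝ) * (ArithmeticFunction.moebius c.1 : ℝ) *
      (a.2 * c.2) * (({x ∈ Finset.Ioc b (b + N) | Nat.lcm a.2 c.2 ∣ x}).card : ℝ) -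
      N * ((ArithmeticFunction.moebius a.1 : ℝ) * (ArithmeticFunction.moebius c.1 : ℝ) *
        (Nat.gcd a.2 c.2 : ℝ)) =
      (ArithmeticFunction.moebius a.1 : ℝ) * (ArithmeticFunction.moebius c.1 : ℝ) *
        ((a.2 * c.2) * ((({x ∈ Finset.Ioc b (b + N) | Nat.lcm a.2 c.2 ∣ x}).card : ℝ) -
          N / (Nat.lcm a.2 c.2 : ℝ))) := by
    rw [hgl]; ring
  rw [hrw, abs_mul, abs_mul, abs_mul]
  have hpos : (0 : ℝ) ≤ (a.2 : ℝ) * c.2 := by positivity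
  rw [abs_of_nonneg hpos]
  calc _ ≤ 1 * 1 * ((a.2 : ℝ) * c.2 * 1) := by
        gcongr
        · exact abs_moebius_le_one _
        · exact abs_moebius_le_one _
    _ = _ := by ring

lemma sq_moebius_of_squarefree {q : ℕ} (hq : Squarefree q) :
    (ArithmeticFunction.moebius q : ℝ) * (ArithmeticFunction.moebius q : ℝ) = 1 := by
  have := ArithmeticFunction.moebius_sq_eq_one_of_squarefree hq
  rw [← sq]; exact_mod_cast this

/-- The Selberg upper bound for the number of integers in an interval without odd prime
factors below `2 * u`. -/
lemma card_mul_sq_sieveMain_le (u b N : ℕ) (B : Finset ℕ) (hB : B ⊆ Finset.Ioc b (b + N))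
    (hcop : ∀ x ∈ B, ∀ q ∈ oddSquarefree u, Nat.Coprime q x) :
    (B.card : ℝ) * sieveMain u ^ 2 ≤ N * sieveMain u + sieveError u ^ 2 := by
  set c : ℕ → ℝ := fun q => (ArithmeticFunction.moebius q : ℝ) / q.totient with hc
  set W : ℕ → ℝ := fun x => ∑ q ∈ oddSquarefree u, c q * ramanujanSum q x with hW
  have hWB : ∀ x ∈ B, W x = sieveMain u := by
    intro x hx
    refine Finset.sum_congr rfl fun q hq => ?_
    have hr : ramanujanSum q x = ArithmeticFunction.moebius q := by
      have hq0 := pos_of_mem_oddSquarefree hq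
      rw [ramanujanSum, Finset.sum_eq_single (q, 1)]
      · simp
      · rintro ⟨a, d⟩ had hne
        have had' := Nat.mem_divisorsAntidiagonal.1 had
        have : ¬ d ∣ x := by
          intro hdx
          have hd1 : d = 1 := Nat.eq_one_of_dvd_coprimes (hcop x hx q hq)
            (Dvd.intro_left a had'.1) hdx
          subst hd1
          apply hne
          simpa using had'.1
        simp [this]
      · intro h
        exact absurd (Nat.mem_divisorsAntidiagonal.2 ⟨by simp, hq0.ne'⟩) h
    simp only [hc]
    rw [hr, div_mul_eq_mul_div, sq_moebius_of_squarefree (mem_oddSquarefree.1 hq).2.2]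
  have h1 : (B.card : ℝ) * sieveMain u ^ 2 ≤ ∑ x ∈ Finset.Ioc b (b + N), W x ^ 2 := by
    calc (B.card : ℝ) * sieveMain u ^ 2 = ∑ x ∈ B, W x ^ 2 := by
          rw [Finset.sum_congr rfl fun x hx => by rw [hWB x hx]]; simp
      _ ≤ _ := Finset.sum_le_sum_of_subset_of_nonneg hB fun _ _ _ => sq_nonneg _
  have h2 : ∑ x ∈ Finset.Ioc b (b + N), W x ^ 2 = ∑ q ∈ oddSquarefree u, ∑ r ∈ oddSquarefree u,
      c q * c r * ∑ x ∈ Finset.Ioc b (b + N), ramanujanSum q x * ramanujanSum r x := by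
    simp_rw [hW, sq, Finset.sum_mul_sum]
    rw [Finset.sum_comm]
    refine Finset.sum_congr rfl fun q _ => ?_
    rw [Finset.sum_comm]
    refine Finset.sum_congr rfl fun r _ => ?_
    rw [Finset.mul_sum]
    exact Finset.sum_congr rfl fun x _ => by ring
  have h3 : (N : ℝ) * sieveMain u = ∑ q ∈ oddSquarefree u, ∑ r ∈ oddSquarefree u,
      c q * c r * (N * (if r = q then (q.totient : ℝ) else 0)) := by
    rw [sieveMain, Finset.mul_sum]
    refine Finset.sum_congr rfl fun q hq => ?_
    have ht : (0 : ℝ) < q.totient := by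
      exact_mod_cast Nat.totient_pos.2 (pos_of_mem_oddSquarefree hq)
    simp only [mul_ite, mul_zero, Finset.sum_ite_eq', hq, if_true, hc]
    have := sq_moebius_of_squarefree (mem_oddSquarefree.1 hq).2.2
    field_simp
    rw [sq, this]
    ring
  have h4 : sieveError u ^ 2 = ∑ q ∈ oddSquarefree u, ∑ r ∈ oddSquarefree u,
      1 / (q.totient : ℝ) * (1 / r.totient) *
        ((∑ d ∈ q.divisors, (d : ℝ)) * ∑ d ∈ r.divisors, (d : ℝ)) := by
    rw [sq, sieveError, Finset.sum_mul_sum]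
    exact Finset.sum_congr rfl fun q _ => Finset.sum_congr rfl fun r _ => by ring
  rw [h2] at h1
  refine h1.trans ?_
  rw [h3, h4, ← Finset.sum_add_distrib]
  refine Finset.sum_le_sum fun q hq => ?_
  rw [← Finset.sum_add_distrib]
  refine Finset.sum_le_sum fun r hr => ?_
  have habs := abs_sum_ramanujanSum_mul_sub_le b N q r (pos_of_mem_oddSquarefree hq)
    (pos_of_mem_oddSquarefree hr)
  have hcabs : ∀ n, |c n| ≤ 1 / (n.totient : ℝ) := by
    intro n
    simp only [hc]
    rw [abs_div, Nat.abs_cast]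
    gcongr
    exact abs_moebius_le_one n
  rw [← sub_le_iff_le_add', ← mul_sub]
  refine (le_abs_self _).trans ?_
  rw [abs_mul, abs_mul]
  gcongr
  · exact hcabs q
  · exact hcabs r

/-- Some translate of a finite set has at least the expected number of elements coprime to `n`. -/
lemma exists_card_mul_totient_le (A : Finset ℕ) (n : ℕ) (hn : 0 < n) :
    ∃ a, A.card * n.totient ≤ n * ({m ∈ A | n.Coprime (m + a)}).card := by
  by_contra! h
  have hsum : ∑ a ∈ Finset.range n, ({m ∈ A | n.Coprime (m + a)}).card = A.card * n.totient := by
    simp_rw [Finset.card_filter]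
    rw [Finset.sum_comm, Finset.card_eq_sum_ones, Finset.sum_mul]
    refine Finset.sum_congr rfl fun m _ => ?_
    rw [← Finset.card_filter, one_mul, ← Nat.filter_coprime_Ico_eq_totient n m]
    refine Finset.card_bij (fun a _ => m + a) ?_ ?_ ?_
    · intro a ha
      simp only [Finset.mem_filter, Finset.mem_range, Finset.mem_Ico] at ha ⊢
      exact ⟨by omega, ha.2⟩
    · intro a _ b _ hab
      simpa using hab
    · intro b hb
      simp only [Finset.mem_filter, Finset.mem_range, Finset.mem_Ico] at hb ⊢
      refine ⟨b - m, ⟨by omega, ?_⟩, by omega⟩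
      rw [show m + (b - m) = b by omega]
      exact hb.2
  have hlt : ∑ a ∈ Finset.range n, n * ({m ∈ A | n.Coprime (m + a)}).card <
      ∑ _a ∈ Finset.range n, A.card * n.totient :=
    Finset.sum_lt_sum_of_nonempty (by simpa using hn.ne') fun a _ => h a
  rw [← Finset.mul_sum, hsum] at hlt
  simp at hlt

/-- The Selberg bound for primes in the progression `1 + t * m` with `m ≤ N`, where the
primes dividing the odd part `n` of `t` are sieved out of a suitable translate as well. -/
lemma card_mul_totient_mul_sq_sieveMain_le (u N k n : ℕ) (hn : Odd n) (A : Finset ℕ)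
    (hA : A ⊆ Finset.Ioc 0 N)
    (hprime : ∀ m ∈ A, (1 + 2 ^ k * n * m).Prime ∧ 2 * u ≤ 1 + 2 ^ k * n * m) :
    (A.card * n.totient : ℝ) * sieveMain u ^ 2 ≤
      n * (N * sieveMain u + sieveError u ^ 2) := by
  obtain ⟨a, ha⟩ := exists_card_mul_totient_le A n hn.pos
  set t := 2 ^ k * n with ht
  set P := ∏ p ∈ Finset.range (2 * u) with p.Prime ∧ ¬ p ∣ t, p with hP
  have hPt : P.Coprime t := by
    refine Nat.Coprime.prod_left fun p hp => ?_
    simp only [Finset.mem_filter] at hp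
    exact (Nat.Prime.coprime_iff_not_dvd hp.2.1).2 hp.2.2
  have hPpos : 0 < P := Finset.prod_pos fun p hp => by
    simp only [Finset.mem_filter] at hp
    exact hp.2.1.pos
  have hnP : n.Coprime P := (hPt.coprime_dvd_right (Dvd.intro_left _ rfl)).symm
  obtain ⟨b, hbn, hbP⟩ := Nat.chineseRemainder hnP a (t ^ (P.totient - 1))
  have hbt : b * t ≡ 1 [MOD P] := by
    have h := Nat.ModEq.pow_totient hPt.symm
    have hφ : P.totient = P.totient - 1 + 1 := by have := Nat.totient_pos.2 hPpos; omega
    rw [hφ, pow_succ] at h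
    exact (hbP.mul_right t).trans h
  set A' := ({m ∈ A | n.Coprime (m + a)}) with hA'
  have hsieve := card_mul_sq_sieveMain_le u b N (A'.image (fun m => m + b)) ?_ ?_
  · rw [Finset.card_image_of_injective _ (add_left_injective b)] at hsieve
    have hn' : (0 : ℝ) ≤ n := by positivity
    have ha' : (A.card * n.totient : ℝ) ≤ n * A'.card := by exact_mod_cast ha
    calc _ ≤ (n * A'.card : ℝ) * sieveMain u ^ 2 := by gcongr
      _ = n * (A'.card * sieveMain u ^ 2) := by ring
      _ ≤ _ := by gcongr
  · intro x hx
    obtain ⟨m, hm, rfl⟩ := Finset.mem_image.1 hx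
    have := Finset.mem_Ioc.1 (hA (Finset.mem_filter.1 hm).1)
    exact Finset.mem_Ioc.2 ⟨by omega, by omega⟩
  · intro x hx q hq
    obtain ⟨m, hm, rfl⟩ := Finset.mem_image.1 hx
    obtain ⟨hmA, hma⟩ := Finset.mem_filter.1 hm
    obtain ⟨hq1, hq2, -⟩ := mem_oddSquarefree.1 hq
    refine Nat.coprime_of_dvd fun p hp hpq hpx => ?_
    have hpu : p < 2 * u := (Nat.le_of_dvd hq2.pos hpq).trans_lt hq1
    by_cases hpt : p ∣ t
    · have hpn : p ∣ n := by
        refine (Nat.Coprime.dvd_mul_left (Nat.Coprime.pow_right k ?_)).1 hpt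
        exact (hq2.of_dvd_nat hpq).coprime_two_right
      have : p ∣ m + a := ((hbn.of_dvd hpn).add_left m).dvd_iff dvd_rfl |>.1 hpx
      exact hp.one_lt.ne' (Nat.eq_one_of_dvd_coprimes hma hpn this)
    · have hpP : p ∣ P := Finset.dvd_prod_of_mem (fun p => p) (by simp [hpu, hp, hpt])
      have h1 : p ∣ (m + b) * t := hpx.mul_right t
      have h2 : (m + b) * t ≡ 1 + t * m [MOD p] := by
        rw [add_mul, add_comm, mul_comm m]
        exact (hbt.of_dvd hpP).add_right _
      have h3 : p ∣ 1 + t * m := (h2.dvd_iff dvd_rfl).1 h1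
      have h4 := (Nat.prime_dvd_prime_iff_eq hp (hprime m hmA).1).1 h3
      have := (hprime m hmA).2
      omega

/-- The sum of `1 / k` over integers `k` with the same prime factors as `q` is at most
`1 / φ(q)`. -/
lemma sum_inv_le_inv_totient (q : ℕ) (hq : 0 < q) (S : Finset ℕ)
    (hS : ∀ k ∈ S, k ≠ 0 ∧ q ∣ k ∧ k.primeFactors = q.primeFactors) :
    ∑ k ∈ S, (1 : ℝ) / k ≤ 1 / q.totient := by
  let f : ℕ →* ℝ := ⟨⟨fun n => (n : ℝ)⁻¹, by simp⟩, fun a b => by simp [mul_comm]⟩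
  have hf : ∀ n, f n = (n : ℝ)⁻¹ := fun n => rfl
  have hsum := (EulerProduct.summable_and_hasSum_factoredNumbers_prod_filter_prime_geometric
    (f := f) (fun {p} hp => by
      rw [hf, norm_inv, Real.norm_natCast]
      exact inv_lt_one_of_one_lt₀ (by exact_mod_cast hp.one_lt)) q.primeFactors).2
  have hfilter : {p ∈ q.primeFactors | p.Prime} = q.primeFactors :=
    Finset.filter_true_of_mem fun p hp => Nat.prime_of_mem_primeFactors hp
  rw [hfilter] at hsum
  have hsum' := (hasSum_subtype_iff_indicator (f := fun m : ℕ => f m)).1 hsum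
  have hinj : Set.InjOn (fun k => k / q) (S : Set ℕ) := by
    intro k hk l hl hkl
    exact (Nat.div_left_inj (hS k hk).2.1 (hS l hl).2.1).1 hkl
  have hle := sum_le_hasSum (S.image fun k => k / q)
    (fun m _ => Set.indicator_nonneg (fun m _ => by rw [hf]; positivity) m) hsum'
  rw [Finset.sum_image hinj] at hle
  have hq' : (0 : ℝ) < q := by exact_mod_cast hq
  have hterm : ∀ k ∈ S, (1 : ℝ) / k = (q : ℝ)⁻¹ *
      (Nat.factoredNumbers q.primeFactors).indicator (fun m : ℕ => f m) (k / q) := by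
    intro k hk
    obtain ⟨h0, ⟨m, rfl⟩, hpf⟩ := hS k hk
    have hm0 : m ≠ 0 := by rintro rfl; simp at h0
    rw [Nat.mul_div_cancel_left m hq, Set.indicator_of_mem, hf]
    · push_cast
      rw [one_div, mul_inv]
    · rw [Nat.mem_factoredNumbers_iff_primeFactors_subset]
      refine ⟨hm0, ?_⟩
      rw [← hpf]
      exact Nat.primeFactors_mono (Dvd.intro_left q rfl) h0
  rw [Finset.sum_congr rfl hterm, ← Finset.mul_sum]
  have htot : (q.totient : ℝ) = q * ∏ p ∈ q.primeFactors, (1 - (p : ℝ)⁻¹) := by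
    have := Nat.totient_eq_mul_prod_factors q
    have h := congrArg (fun x : ℚ => (x : ℝ)) this
    push_cast at h
    exact h
  rw [htot, one_div, mul_inv, ← Finset.prod_inv_distrib]
  gcongr
  exact hle

lemma sum_inv_odd_le_sieveMain (u : ℕ) :
    ∑ i ∈ Finset.range u, (1 : ℝ) / (2 * i + 1 : ℕ) ≤ sieveMain u := by
  have hrange : ∑ i ∈ Finset.range u, (1 : ℝ) / (2 * i + 1 : ℕ) =
      ∑ k ∈ (Finset.range u).image (fun i : ℕ => 2 * i + 1), (1 : ℝ) / (k : ℕ) := by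
    rw [Finset.sum_image]
    intro a _ b _ h
    simpa using h
  set K := (Finset.range u).image (fun i : ℕ => 2 * i + 1) with hK
  have hKmem : ∀ k ∈ K, Odd k ∧ k < 2 * u := by
    intro k hk
    obtain ⟨i, hi, rfl⟩ := Finset.mem_image.1 hk
    exact ⟨odd_two_mul_add_one i, by have := Finset.mem_range.1 hi; omega⟩
  have hmaps : ∀ k ∈ K, UniqueFactorizationMonoid.radical k ∈ oddSquarefree u := by
    intro k hk
    obtain ⟨h1, h2⟩ := hKmem k hk
    have hdvd : UniqueFactorizationMonoid.radical k ∣ k :=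
      UniqueFactorizationMonoid.radical_dvd_self
    exact mem_oddSquarefree.2 ⟨(Nat.le_of_dvd h1.pos hdvd).trans_lt h2, h1.of_dvd_nat hdvd,
      UniqueFactorizationMonoid.squarefree_radical⟩
  rw [hrange, ← Finset.sum_fiberwise_of_maps_to hmaps, sieveMain]
  refine Finset.sum_le_sum fun q hq => ?_
  refine sum_inv_le_inv_totient q (pos_of_mem_oddSquarefree hq) _ fun k hk => ?_
  obtain ⟨hk1, hk2⟩ := Finset.mem_filter.1 hk
  refine ⟨(hKmem k hk1).1.pos.ne', ?_, ?_⟩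
  · rw [← hk2]
    exact UniqueFactorizationMonoid.radical_dvd_self
  · rw [← hk2]
    exact (Nat.primeFactors_radical k).symm

lemma log_succ_div_le {x : ℝ} (hx : 0 < x) :
    Real.log ((x + 1) / x) ≤ (1 / x + 1 / (x + 1)) / 2 := by
  have hy : 0 < (x + 1) / x := by positivity
  have h1 : 1 ≤ (x + 1) / x := by rw [le_div_iff₀ hx]; linarith
  have h := Real.self_le_sinh_iff.2 (Real.log_nonneg h1)
  rw [Real.sinh_log hy] at h
  refine h.trans (le_of_eq ?_)
  field_simp
  ring

lemma log_le_sum_inv_odd (u : ℕ) (hu : 16 ≤ u) :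
    Real.log (u + 1 / 64) / 2 + 0.98 ≤ ∑ i ∈ Finset.range u, (1 : ℝ) / (2 * i + 1 : ℕ) := by
  induction u, hu using Nat.le_induction with
  | base =>
    have h : Real.log ((16 : ℕ) + 1 / 64) ≤ 4 * Real.log 2 + 1 / 1024 := by
      have h1 : (((16 : ℕ) : ℝ) + 1 / 64) = 2 ^ 4 * (1 + 1 / 1024) := by norm_num
      rw [h1, Real.log_mul (by norm_num) (by norm_num), Real.log_pow]
      have := Real.log_le_sub_one_of_pos (show (0 : ℝ) < 1 + 1 / 1024 by norm_num)
      push_cast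
      linarith
    have h2 := Real.log_two_lt_d9
    norm_num [Finset.sum_range_succ] at h ⊢
    linarith
  | succ n hn ih =>
    have hn' : (16 : ℝ) ≤ n := by exact_mod_cast hn
    rw [Finset.sum_range_succ]
    have hx : (0 : ℝ) < n + 1 / 64 := by positivity
    have h := log_succ_div_le hx
    rw [Real.log_div (by positivity) (by positivity)] at h
    have hle : (1 / ((n : ℝ) + 1 / 64) + 1 / (n + 1 / 64 + 1)) / 2 ≤ 2 * (1 / (2 * n + 1)) := by
      rw [div_add_div _ _ (by positivity) (by positivity), div_div, mul_one_div,
        div_le_div_iff₀ (by positivity) (by positivity)]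
      nlinarith
    push_cast at ih ⊢
    rw [show (n : ℝ) + 1 + 1 / 64 = n + 1 / 64 + 1 by ring]
    linarith

lemma log_le_sieveMain (u : ℕ) (hu : 16 ≤ u) : Real.log u / 2 + 0.98 ≤ sieveMain u := by
  have hu' : (16 : ℝ) ≤ u := by exact_mod_cast hu
  have h : Real.log u ≤ Real.log (u + 1 / 64) := Real.log_le_log (by linarith) (by linarith)
  linarith [log_le_sum_inv_odd u hu, sum_inv_odd_le_sieveMain u]

/-- The multiplicative function with value `2 / (p - 1)` at the prime `p` for which
`σ(q) / φ(q)` is the divisor sum on squarefree `q`. -/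
noncomputable def ratioWeight : ArithmeticFunction ℝ :=
  ArithmeticFunction.prodPrimeFactors fun p => 2 / ((p : ℝ) - 1)

lemma ratioWeight_apply {d : ℕ} (hd : d ≠ 0) :
    ratioWeight d = ∏ p ∈ d.primeFactors, 2 / ((p : ℝ) - 1) :=
  ArithmeticFunction.prodPrimeFactors_apply hd

lemma two_le_of_mem_primeFactors {d p : ℕ} (hp : p ∈ d.primeFactors) : (2 : ℝ) ≤ p := by
  exact_mod_cast (Nat.prime_of_mem_primeFactors hp).two_le

lemma ratioWeight_nonneg (d : ℕ) : 0 ≤ ratioWeight d := by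
  rcases eq_or_ne d 0 with rfl | hd
  · simp
  rw [ratioWeight_apply hd]
  refine Finset.prod_nonneg fun p hp => ?_
  have := two_le_of_mem_primeFactors hp
  exact div_nonneg (by norm_num) (by linarith)

lemma sum_divisors_div_totient_eq {q : ℕ} (hq : Squarefree q) :
    (∑ d ∈ q.divisors, (d : ℝ)) / q.totient = ∑ d ∈ q.divisors, ratioWeight d := by
  have hσ : ∑ d ∈ q.divisors, (d : ℝ) = ∏ p ∈ q.primeFactors, (1 + (p : ℝ)) := by
    have h := (ArithmeticFunction.isMultiplicative_id.natCast
      (R := ℝ)).prodPrimeFactors_one_add_of_squarefree hq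
    simpa using h.symm
  have hφ : (q.totient : ℝ) = ∏ p ∈ q.primeFactors, ((p : ℝ) - 1) := by
    have h := Nat.totient_mul_prod_primeFactors q
    rw [Nat.prod_primeFactors_of_squarefree hq, mul_comm] at h
    have h' := Nat.eq_of_mul_eq_mul_left (Nat.pos_of_ne_zero hq.ne_zero) h
    rw [h', Nat.cast_prod]
    refine Finset.prod_congr rfl fun p hp => ?_
    rw [Nat.cast_sub (Nat.prime_of_mem_primeFactors hp).one_le, Nat.cast_one]
  have hw : ∑ d ∈ q.divisors, ratioWeight d =
      ∏ p ∈ q.primeFactors, (1 + ratioWeight p) :=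
    (ArithmeticFunction.IsMultiplicative.prodPrimeFactors_one_add_of_squarefree
      (ArithmeticFunction.IsMultiplicative.prodPrimeFactors _) hq).symm
  rw [hσ, hφ, hw, ← Finset.prod_div_distrib]
  refine Finset.prod_congr rfl fun p hp => ?_
  have h2 := two_le_of_mem_primeFactors hp
  have hp' := Nat.prime_of_mem_primeFactors hp
  rw [ratioWeight_apply hp'.ne_zero, hp'.primeFactors, Finset.prod_singleton]
  have : (p : ℝ) - 1 ≠ 0 := by linarith
  field_simp
  ring

lemma prod_one_add_le (u : ℕ) (hu : 2 ≤ u) :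
    ∏ i ∈ Finset.Ico 1 u, (1 + 1 / ((i : ℝ) * (2 * i + 1))) ≤
      16 / 9 * ((2 * u - 1) / (2 * u)) := by
  induction u, hu using Nat.le_induction with
  | base => norm_num
  | succ n hn ih =>
    have hn' : (2 : ℝ) ≤ n := by exact_mod_cast hn
    rw [Finset.prod_Ico_succ_top (by omega)]
    refine (mul_le_mul_of_nonneg_right ih (by positivity)).trans ?_
    push_cast
    rw [mul_assoc]
    gcongr
    rw [one_add_div (by positivity), div_mul_div_comm, div_le_div_iff₀ (by positivity) (by positivity)]
    nlinarith [mul_nonneg (sub_nonneg.2 hn') (sub_nonneg.2 hn')]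

lemma sum_ratioWeight_div_le (u : ℕ) (hu : 2 ≤ u) :
    ∑ d ∈ oddSquarefree u, ratioWeight d / d ≤ 16 / 9 := by
  set s := {i ∈ Finset.Ico 1 u | (2 * i + 1).Prime} with hs
  set T := s.image (fun i => 2 * i + 1) with hT
  set P := ∏ p ∈ T, p with hP
  have hTp : ∀ p ∈ T, p.Prime := by
    intro p hp
    obtain ⟨i, hi, rfl⟩ := Finset.mem_image.1 hp
    exact (Finset.mem_filter.1 hi).2
  have hPf : P.primeFactors = T := Nat.primeFactors_prod hTp
  have hP0 : P ≠ 0 := Finset.prod_ne_zero_iff.2 fun p hp => (hTp p hp).ne_zero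
  have hPsq : Squarefree P := by
    rw [hP]
    refine Finset.squarefree_prod_of_pairwise_isCoprime ?_ fun p hp => (hTp p hp).prime.squarefree
    intro p hp r hr hpr
    rw [Function.onFun, ← Nat.coprime_iff_isRelPrime]
    exact (Nat.coprime_primes (hTp p hp) (hTp r hr)).2 hpr
  set f : ArithmeticFunction ℝ :=
    ArithmeticFunction.prodPrimeFactors fun p => 2 / (((p : ℝ) - 1) * p) with hf
  have hf0 : ∀ d, 0 ≤ f d := by
    intro d
    rcases eq_or_ne d 0 with rfl | hd
    · simp
    rw [hf, ArithmeticFunction.prodPrimeFactors_apply hd]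
    refine Finset.prod_nonneg fun p hp => ?_
    have := two_le_of_mem_primeFactors hp
    exact div_nonneg (by norm_num) (mul_nonneg (by linarith) (by linarith))
  have hfd : ∀ d ∈ oddSquarefree u, ratioWeight d / d = f d := by
    intro d hd
    have hsq := (mem_oddSquarefree.1 hd).2.2
    have hd0 := hsq.ne_zero
    have hdp : (d : ℝ) = ∏ p ∈ d.primeFactors, (p : ℝ) := by
      rw [← Nat.cast_prod, Nat.prod_primeFactors_of_squarefree hsq]
    rw [ratioWeight_apply hd0, hf, ArithmeticFunction.prodPrimeFactors_apply hd0, hdp,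
      ← Finset.prod_div_distrib]
    exact Finset.prod_congr rfl fun p _ => div_div _ _ _
  have hsub : oddSquarefree u ⊆ P.divisors := by
    intro d hd
    obtain ⟨h1, h2, h3⟩ := mem_oddSquarefree.1 hd
    refine Nat.mem_divisors.2 ⟨?_, hP0⟩
    rw [← Nat.prod_primeFactors_of_squarefree h3, hP]
    refine Finset.prod_dvd_prod_of_subset _ _ _ fun p hp => ?_
    have hpp := Nat.prime_of_mem_primeFactors hp
    have hpd := Nat.dvd_of_mem_primeFactors hp
    obtain ⟨i, hi⟩ := h2.of_dvd_nat hpd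
    have hle := Nat.le_of_dvd h2.pos hpd
    have := hpp.two_le
    exact Finset.mem_image.2 ⟨i, Finset.mem_filter.2
      ⟨Finset.mem_Ico.2 ⟨by omega, by omega⟩, hi ▸ hpp⟩, hi.symm⟩
  calc ∑ d ∈ oddSquarefree u, ratioWeight d / d = ∑ d ∈ oddSquarefree u, f d :=
        Finset.sum_congr rfl hfd
    _ ≤ ∑ d ∈ P.divisors, f d := Finset.sum_le_sum_of_subset_of_nonneg hsub fun d _ _ => hf0 d
    _ = ∏ p ∈ P.primeFactors, (1 + f p) :=
        (ArithmeticFunction.IsMultiplicative.prodPrimeFactors_one_add_of_squarefree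
          (ArithmeticFunction.IsMultiplicative.prodPrimeFactors _) hPsq).symm
    _ = ∏ i ∈ s, (1 + 1 / ((i : ℝ) * (2 * i + 1))) := by
        rw [hPf, hT, Finset.prod_image (by intro a _ b _ h; simpa using h)]
        refine Finset.prod_congr rfl fun i hi => ?_
        obtain ⟨hi1, hi2⟩ := Finset.mem_filter.1 hi
        rw [hf, ArithmeticFunction.prodPrimeFactors_apply hi2.ne_zero, hi2.primeFactors,
          Finset.prod_singleton]
        have : (1 : ℝ) ≤ i := by exact_mod_cast (Finset.mem_Ico.1 hi1).1
        push_cast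
        field_simp
        ring
    _ ≤ ∏ i ∈ Finset.Ico 1 u, (1 + 1 / ((i : ℝ) * (2 * i + 1))) := by
        rw [hs, Finset.prod_filter]
        refine Finset.prod_le_prod (fun i _ => by split_ifs <;> positivity) fun i _ => ?_
        split_ifs
        · exact le_rfl
        · have : 0 ≤ 1 / ((i : ℝ) * (2 * i + 1)) := by positivity
          linarith
    _ ≤ 16 / 9 * ((2 * u - 1) / (2 * u)) := prod_one_add_le u hu
    _ ≤ 16 / 9 := by
        have : (2 : ℝ) ≤ u := by exact_mod_cast hu
        have h : (2 * (u : ℝ) - 1) / (2 * u) ≤ 1 := by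
          rw [div_le_one (by positivity)]; linarith
        linarith

lemma ratioWeight_le {d : ℕ} (hodd : Odd d) (hd : Squarefree d) :
    ratioWeight d ≤ 2 / √d := by
  have hd0 : (0 : ℝ) < d := by exact_mod_cast hodd.pos
  have hkey : ratioWeight d ^ 2 * d ≤ 4 := by
    have hdp : (d : ℝ) = ∏ p ∈ d.primeFactors, (p : ℝ) := by
      rw [← Nat.cast_prod, Nat.prod_primeFactors_of_squarefree hd]
    rw [ratioWeight_apply hd.ne_zero, hdp, ← Finset.prod_pow, ← Finset.prod_mul_distrib]
    calc ∏ p ∈ d.primeFactors, (2 / ((p : ℝ) - 1)) ^ 2 * (p : ℝ)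
        ≤ ∏ p ∈ d.primeFactors, (if p = 3 then (3 : ℝ) else 1) * (if p = 5 then 5 / 4 else 1) := by
          refine Finset.prod_le_prod (fun p _ => by positivity) fun p hp => ?_
          have hpp := Nat.prime_of_mem_primeFactors hp
          have hpo := hodd.of_dvd_nat (Nat.dvd_of_mem_primeFactors hp)
          by_cases h3 : p = 3
          · subst h3; norm_num
          by_cases h5 : p = 5
          · subst h5; norm_num
          have h7 : 7 ≤ p := by
            have := hpp.two_le
            obtain ⟨i, rfl⟩ := hpo
            omega
          have h7' : (7 : ℝ) ≤ p := by exact_mod_cast h7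
          simp only [h3, h5, if_false, mul_one]
          have hpos : (0 : ℝ) < p - 1 := by linarith
          rw [div_pow, div_mul_eq_mul_div, div_le_one (by positivity)]
          nlinarith
      _ ≤ 3 * (5 / 4) := by
          rw [Finset.prod_mul_distrib, Finset.prod_ite_eq', Finset.prod_ite_eq']
          split_ifs <;> norm_num
      _ ≤ 4 := by norm_num
  rw [le_div_iff₀ (Real.sqrt_pos.2 hd0)]
  refine abs_le_of_sq_le_sq' ?_ (by norm_num) |>.2
  rw [mul_pow, Real.sq_sqrt hd0.le]
  linarith

lemma sum_inv_sqrt_odd_le (u : ℕ) (hu : 1 ≤ u) :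
    ∑ i ∈ Finset.range u, 1 / √((2 * i + 1 : ℕ) : ℝ) ≤ √(2 * u - 1) := by
  induction u, hu using Nat.le_induction with
  | base => norm_num
  | succ n hn ih =>
    have hn' : (1 : ℝ) ≤ n := by exact_mod_cast hn
    rw [Finset.sum_range_succ]
    push_cast at ih ⊢
    rw [show (2 : ℝ) * (n + 1) - 1 = 2 * n + 1 by ring]
    have ha : 0 < √(2 * (n : ℝ) + 1) := Real.sqrt_pos.2 (by linarith)
    have hb : 0 ≤ √(2 * (n : ℝ) - 1) := Real.sqrt_nonneg _
    have ha2 := Real.sq_sqrt (show 0 ≤ 2 * (n : ℝ) + 1 by linarith)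
    have hb2 := Real.sq_sqrt (show 0 ≤ 2 * (n : ℝ) - 1 by linarith)
    have : 1 / √(2 * (n : ℝ) + 1) ≤ √(2 * (n : ℝ) + 1) - √(2 * (n : ℝ) - 1) := by
      rw [div_le_iff₀ ha]
      nlinarith [sq_nonneg (√(2 * (n : ℝ) + 1) - √(2 * (n : ℝ) - 1))]
    linarith

lemma sum_ratioWeight_le (u : ℕ) (hu : 1 ≤ u) :
    ∑ d ∈ oddSquarefree u, ratioWeight d ≤ 2 * √(2 * u - 1) := by
  calc ∑ d ∈ oddSquarefree u, ratioWeight d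
      ≤ ∑ d ∈ oddSquarefree u, 2 / √(d : ℝ) := Finset.sum_le_sum fun d hd =>
        ratioWeight_le (mem_oddSquarefree.1 hd).2.1 (mem_oddSquarefree.1 hd).2.2
    _ ≤ ∑ d ∈ (Finset.range u).image (fun i : ℕ => 2 * i + 1), 2 / √((d : ℕ) : ℝ) := by
        refine Finset.sum_le_sum_of_subset_of_nonneg (fun d hd => ?_) fun _ _ _ => by positivity
        obtain ⟨h1, ⟨i, hi⟩, -⟩ := mem_oddSquarefree.1 hd
        exact Finset.mem_image.2 ⟨i, Finset.mem_range.2 (by omega), hi.symm⟩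
    _ = 2 * ∑ i ∈ Finset.range u, 1 / √((2 * i + 1 : ℕ) : ℝ) := by
        rw [Finset.sum_image (by intro a _ b _ h; simpa using h), Finset.mul_sum]
        exact Finset.sum_congr rfl fun i _ => by ring
    _ ≤ _ := by
        have := sum_inv_sqrt_odd_le u hu
        linarith

lemma card_filter_dvd_oddSquarefree_le (u d : ℕ) (hu : 1 ≤ u) (hd : 0 < d) :
    (({q ∈ oddSquarefree u | d ∣ q}).card : ℝ) ≤ ((2 * u - 1) / d + 1) / 2 := by
  have hcard : ({q ∈ oddSquarefree u | d ∣ q}).card ≤ ((2 * u - 1) / d + 1) / 2 := by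
    rw [← Finset.card_range (((2 * u - 1) / d + 1) / 2)]
    have hspec : ∀ q ∈ ({q ∈ oddSquarefree u | d ∣ q}),
        ∃ i, q = d * (2 * i + 1) ∧ 2 * i + 1 ≤ (2 * u - 1) / d := by
      intro q hq
      obtain ⟨hq1, m, rfl⟩ := Finset.mem_filter.1 hq
      obtain ⟨h1, h2, -⟩ := mem_oddSquarefree.1 hq1
      obtain ⟨i, hi⟩ := h2.of_dvd_nat (Dvd.intro_left d rfl)
      refine ⟨i, by rw [hi], ?_⟩
      rw [Nat.le_div_iff_mul_le hd, ← hi, mul_comm]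
      omega
    refine Finset.card_le_card_of_injOn (fun q => q / d / 2) ?_ ?_
    · intro q hq
      obtain ⟨i, rfl, hi⟩ := hspec q hq
      simp only [Finset.coe_range, Set.mem_Iio]
      rw [Nat.mul_div_cancel_left _ hd]
      omega
    · intro q hq r hr hqr
      obtain ⟨i, rfl, -⟩ := hspec q hq
      obtain ⟨k, rfl, -⟩ := hspec r hr
      simp only [Nat.mul_div_cancel_left _ hd] at hqr
      rw [show i = k by omega]
  have h1 : ((((2 * u - 1) / d + 1) / 2 : ℕ) : ℝ) ≤ (((2 * u - 1) / d + 1 : ℕ) : ℝ) / 2 :=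
    Nat.cast_div_le
  have h2 : (((2 * u - 1) / d : ℕ) : ℝ) ≤ ((2 * u - 1 : ℕ) : ℝ) / d := Nat.cast_div_le
  rw [Nat.cast_sub (by omega)] at h2
  push_cast at h1 h2
  have h3 : (({q ∈ oddSquarefree u | d ∣ q}).card : ℝ) ≤
      ((((2 * u - 1) / d + 1) / 2 : ℕ) : ℝ) := by exact_mod_cast hcard
  linarith

lemma sieveError_le (u : ℕ) (hu : 2 ≤ u) :
    sieveError u ≤ 8 / 9 * (2 * u - 1) + √(2 * u - 1) := by
  have hu' : (2 : ℝ) ≤ u := by exact_mod_cast hu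
  calc sieveError u = ∑ q ∈ oddSquarefree u, ∑ d ∈ oddSquarefree u,
        if d ∣ q then ratioWeight d else 0 := by
        refine Finset.sum_congr rfl fun q hq => ?_
        obtain ⟨h1, h2, h3⟩ := mem_oddSquarefree.1 hq
        rw [sum_divisors_div_totient_eq h3, ← Finset.sum_filter]
        refine Finset.sum_congr ?_ fun _ _ => rfl
        ext d
        simp only [Nat.mem_divisors, Finset.mem_filter, mem_oddSquarefree]
        constructor
        · rintro ⟨h, -⟩
          exact ⟨⟨(Nat.le_of_dvd h2.pos h).trans_lt h1, h2.of_dvd_nat h,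
            h3.squarefree_of_dvd h⟩, h⟩
        · rintro ⟨-, h⟩
          exact ⟨h, h3.ne_zero⟩
    _ = ∑ d ∈ oddSquarefree u, ratioWeight d * ({q ∈ oddSquarefree u | d ∣ q}).card := by
        rw [Finset.sum_comm]
        refine Finset.sum_congr rfl fun d _ => ?_
        rw [← Finset.sum_filter, Finset.sum_const, nsmul_eq_mul, mul_comm]
    _ ≤ ∑ d ∈ oddSquarefree u, ratioWeight d * (((2 * u - 1) / d + 1) / 2) :=
        Finset.sum_le_sum fun d hd => mul_le_mul_of_nonneg_left
          (card_filter_dvd_oddSquarefree_le u d (by omega) (pos_of_mem_oddSquarefree hd))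
          (ratioWeight_nonneg d)
    _ = (2 * u - 1) / 2 * ∑ d ∈ oddSquarefree u, ratioWeight d / d +
          (∑ d ∈ oddSquarefree u, ratioWeight d) / 2 := by
        rw [Finset.mul_sum, Finset.sum_div, ← Finset.sum_add_distrib]
        exact Finset.sum_congr rfl fun d _ => by ring
    _ ≤ (2 * u - 1) / 2 * (16 / 9) + 2 * √(2 * u - 1) / 2 := by
        gcongr
        · linarith
        · exact sum_ratioWeight_div_le u hu
        · exact sum_ratioWeight_le u (by omega)
    _ = _ := by ring

lemma oddSquarefree_eq_filter {u : ℕ} (hu : u ≤ 18) :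
    oddSquarefree u = {q ∈ Finset.range (2 * u) | q % 2 = 1 ∧ q % 9 ≠ 0 ∧ q % 25 ≠ 0} := by
  refine Finset.filter_congr fun q hq => ?_
  have hq' := Finset.mem_range.1 hq
  rw [Nat.odd_iff]
  refine and_congr_right fun hodd => ?_
  rw [Nat.squarefree_iff_prime_squarefree]
  constructor
  · intro h
    have h3 := h 3 Nat.prime_three
    have h5 := h 5 Nat.prime_five
    omega
  · rintro ⟨h3, h5⟩ p hp hpq
    have hle := Nat.le_of_dvd (by omega) hpq
    have hp6 : p < 6 := by nlinarith
    have hp2 := hp.two_le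
    interval_cases p <;> omega

lemma oddSquarefree_seven : oddSquarefree 7 = {1, 3, 5, 7, 11, 13} := by
  rw [oddSquarefree_eq_filter (by norm_num)]
  decide

lemma sieveMain_seven : sieveMain 7 = 21 / 10 := by
  rw [sieveMain, oddSquarefree_seven]
  simp [show Nat.totient 3 = 2 by decide, show Nat.totient 5 = 4 by decide,
    show Nat.totient 7 = 6 by decide, show Nat.totient 11 = 10 by decide,
    show Nat.totient 13 = 12 by decide]
  norm_num

lemma sieveError_seven : sieveError 7 = 41 / 5 := by
  rw [sieveError, oddSquarefree_seven]
  simp [show Nat.totient 3 = 2 by decide, show Nat.totient 5 = 4 by decide,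
    show Nat.totient 7 = 6 by decide, show Nat.totient 11 = 10 by decide,
    show Nat.totient 13 = 12 by decide,
    show Nat.divisors 3 = {1, 3} by decide, show Nat.divisors 5 = {1, 5} by decide,
    show Nat.divisors 7 = {1, 7} by decide, show Nat.divisors 11 = {1, 11} by decide,
    show Nat.divisors 13 = {1, 13} by decide]
  norm_num

lemma oddSquarefree_eighteen :
    oddSquarefree 18 = {1, 3, 5, 7, 11, 13, 15, 17, 19, 21, 23, 29, 31, 33, 35} := by
  rw [oddSquarefree_eq_filter (by norm_num)]
  decide

lemma log_natCast_le {N k : ℕ} (hN : 0 < N) (h : N ≤ 2 ^ k) :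
    Real.log N ≤ k * 0.6931471808 := by
  calc Real.log N ≤ Real.log ((2 : ℝ) ^ k) :=
        Real.log_le_log (by exact_mod_cast hN) (by exact_mod_cast h)
    _ = k * Real.log 2 := Real.log_pow _ _
    _ ≤ _ := by
        have := Real.log_two_lt_d9
        gcongr

lemma mul_log_le_sqrt {s : ℝ} (hs : 128 ≤ s) :
    Real.log (s ^ 2) * (Real.log (s ^ 2) + 1.147) ≤ 1.4 * s := by
  set r := √(s / 128) with hr
  have hr2 : r ^ 2 = s / 128 := Real.sq_sqrt (by linarith)
  have hr1 : 1 ≤ r := Real.one_le_sqrt.2 (by linarith)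
  have hs2 : s ^ 2 = 2 ^ 14 * r ^ 4 := by
    rw [show r ^ 4 = (r ^ 2) ^ 2 by ring, hr2]; ring
  have hlog : Real.log (s ^ 2) = 14 * Real.log 2 + 4 * Real.log r := by
    rw [hs2, Real.log_mul (by norm_num) (by positivity), Real.log_pow, Real.log_pow]
    norm_num
  have h1 := Real.log_two_lt_d9
  have h2 : Real.log r ≤ r - 1 := Real.log_le_sub_one_of_pos (by linarith)
  have h3 : 0 ≤ Real.log (s ^ 2) := Real.log_nonneg (by nlinarith)
  have h4 : Real.log (s ^ 2) ≤ 9.705 * r := by linarith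
  calc Real.log (s ^ 2) * (Real.log (s ^ 2) + 1.147) ≤ (9.705 * r) * (10.852 * r) :=
        mul_le_mul h4 (by linarith) (by linarith) (by linarith)
    _ ≤ 1.4 * s := by nlinarith

lemma sieveMain_eighteen : sieveMain 18 = 145949 / 55440 := by
  rw [sieveMain, oddSquarefree_eighteen]
  simp [show Nat.totient 3 = 2 by decide,
    show Nat.totient 5 = 4 by decide,
    show Nat.totient 7 = 6 by decide,
    show Nat.totient 11 = 10 by decide,
    show Nat.totient 13 = 12 by decide,
    show Nat.totient 15 = 8 by decide,
    show Nat.totient 17 = 16 by decide,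
    show Nat.totient 19 = 18 by decide,
    show Nat.totient 21 = 12 by decide,
    show Nat.totient 23 = 22 by decide,
    show Nat.totient 29 = 28 by decide,
    show Nat.totient 31 = 30 by decide,
    show Nat.totient 33 = 20 by decide,
    show Nat.totient 35 = 24 by decide]
  norm_num

lemma sieveError_eighteen : sieveError 18 = 131569 / 5544 := by
  rw [sieveError, oddSquarefree_eighteen]
  simp [show Nat.totient 3 = 2 by decide,
    show Nat.totient 5 = 4 by decide,
    show Nat.totient 7 = 6 by decide,
    show Nat.totient 11 = 10 by decide,
    show Nat.totient 13 = 12 by decide,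
    show Nat.totient 15 = 8 by decide,
    show Nat.totient 17 = 16 by decide,
    show Nat.totient 19 = 18 by decide,
    show Nat.totient 21 = 12 by decide,
    show Nat.totient 23 = 22 by decide,
    show Nat.totient 29 = 28 by decide,
    show Nat.totient 31 = 30 by decide,
    show Nat.totient 33 = 20 by decide,
    show Nat.totient 35 = 24 by decide,
    show Nat.divisors 3 = {1, 3} by decide,
    show Nat.divisors 5 = {1, 5} by decide,
    show Nat.divisors 7 = {1, 7} by decide,
    show Nat.divisors 11 = {1, 11} by decide,
    show Nat.divisors 13 = {1, 13} by decide,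
    show Nat.divisors 15 = {1, 3, 5, 15} by decide,
    show Nat.divisors 17 = {1, 17} by decide,
    show Nat.divisors 19 = {1, 19} by decide,
    show Nat.divisors 21 = {1, 3, 7, 21} by decide,
    show Nat.divisors 23 = {1, 23} by decide,
    show Nat.divisors 29 = {1, 29} by decide,
    show Nat.divisors 31 = {1, 31} by decide,
    show Nat.divisors 33 = {1, 3, 11, 33} by decide,
    show Nat.divisors 35 = {1, 5, 7, 35} by decide]
  norm_num

lemma exists_log_mul_le_of_large (N : ℕ) (hN : 16384 ≤ N) : ∃ u : ℕ, 1 ≤ u ∧ 0 < sieveMain u ∧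
    Real.log N * (N * sieveMain u + sieveError u ^ 2 + (u - 1) * sieveMain u ^ 2) ≤
      4 * N * sieveMain u ^ 2 := by
  have hN' : (16384 : ℝ) ≤ N := by exact_mod_cast hN
  set s := √(N : ℝ) with hs
  have hsN : s ^ 2 = N := Real.sq_sqrt (by linarith)
  have hs128 : 128 ≤ s := Real.le_sqrt_of_sq_le (by linarith)
  set u := ⌊s / 4⌋₊ + 1 with hu
  have hu1 : (u : ℝ) - 1 ≤ s / 4 := by
    have := Nat.floor_le (show 0 ≤ s / 4 by linarith)
    rw [hu]; push_cast; linarith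
  have hu2 : s / 4 ≤ u := by
    have := (Nat.lt_floor_add_one (s / 4)).le
    rw [hu]; push_cast; linarith
  have hu16 : 16 ≤ u := by
    have : (16 : ℝ) ≤ u := by linarith
    exact_mod_cast this
  have hlog := mul_log_le_sqrt hs128
  have hG := log_le_sieveMain u hu16
  have hE := sieveError_le u (by omega)
  have hE0 : 0 ≤ sieveError u := Finset.sum_nonneg fun _ _ => by positivity
  have hlogu : Real.log (s ^ 2) / 2 - 2 * Real.log 2 ≤ Real.log u := by
    calc Real.log (s ^ 2) / 2 - 2 * Real.log 2 = Real.log (s / 2 ^ 2) := by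
          rw [Real.log_div (by linarith) (by norm_num), Real.log_pow, Real.log_pow]
          push_cast; ring
      _ ≤ Real.log u := Real.log_le_log (by positivity) (by linarith)
  have hℓ0 : 0 ≤ Real.log (s ^ 2) := Real.log_nonneg (by nlinarith)
  rw [← hsN]
  set l := Real.log (s ^ 2) with hl
  set G := sieveMain u with hGdef
  set E := sieveError u with hEdef
  have hG' : (l + 1.147) / 4 ≤ G := by
    have := Real.log_two_lt_d9
    linarith
  have hG0 : 0 < G := by linarith
  have hroot : √(2 * (u : ℝ) - 1) ≤ 0.063 * s := by
    refine Real.sqrt_le_iff.2 ⟨by linarith, ?_⟩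
    nlinarith
  have hE2 : E ≤ 0.5145 * s := by linarith
  have hE3 : E ^ 2 ≤ 0.26475 * s ^ 2 := by nlinarith
  refine ⟨u, by omega, hG0, ?_⟩
  have hstep : l * (s * G + 0.26475 * s + G ^ 2 / 4) ≤ 4 * s * G ^ 2 := by
    have hls : l ≤ 1.4 * s := by nlinarith
    have hx : 0 ≤ G * (4 * s - l / 4) - l * s - 1.0595 * s := by
      have : (l + 1.147) / 4 * (4 * s - l / 4) ≤ G * (4 * s - l / 4) :=
        mul_le_mul_of_nonneg_right hG' (by linarith)
      nlinarith
    have hy : (l + 1.147) / 4 * (1.0595 * s) ≤ G * (G * (4 * s - l / 4) - l * s) :=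
      mul_le_mul hG' (by linarith) (by linarith) hG0.le
    nlinarith
  calc l * (s ^ 2 * G + E ^ 2 + (u - 1) * G ^ 2)
      ≤ l * (s ^ 2 * G + 0.26475 * s ^ 2 + s / 4 * G ^ 2) := by gcongr
    _ = s * (l * (s * G + 0.26475 * s + G ^ 2 / 4)) := by ring
    _ ≤ s * (4 * s * G ^ 2) := by gcongr
    _ = 4 * s ^ 2 * G ^ 2 := by ring

lemma log_mul_le_of_dyadic {N a k : ℕ} {G R : ℝ} (ha : 0 < a) (haN : a ≤ N) (hNk : N ≤ 2 ^ k)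
    (hG : 0 < G) (hR : 0 ≤ R) (hkG : k * 0.6931471808 ≤ 4 * G)
    (h : k * 0.6931471808 * (a * G + R) ≤ 4 * a * G ^ 2) :
    Real.log N * (N * G + R) ≤ 4 * N * G ^ 2 := by
  have haN' : (a : ℝ) ≤ N := by exact_mod_cast haN
  have hl : Real.log N ≤ k * 0.6931471808 := log_natCast_le (ha.trans_le haN) hNk
  calc Real.log N * (N * G + R) ≤ k * 0.6931471808 * (N * G + R) := by gcongr
    _ ≤ 4 * N * G ^ 2 := by
      have := mul_le_mul_of_nonneg_right haN' (mul_nonneg hG.le (sub_nonneg.2 hkG))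
      linarith

lemma exists_log_mul_le (N : ℕ) (hN : 55 ≤ N) : ∃ u : ℕ, 1 ≤ u ∧ 0 < sieveMain u ∧
    Real.log N * (N * sieveMain u + sieveError u ^ 2 + (u - 1) * sieveMain u ^ 2) ≤
      4 * N * sieveMain u ^ 2 := by
  rcases le_total 16384 N with h | h
  · exact exists_log_mul_le_of_large N h
  rcases le_total 2048 N with h' | h'
  · have key : ∃ a k : ℕ, (a, k) ∈ [(2048, 12), (4096, 13), (8192, 14)] ∧ a ≤ N ∧ N ≤ 2 ^ k := by
      rcases le_total N 4096 with h1 | h1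
      · exact ⟨2048, 12, by simp, h', h1⟩
      rcases le_total N 8192 with h2 | h2
      · exact ⟨4096, 13, by simp, h1, h2⟩
      · exact ⟨8192, 14, by simp, h2, h⟩
    refine ⟨18, by norm_num, by rw [sieveMain_eighteen]; norm_num, ?_⟩
    rw [sieveMain_eighteen, sieveError_eighteen, add_assoc]
    obtain ⟨a, k, hak, haN, hNk⟩ := key
    simp only [List.mem_cons, List.not_mem_nil, or_false, Prod.mk.injEq] at hak
    rcases hak with ⟨rfl, rfl⟩ | ⟨rfl, rfl⟩ | ⟨rfl, rfl⟩ <;>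
      exact log_mul_le_of_dyadic (by norm_num) haN hNk (by norm_num) (by norm_num) (by norm_num)
        (by norm_num)
  · have key : ∃ a k : ℕ, (a, k) ∈ [(55, 6), (64, 7), (128, 8), (256, 9), (512, 10), (1024, 11)] ∧
        a ≤ N ∧ N ≤ 2 ^ k := by
      rcases le_total N 64 with h1 | h1
      · exact ⟨55, 6, by simp, hN, h1⟩
      rcases le_total N 128 with h2 | h2
      · exact ⟨64, 7, by simp, h1, h2⟩
      rcases le_total N 256 with h3 | h3
      · exact ⟨128, 8, by simp, h2, h3⟩
      rcases le_total N 512 with h4 | h4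
      · exact ⟨256, 9, by simp, h3, h4⟩
      rcases le_total N 1024 with h5 | h5
      · exact ⟨512, 10, by simp, h4, h5⟩
      · exact ⟨1024, 11, by simp, h5, h'⟩
    refine ⟨7, by norm_num, by rw [sieveMain_seven]; norm_num, ?_⟩
    rw [sieveMain_seven, sieveError_seven, add_assoc]
    obtain ⟨a, k, hak, haN, hNk⟩ := key
    simp only [List.mem_cons, List.not_mem_nil, or_false, Prod.mk.injEq] at hak
    rcases hak with ⟨rfl, rfl⟩ | ⟨rfl, rfl⟩ | ⟨rfl, rfl⟩ | ⟨rfl, rfl⟩ | ⟨rfl, rfl⟩ | ⟨rfl, rfl⟩ <;>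
      exact log_mul_le_of_dyadic (by norm_num) haN hNk (by norm_num) (by norm_num) (by norm_num)
        (by norm_num)

/-- An upper bound for the number of `m ≤ N` such that `1 + 2 ^ k * n * m` is prime. -/
lemma card_mul_totient_mul_log_le (k n N : ℕ) (hk : 1 ≤ k) (hn : Odd n) (hN : 55 ≤ N)
    (S : Finset ℕ) (hS : S ⊆ Finset.Ioc 0 N) (hprime : ∀ m ∈ S, (1 + 2 ^ k * n * m).Prime) :
    (S.card * n.totient : ℝ) * Real.log N ≤ 4 * n * N := by
  obtain ⟨u, hu, hG, hkey⟩ := exists_log_mul_le N hN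
  set A := {m ∈ S | 2 * u ≤ 1 + 2 ^ k * n * m} with hA
  have hsieve := card_mul_totient_mul_sq_sieveMain_le u N k n hn A
    ((Finset.filter_subset _ _).trans hS)
    fun m hm => ⟨hprime m (Finset.mem_filter.1 hm).1, (Finset.mem_filter.1 hm).2⟩
  obtain ⟨b, hb⟩ : ∃ b, 2 ^ k * n = 2 * b := by
    obtain ⟨i, rfl⟩ := Nat.exists_eq_add_of_le hk
    exact ⟨2 ^ i * n, by ring⟩
  have hb0 : 0 < b := by
    rcases Nat.eq_zero_or_pos b with h | h
    · have := hn.pos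
      have : 0 < 2 ^ k * n := by positivity
      omega
    · exact h
  have hsmall : ({m ∈ S | ¬ 2 * u ≤ 1 + 2 ^ k * n * m}).card ≤ u - 1 := by
    rw [show u - 1 = (Finset.Ioo 0 u).card by simp]
    refine Finset.card_le_card fun m hm => ?_
    obtain ⟨h1, h2⟩ := Finset.mem_filter.1 hm
    have h3 := (Finset.mem_Ioc.1 (hS h1)).1
    rw [hb] at h2
    have : m ≤ b * m := Nat.le_mul_of_pos_left m hb0
    rw [mul_assoc] at h2
    exact Finset.mem_Ioo.2 ⟨h3, by omega⟩
  have hcard : (S.card : ℝ) ≤ A.card + (u - 1) := by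
    have h : A.card + ({m ∈ S | ¬ 2 * u ≤ 1 + 2 ^ k * n * m}).card = S.card :=
      Finset.card_filter_add_card_filter_not _
    have h' : S.card ≤ A.card + (u - 1) := by omega
    have h'' : (S.card : ℝ) ≤ ((A.card + (u - 1) : ℕ) : ℝ) := by exact_mod_cast h'
    rwa [Nat.cast_add, Nat.cast_sub hu, Nat.cast_one] at h''
  have hφ : (n.totient : ℝ) ≤ n := by exact_mod_cast Nat.totient_le n
  have hu' : (0 : ℝ) ≤ u - 1 := by
    have : (1 : ℝ) ≤ u := by exact_mod_cast hu
    linarith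
  have hlog : 0 ≤ Real.log N := Real.log_natCast_nonneg N
  set G := sieveMain u
  set E := sieveError u
  have hG2 : 0 < G ^ 2 := by positivity
  have h1 : (S.card * n.totient : ℝ) * G ^ 2 ≤ n * (N * G + E ^ 2 + (u - 1) * G ^ 2) := by
    calc (S.card * n.totient : ℝ) * G ^ 2 ≤ ((A.card + (u - 1)) * n.totient) * G ^ 2 := by gcongr
      _ = (A.card * n.totient : ℝ) * G ^ 2 + (u - 1) * n.totient * G ^ 2 := by ring
      _ ≤ n * (N * G + E ^ 2) + (u - 1) * n * G ^ 2 := by gcongr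
      _ = _ := by ring
  refine le_of_mul_le_mul_right ?_ hG2
  calc (S.card * n.totient : ℝ) * Real.log N * G ^ 2
      = Real.log N * ((S.card * n.totient : ℝ) * G ^ 2) := by ring
    _ ≤ Real.log N * (n * (N * G + E ^ 2 + (u - 1) * G ^ 2)) := by gcongr
    _ = n * (Real.log N * (N * G + E ^ 2 + (u - 1) * G ^ 2)) := by ring
    _ ≤ n * (4 * N * G ^ 2) := by gcongr
    _ = _ := by ring

lemma totient_mul_card_mul_log_le {t N : ℕ} (ht : Even t) (ht0 : 0 < t)
    (S : Finset ℕ) (hS : S ⊆ Finset.Ioc 0 N) (hprime : ∀ m ∈ S, (1 + t * m).Prime) :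
    1 / 2 * (t.totient : ℝ) * S.card * Real.log S.card ≤ t * N := by
  obtain ⟨k, n, hn, rfl⟩ := Nat.exists_eq_two_pow_mul_odd ht0.ne'
  have hk : 1 ≤ k := by
    rcases Nat.eq_zero_or_pos k with rfl | h
    · simp only [pow_zero, one_mul] at ht
      exact absurd ht (Nat.not_even_iff_odd.2 hn)
    · exact h
  have hcard : S.card ≤ N := by simpa using Finset.card_le_card hS
  rcases Nat.eq_zero_or_pos S.card with h0 | h0
  · rw [h0]; simp; positivity
  have hcard' : (S.card : ℝ) ≤ N := by exact_mod_cast hcard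
  have h0' : (0 : ℝ) < S.card := by exact_mod_cast h0
  have hlog : Real.log S.card ≤ Real.log N := Real.log_le_log h0' hcard'
  have hlog0 : 0 ≤ Real.log S.card := Real.log_natCast_nonneg _
  have htot : ((2 ^ k * n).totient : ℝ) = 2 ^ k / 2 * n.totient := by
    rw [Nat.totient_mul ((Nat.coprime_two_left.2 hn).pow_left k),
      Nat.totient_prime_pow Nat.prime_two hk]
    obtain ⟨i, rfl⟩ := Nat.exists_eq_add_of_le hk
    simp [pow_add]
  rw [htot]
  have main : (S.card * n.totient : ℝ) * Real.log N ≤ 4 * n * N := by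
    rcases le_or_gt 55 N with h | h
    · exact card_mul_totient_mul_log_le k n N hk hn h S hS hprime
    · have hN4 : Real.log N ≤ 4 := by
        rw [Real.log_le_iff_le_exp (by linarith)]
        have h1 : (N : ℝ) ≤ 54 := by exact_mod_cast Nat.le_of_lt_succ h
        have h2 : (2.7182818283 : ℝ) ^ 4 ≤ Real.exp 1 ^ 4 := by
          have := Real.exp_one_gt_d9
          gcongr
        rw [← Real.exp_nat_mul] at h2
        norm_num at h2
        linarith
      have hφ : (n.totient : ℝ) ≤ n := by exact_mod_cast Nat.totient_le n
      calc (S.card * n.totient : ℝ) * Real.log N ≤ (N * n) * 4 := by gcongr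
        _ = _ := by ring
  calc 1 / 2 * ((2 : ℝ) ^ k / 2 * n.totient) * S.card * Real.log S.card
      = 2 ^ k / 4 * ((S.card * n.totient : ℝ) * Real.log S.card) := by ring
    _ ≤ 2 ^ k / 4 * ((S.card * n.totient : ℝ) * Real.log N) := by gcongr
    _ ≤ 2 ^ k / 4 * (4 * n * N) := by gcongr
    _ = _ := by push_cast; ring

lemma nth_prime_one_mod_ge_of_even {t j : ℕ} (ht : Even t) (ht0 : 0 < t) (hj : 1 ≤ j) :
    (1 / 2) * (t.totient : ℝ) * (j : ℝ) * Real.log j ≤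
      (Nat.nth (fun p => p.Prime ∧ p % t = 1) (j - 1) : ℕ) := by
  have ht2 : 2 ≤ t := by
    obtain ⟨r, rfl⟩ := ht
    omega
  set P : ℕ → Prop := fun p => p.Prime ∧ p % t = 1 with hP
  have hinf : {p | P p}.Infinite := by
    refine (Nat.infinite_setOfPred_prime_modEq_one ht0.ne').mono fun p hp => ⟨hp.1, ?_⟩
    have := hp.2
    rwa [Nat.ModEq, Nat.mod_eq_of_lt (show 1 < t by omega)] at this
  set f : ℕ → ℕ := fun i => Nat.nth P i / t with hf
  have hspec : ∀ i, Nat.nth P i = 1 + t * f i ∧ (1 + t * f i).Prime := by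
    intro i
    have h := Nat.nth_mem_of_infinite hinf i
    have h1 : Nat.nth P i = 1 + t * f i := by
      have := Nat.mod_add_div (Nat.nth P i) t
      rw [h.2] at this
      exact this.symm
    exact ⟨h1, h1 ▸ h.1⟩
  have hinj : Function.Injective f := by
    intro a b hab
    refine Nat.nth_injective hinf ?_
    rw [(hspec a).1, (hspec b).1, hab]
  have hS : (Finset.range j).image f ⊆ Finset.Ioc 0 (f (j - 1)) := by
    intro m hm
    obtain ⟨i, hi, rfl⟩ := Finset.mem_image.1 hm
    have hi' := Finset.mem_range.1 hi
    refine Finset.mem_Ioc.2 ⟨Nat.pos_of_ne_zero fun h => ?_, ?_⟩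
    · have := (hspec i).2
      rw [h] at this
      exact Nat.not_prime_one this
    · exact Nat.div_le_div_right ((Nat.nth_le_nth hinf).2 (by omega))
  have h := totient_mul_card_mul_log_le ht ht0 _ hS fun m hm => by
    obtain ⟨i, -, rfl⟩ := Finset.mem_image.1 hm
    exact (hspec i).2
  rw [Finset.card_image_of_injective _ hinj, Finset.card_range] at h
  rw [(hspec (j - 1)).1]
  push_cast
  linarith

/-- Let `t ≥ 2` and `j ≥ 1`, and let `p_j` be the `j`-th smallest prime congruent to `1`
modulo `t` (here realized as `Nat.nth` of the predicate, with `j - 1` since `Nat.nth`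
is 0-indexed; the set of such primes is infinite by Dirichlet's theorem, so `Nat.nth`
enumerates them in increasing order).  Then `p_j ≥ (1/2) · φ(t) · j · log j`. -/
theorem nth_prime_one_mod_ge (t j : ℕ) (ht : 2 ≤ t) (hj : 1 ≤ j) :
    ((Nat.nth (fun p => p.Prime ∧ p % t = 1) (j - 1) : ℕ) : ℝ) ≥
      (1 / 2) * (t.totient : ℝ) * (j : ℝ) * Real.log j := by
  rcases Nat.even_or_odd t with h | h
  · exact nth_prime_one_mod_ge_of_even h (by omega) hj
  · have hpred : (fun p : ℕ => p.Prime ∧ p % t = 1) = fun p => p.Prime ∧ p % (2 * t) = 1 := by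
      funext p
      refine propext (and_congr_right fun hp => ⟨fun h1 => ?_, fun h1 => ?_⟩)
      · have hp2 : p % 2 = 1 := by
          rcases hp.eq_two_or_odd with rfl | h2
          · obtain ⟨i, rfl⟩ := h
            rw [Nat.mod_eq_of_lt (by omega)] at h1
            omega
          · exact h2
        have hmod : p ≡ 1 [MOD 2 * t] :=
          (Nat.modEq_and_modEq_iff_modEq_mul (Nat.coprime_two_left.2 h)).1
            ⟨hp2, by rw [Nat.ModEq, h1, Nat.mod_eq_of_lt (by omega)]⟩
        rwa [Nat.ModEq, Nat.mod_eq_of_lt (show 1 < 2 * t by omega)] at hmod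
      · rw [← Nat.mod_mul_left_mod p 2 t, h1, Nat.mod_eq_of_lt (by omega)]
    have htot : t.totient = (2 * t).totient := by
      rw [Nat.totient_mul (Nat.coprime_two_left.2 h), Nat.totient_two, one_mul]
    rw [hpred, htot]
    exact nth_prime_one_mod_ge_of_even (even_two_mul t) (by omega) hj
end

section
/- There exists a constant E > 0, depending only on s, with the following property: for every integer N satisfying log log log N > 2 and N > (log log N)^{6s+6}, every integer m with 2 ≤ m ≤ log log N, and every positive integer u ≤ √N, one has φ(m) · Σ (1/p − 1/p²) ≥ log log N − E · log log log N, where the sum is over primes p ≤ N^{1/(3s)} with p ≡ 1 (mod m) and p ∤ u. -/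
open scoped BigOperators

namespace DirichletLower

open Finset Filter Topology
open scoped ArithmeticFunction.vonMangoldt

/-- Summation by parts. -/
lemma sum_Ioc_mul_eq_by_parts (c : ℕ → ℂ) (g : ℕ → ℝ) {M N : ℕ} (h : M ≤ N) :
    ∑ n ∈ Ioc M N, c n * g n = (∑ n ∈ Ioc M N, c n) * g (N + 1)
      + ∑ n ∈ Ioc M N, (∑ k ∈ Ioc M n, c k) * ((g n - g (n + 1) : ℝ) : ℂ) := by
  induction N, h using Nat.le_induction with
  | base => simp
  | succ N h ih =>
    simp only [sum_Ioc_succ_top h]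
    rw [ih]
    push_cast
    ring

lemma norm_sum_Ioc_mul_le {c : ℕ → ℂ} {B : ℝ} (hB : ∀ M N, ‖∑ n ∈ Ioc M N, c n‖ ≤ B)
    (g : ℕ → ℝ) {M N : ℕ} (h : M ≤ N) :
    ‖∑ n ∈ Ioc M N, c n * g n‖ ≤ B * (|g (N + 1)| + ∑ n ∈ Ioc M N, |g n - g (n + 1)|) := by
  rw [sum_Ioc_mul_eq_by_parts c g h, mul_add, mul_sum]
  refine (norm_add_le _ _).trans (add_le_add ?_ ((norm_sum_le _ _).trans (sum_le_sum fun n _ ↦ ?_)))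
  all_goals
    rw [norm_mul, Complex.norm_real, Real.norm_eq_abs]
    gcongr
    exact hB _ _

lemma norm_sum_Ioc_mul_le_of_antitone {c : ℕ → ℂ} {B : ℝ}
    (hB : ∀ M N, ‖∑ n ∈ Ioc M N, c n‖ ≤ B) {g : ℕ → ℝ} {M N : ℕ} (hg0 : ∀ n, 0 ≤ g n)
    (hg : ∀ n, M < n → g (n + 1) ≤ g n) (h : M ≤ N) :
    ‖∑ n ∈ Ioc M N, c n * g n‖ ≤ B * g (M + 1) := by
  refine (norm_sum_Ioc_mul_le hB g h).trans_eq ?_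
  congr 1
  induction N, h using Nat.le_induction with
  | base => simp [abs_of_nonneg (hg0 _)]
  | succ N h ih =>
    rw [sum_Ioc_succ_top h, ← ih, abs_of_nonneg (hg0 _), abs_of_nonneg (hg0 _),
      abs_of_nonneg (sub_nonneg.2 (hg (N + 1) (by lia)))]
    ring

lemma tendsto_div_add_one (c : ℝ) : Tendsto (fun M : ℕ ↦ c / (M + 1)) atTop (𝓝 0) := by
  simpa using (tendsto_one_div_add_atTop_nhds_zero_nat (𝕜 := ℝ)).const_mul c
    |>.congr fun n ↦ by ring

section Character

variable {q : ℕ} [NeZero q] {χ : DirichletCharacter ℂ q}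

lemma sum_Ioc_period_eq_zero (hχ : χ ≠ 1) (M : ℕ) :
    ∑ n ∈ Ioc M (M + q), χ (n : ZMod q) = 0 := by
  have hq : 0 < q := Nat.pos_of_ne_zero (NeZero.ne q)
  induction M with
  | zero =>
    have h0 : ∑ a : ZMod q, χ a = 0 := MulChar.sum_eq_zero_of_ne_one hχ
    rw [← h0]
    refine sum_bij' (fun n _ ↦ (n : ZMod q)) (fun a _ ↦ if a.val = 0 then q else a.val)
      (by simp) ?_ ?_ ?_ (by simp)
    · intro a _
      have := ZMod.val_lt a
      simp only [mem_Ioc]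
      split_ifs <;> lia
    · intro n hn
      simp only [mem_Ioc, zero_add] at hn
      rcases hn.2.lt_or_eq with h | rfl
      · simp only [ZMod.val_natCast_of_lt h]
        rw [if_neg hn.1.ne']
      · simp
    · intro a _
      by_cases h : a.val = 0
      · simp [(ZMod.val_eq_zero a).1 h]
      · simp [h]
  | succ M ih =>
    have h1 : ∑ n ∈ Ioc M (M + q + 1), χ (n : ZMod q)
        = ∑ n ∈ Ioc M (M + q), χ (n : ZMod q) + χ ((M + q + 1 : ℕ) : ZMod q) :=
      sum_Ioc_succ_top (by lia) _
    have h2 : ∑ n ∈ Ioc M (M + q + 1), χ (n : ZMod q)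
        = χ ((M + 1 : ℕ) : ZMod q) + ∑ n ∈ Ioc (M + 1) (M + q + 1), χ (n : ZMod q) := by
      rw [← sum_Ioc_consecutive _ (by lia : M ≤ M + 1) (by lia : M + 1 ≤ M + q + 1)]
      simp
    rw [show M + 1 + q = M + q + 1 by ring]
    have h3 : ((M + q + 1 : ℕ) : ZMod q) = ((M + 1 : ℕ) : ZMod q) := by simp
    rw [h3] at h1
    rw [h1, ih] at h2
    linear_combination -h2

lemma norm_sum_Ioc_character_le (hχ : χ ≠ 1) (M N : ℕ) :
    ‖∑ n ∈ Ioc M N, χ (n : ZMod q)‖ ≤ q := by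
  have hq : 0 < q := Nat.pos_of_ne_zero (NeZero.ne q)
  obtain ⟨d, hd⟩ : ∃ d, N - M = d := ⟨_, rfl⟩
  induction d using Nat.strong_induction_on generalizing M with
  | _ d ih =>
    by_cases h : d < q
    · calc _ ≤ ∑ n ∈ Ioc M N, (1 : ℝ) :=
            norm_sum_le_of_le _ fun n _ ↦ DirichletCharacter.norm_le_one _ _
        _ = d := by simp [hd]
        _ ≤ q := by exact_mod_cast h.le
    · rw [← sum_Ioc_consecutive _ (by lia : M ≤ M + q) (by lia : M + q ≤ N),
        sum_Ioc_period_eq_zero hχ, zero_add]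
      exact ih (d - q) (by lia) _ (by lia)

/-- The value at `1` of the `L`-function, as a conditionally convergent series. -/
lemma exists_sum_div_tail_le (hχ : χ ≠ 1) : ∃ l : ℂ, ∀ M : ℕ,
    ‖l - ∑ n ∈ Ioc 0 M, χ (n : ZMod q) * ((1 / n : ℝ) : ℂ)‖ ≤ q / (M + 1) := by
  set S : ℕ → ℂ := fun M ↦ ∑ n ∈ Ioc 0 M, χ (n : ZMod q) * ((1 / n : ℝ) : ℂ) with hS
  have key : ∀ M N, M ≤ N → ‖S N - S M‖ ≤ q / (M + 1) := by
    intro M N h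
    have : S N - S M = ∑ n ∈ Ioc M N, χ (n : ZMod q) * ((1 / n : ℝ) : ℂ) := by
      rw [hS]
      simp only
      rw [← sum_Ioc_consecutive _ (Nat.zero_le M) h]
      ring
    rw [this]
    refine (norm_sum_Ioc_mul_le_of_antitone (norm_sum_Ioc_character_le hχ)
      (g := fun n ↦ 1 / (n : ℝ)) (fun n ↦ by positivity) ?_ h).trans_eq ?_
    · intro n hn
      have : (0 : ℝ) < n := by exact_mod_cast (Nat.zero_le M).trans_lt hn
      push_cast
      gcongr
      linarith
    · push_cast
      ring
  have hc : CauchySeq S := by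
    refine cauchySeq_of_le_tendsto_0' _ (fun n m h ↦ ?_)
      (tendsto_div_add_one q)
    rw [dist_comm, dist_eq_norm]
    exact key n m h
  obtain ⟨l, hl⟩ := cauchySeq_tendsto_of_complete hc
  refine ⟨l, fun M ↦ ?_⟩
  refine le_of_tendsto ((hl.sub_const (S M)).norm) ?_
  filter_upwards [eventually_ge_atTop M] with N hN using key M N hN

end Character

open scoped ComplexOrder

/-- `l` is the value at `1` of the `L`-function of the nontrivial character `χ`, with the
explicit rate of convergence given by summation by parts. -/
def IsValueAtOne {q : ℕ} (χ : DirichletCharacter ℂ q) (l : ℂ) : Prop :=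
  ∀ M : ℕ, ‖l - ∑ n ∈ Ioc 0 M, χ (n : ZMod q) * ((1 / n : ℝ) : ℂ)‖ ≤ q / (M + 1)

lemma IsValueAtOne.tendsto {q : ℕ} {χ : DirichletCharacter ℂ q} {l : ℂ} (hl : IsValueAtOne χ l) :
    Tendsto (fun M : ℕ ↦ ∑ n ∈ Ioc 0 M, χ (n : ZMod q) * ((1 / n : ℝ) : ℂ)) atTop (𝓝 l) := by
  rw [tendsto_iff_norm_sub_tendsto_zero]
  refine squeeze_zero (fun _ ↦ norm_nonneg _) (fun M ↦ ?_) (tendsto_div_add_one q)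
  rw [norm_sub_rev]
  exact hl M

lemma sum_Ioc_sum_divisors {R : Type*} [AddCommMonoid R] (H : ℕ → ℕ → R) (N : ℕ) :
    ∑ n ∈ Ioc 0 N, ∑ d ∈ n.divisors, H d n
      = ∑ d ∈ Ioc 0 N, ∑ k ∈ Ioc 0 (N / d), H d (d * k) := by
  rw [sum_sigma', sum_sigma']
  refine sum_bij' (fun x _ ↦ ⟨x.2, x.1 / x.2⟩) (fun y _ ↦ ⟨y.1 * y.2, y.1⟩) ?_ ?_ ?_ ?_ ?_
  · rintro ⟨n, d⟩ h
    simp only [mem_sigma, mem_Ioc, Nat.mem_divisors] at h ⊢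
    have hd := Nat.pos_of_dvd_of_pos h.2.1 h.1.1
    exact ⟨⟨hd, (Nat.le_of_dvd h.1.1 h.2.1).trans h.1.2⟩,
      Nat.div_pos (Nat.le_of_dvd h.1.1 h.2.1) hd, Nat.div_le_div_right h.1.2⟩
  · rintro ⟨d, k⟩ h
    simp only [mem_sigma, mem_Ioc, Nat.mem_divisors] at h ⊢
    have hp := Nat.mul_pos h.1.1 h.2.1
    refine ⟨⟨hp, ?_⟩, dvd_mul_right _ _, hp.ne'⟩
    rw [mul_comm]
    exact (Nat.le_div_iff_mul_le h.1.1).1 h.2.2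
  · rintro ⟨n, d⟩ h
    simp only [mem_sigma, mem_Ioc, Nat.mem_divisors] at h ⊢
    simp [Nat.mul_div_cancel' h.2.1]
  · rintro ⟨d, k⟩ h
    simp only [mem_sigma, mem_Ioc] at h ⊢
    simp [Nat.mul_div_cancel_left k h.1.1]
  · rintro ⟨n, d⟩ h
    simp only [mem_sigma, mem_Ioc, Nat.mem_divisors] at h ⊢
    simp [Nat.mul_div_cancel' h.2.1]

section Lambert

variable {x : ℝ}

/-- The error in replacing a Lambert series coefficient by its limiting value. -/
noncomputable def lambertGap (x : ℝ) (n : ℕ) : ℝ := 1 / n * (1 / (1 - x)) - x ^ n / (1 - x ^ n)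

lemma one_sub_pow_eq (x : ℝ) (n : ℕ) : 1 - x ^ n = (1 - x) * ∑ i ∈ range n, x ^ i := by
  rw [mul_comm, geom_sum_mul_neg]

/-- The arithmetic-geometric mean inequality for a geometric progression. -/
lemma sq_mul_pow_le_geom_sum_sq (hx : 0 < x) (n : ℕ) :
    (n : ℝ) ^ 2 * x ^ (n - 1) ≤ (∑ i ∈ range n, x ^ i) ^ 2 := by
  have h : ∑ i ∈ range n, (√x) ^ (n - 1) ≤ ∑ i ∈ range n, x ^ i := by
    have hr := sum_range_reflect (fun i ↦ x ^ i) n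
    have : 2 * ∑ i ∈ range n, (√x) ^ (n - 1)
        ≤ ∑ i ∈ range n, x ^ i + ∑ i ∈ range n, x ^ (n - 1 - i) := by
      rw [mul_sum, ← sum_add_distrib]
      refine sum_le_sum fun i hi ↦ ?_
      have hi' : n - 1 = i + (n - 1 - i) := by have := mem_range.1 hi; lia
      have h1 : x ^ i = ((√x) ^ i) ^ 2 := by rw [← pow_mul, mul_comm, pow_mul, Real.sq_sqrt hx.le]
      have h2 : x ^ (n - 1 - i) = ((√x) ^ (n - 1 - i)) ^ 2 := by
        rw [← pow_mul, mul_comm, pow_mul, Real.sq_sqrt hx.le]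
      rw [h1, h2]
      conv_lhs => rw [hi', pow_add]
      nlinarith [sq_nonneg ((√x) ^ i - (√x) ^ (n - 1 - i))]
    linarith
  rw [sum_const, card_range, nsmul_eq_mul] at h
  calc (n : ℝ) ^ 2 * x ^ (n - 1) = (n * (√x) ^ (n - 1)) ^ 2 := by
        rw [mul_pow, ← pow_mul, mul_comm (n - 1) 2, pow_mul, Real.sq_sqrt hx.le]
    _ ≤ _ := by gcongr

lemma lambertGap_succ_le (hx : 0 < x) (hx1 : x < 1) {n : ℕ} (hn : 0 < n) :
    lambertGap x (n + 1) ≤ lambertGap x n := by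
  have hn' : (0 : ℝ) < n := by exact_mod_cast hn
  have hy : 0 < 1 - x := by linarith
  set A := ∑ i ∈ range n, x ^ i with hA
  set B := ∑ i ∈ range (n + 1), x ^ i with hB
  have hApos : 0 < A := sum_pos (fun i _ ↦ by positivity) ⟨0, by simpa⟩
  have hBpos : 0 < B := sum_pos (fun i _ ↦ by positivity) ⟨0, by simp⟩
  have hBA : B = A + x ^ n := by rw [hB, sum_range_succ]
  have hAx : x * A = B - 1 := by
    rw [hB, sum_range_succ', hA, mul_sum]
    simp [pow_succ, mul_comm]
  have h1 : (n : ℝ) ^ 2 * x ^ (n - 1) ≤ A ^ 2 := sq_mul_pow_le_geom_sum_sq hx n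
  have h2 : ((n + 1 : ℕ) : ℝ) ^ 2 * x ^ (n + 1 - 1) ≤ B ^ 2 := sq_mul_pow_le_geom_sum_sq hx (n + 1)
  rw [Nat.add_sub_cancel] at h2
  push_cast at h2
  have h3 : (n * (n + 1) * x ^ n) ^ 2 ≤ (A * B) ^ 2 := by
    have hxn : x ^ n * x ^ n ≤ x ^ (n - 1) * x ^ n :=
      mul_le_mul_of_nonneg_right (pow_le_pow_of_le_one hx.le hx1.le (Nat.sub_le _ _)) (by positivity)
    calc (n * (n + 1) * x ^ n) ^ 2 = (n : ℝ) ^ 2 * (n + 1) ^ 2 * (x ^ n * x ^ n) := by ring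
      _ ≤ (n : ℝ) ^ 2 * (n + 1) ^ 2 * (x ^ (n - 1) * x ^ n) := by gcongr
      _ = ((n : ℝ) ^ 2 * x ^ (n - 1)) * ((n + 1) ^ 2 * x ^ n) := by ring
      _ ≤ A ^ 2 * B ^ 2 := by gcongr
      _ = _ := by ring
  have h4 : n * (n + 1) * x ^ n ≤ A * B := (sq_le_sq₀ (by positivity) (by positivity)).1 h3
  rw [lambertGap, lambertGap, one_sub_pow_eq x n, one_sub_pow_eq x (n + 1), ← hA, ← hB]
  have : 1 / (n : ℝ) * (1 / (1 - x)) - x ^ n / ((1 - x) * A)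
      - (1 / ((n + 1 : ℕ) : ℝ) * (1 / (1 - x)) - x ^ (n + 1) / ((1 - x) * B))
      = (A * B - n * (n + 1) * x ^ n) / ((1 - x) * n * (n + 1) * A * B) := by
    have hxn : x ^ n = B - A := by linarith
    rw [pow_succ, hxn]
    push_cast
    field_simp
    linear_combination ((n : ℝ) * (n + 1) * (B - A)) * hAx
  have hp : 0 ≤ (A * B - n * (n + 1) * x ^ n) / ((1 - x) * n * (n + 1) * A * B) := by
    have := sub_nonneg.2 h4
    positivity
  linarith

lemma lambertGap_nonneg (hx : 0 < x) (hx1 : x < 1) (n : ℕ) : 0 ≤ lambertGap x n := by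
  rcases Nat.eq_zero_or_pos n with rfl | hn
  · simp [lambertGap]
  have hn' : (0 : ℝ) < n := by exact_mod_cast hn
  have hy : 0 < 1 - x := by linarith
  have h : n * x ^ n ≤ ∑ i ∈ range n, x ^ i := by
    have := card_nsmul_le_sum (range n) (fun i ↦ x ^ i) (x ^ n) fun i hi ↦
      pow_le_pow_of_le_one hx.le hx1.le (mem_range.1 hi).le
    simpa using this
  have hApos : 0 < ∑ i ∈ range n, x ^ i := sum_pos (fun i _ ↦ by positivity) ⟨0, by simpa⟩
  rw [lambertGap, one_sub_pow_eq, sub_nonneg, div_mul_div_comm, one_mul,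
    div_le_div_iff₀ (by positivity) (by positivity)]
  nlinarith [mul_le_mul_of_nonneg_left h hy.le]

lemma lambertGap_one (hx1 : x < 1) : lambertGap x 1 = 1 := by
  have hy : 1 - x ≠ 0 := by linarith
  simp [lambertGap]
  field_simp

lemma norm_lambert_sub_sum_le (hx : 0 < x) (hx1 : x < 1) {q : ℕ} (χ : DirichletCharacter ℂ q)
    (N : ℕ) :
    ‖∑ n ∈ Ioc 0 N, χ (n : ZMod q) * ((x ^ n / (1 - x ^ n) : ℝ) : ℂ)
      - ∑ n ∈ Ioc 0 N, χ.zetaMul n * ((x ^ n : ℝ) : ℂ)‖ ≤ N * (x ^ N / (1 - x)) := by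
  have h1 : ∑ n ∈ Ioc 0 N, χ.zetaMul n * ((x ^ n : ℝ) : ℂ)
      = ∑ d ∈ Ioc 0 N, ∑ k ∈ Ioc 0 (N / d), χ (d : ZMod q) * ((x ^ (d * k) : ℝ) : ℂ) := by
    rw [← sum_Ioc_sum_divisors (fun d n ↦ χ (d : ZMod q) * ((x ^ n : ℝ) : ℂ))]
    refine sum_congr rfl fun n hn ↦ ?_
    rw [DirichletCharacter.zetaMul, ArithmeticFunction.coe_zeta_mul_apply, sum_mul]
    refine sum_congr rfl fun d hd ↦ ?_
    simp [toArithmeticFunction, (Nat.pos_of_mem_divisors hd).ne']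
  rw [h1, ← sum_sub_distrib]
  have h2 : ∀ d ∈ Ioc 0 N, ‖χ (d : ZMod q) * ((x ^ d / (1 - x ^ d) : ℝ) : ℂ)
      - ∑ k ∈ Ioc 0 (N / d), χ (d : ZMod q) * ((x ^ (d * k) : ℝ) : ℂ)‖ ≤ x ^ N / (1 - x) := by
    intro d hd
    have hd0 : 0 < d := (mem_Ioc.1 hd).1
    have hxd : x ^ d ≤ x := pow_le_of_le_one hx.le hx1.le hd0.ne'
    have hpos : 0 < 1 - x ^ d := by linarith
    have hgeo : ∀ K : ℕ, ∑ k ∈ Ioc 0 K, x ^ (d * k)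
        = x ^ d / (1 - x ^ d) - x ^ (d * (K + 1)) / (1 - x ^ d) := by
      intro K
      induction K with
      | zero => simp
      | succ K ih =>
        rw [sum_Ioc_succ_top (Nat.zero_le K), ih]
        field_simp
        ring
    rw [← mul_sum, ← Complex.ofReal_sum, hgeo, ← mul_sub, ← Complex.ofReal_sub, sub_sub_cancel,
      norm_mul, Complex.norm_real, Real.norm_of_nonneg (by positivity)]
    have hle : N ≤ d * (N / d + 1) := (Nat.lt_mul_div_succ N hd0).le
    calc _ ≤ 1 * (x ^ (d * (N / d + 1)) / (1 - x ^ d)) := by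
          gcongr
          exact DirichletCharacter.norm_le_one _ _
      _ ≤ x ^ N / (1 - x) := by
          rw [one_mul]
          have := pow_le_pow_of_le_one hx.le hx1.le hle
          have hy : 0 < 1 - x := by linarith
          gcongr
  refine (norm_sum_le_of_le _ h2).trans_eq ?_
  simp

end Lambert

lemma one_le_zetaMul_sq {q : ℕ} {χ : DirichletCharacter ℂ q} (hχ : χ ^ 2 = 1) {k : ℕ}
    (hk : k ≠ 0) : 1 ≤ χ.zetaMul (k ^ 2) := by
  induction k using Nat.recOnPosPrimePosCoprime with
  | zero => exact absurd rfl hk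
  | one => simp [χ.isMultiplicative_zetaMul.map_one]
  | prime_pow p n hp hn =>
    rw [← pow_mul, DirichletCharacter.zetaMul, ArithmeticFunction.coe_zeta_mul_apply,
      Nat.sum_divisors_prime_pow hp]
    simp only [toArithmeticFunction, ArithmeticFunction.coe_mk, pow_eq_zero_iff', hp.ne_zero,
      ne_eq, false_and, ↓reduceIte, Nat.cast_pow, map_pow]
    rcases MulChar.isQuadratic_iff_sq_eq_one.mpr hχ (p : ZMod q) with h | h | h
    · rw [h, sum_range_succ']
      simp
    · rw [h]
      simp only [one_pow, sum_const, card_range, nsmul_eq_mul, mul_one]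
      exact_mod_cast Nat.succ_le_succ (Nat.zero_le _)
    · rw [h, neg_one_geom_sum, if_neg (by simp [parity_simps])]
  | coprime a b ha hb hab iha ihb =>
    rw [mul_pow, χ.isMultiplicative_zetaMul.map_mul_of_coprime (hab.pow 2 2)]
    have h1 := iha (by lia)
    have h2 := ihb (by lia)
    calc (1 : ℂ) = 1 * 1 := by ring
      _ ≤ _ := mul_le_mul h1 h2 zero_le_one (zero_le_one.trans h1)

lemma le_norm_of_sq_eq_one {q : ℕ} [NeZero q] {χ : DirichletCharacter ℂ q} (hχ : χ ≠ 1)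
    (hχ2 : χ ^ 2 = 1) {l : ℂ} (hl : IsValueAtOne χ l) : 1 / (32 * q) ≤ ‖l‖ := by
  have hq : (1 : ℝ) ≤ q := by exact_mod_cast Nat.one_le_iff_ne_zero.2 (NeZero.ne q)
  set x : ℝ := 1 - 1 / (2 * (4 * q) ^ 2) with hxdef
  have hsmall : 1 / (2 * (4 * (q : ℝ)) ^ 2) < 1 := by
    rw [div_lt_one (by positivity)]
    nlinarith
  have hx : 0 < x := by linarith
  have hx1 : x < 1 := by
    have : 0 < 1 / (2 * (4 * (q : ℝ)) ^ 2) := by positivity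
    linarith
  have hy : 0 < 1 - x := by linarith
  have key : ∀ N ≥ (4 * q) ^ 2, (q : ℝ) ≤
      ‖∑ n ∈ Ioc 0 N, χ (n : ZMod q) * ((1 / n : ℝ) : ℂ)‖ * (1 / (1 - x))
        + N * (x ^ N / (1 - x)) := by
    intro N hN
    set S := ∑ n ∈ Ioc 0 N, χ (n : ZMod q) * ((1 / n : ℝ) : ℂ)
    set F := ∑ n ∈ Ioc 0 N, χ (n : ZMod q) * ((x ^ n / (1 - x ^ n) : ℝ) : ℂ) with hF
    set G := ∑ n ∈ Ioc 0 N, χ.zetaMul n * ((x ^ n : ℝ) : ℂ) with hG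
    have h1 : ‖S * ((1 / (1 - x) : ℝ) : ℂ) - F‖ ≤ q := by
      have := norm_sum_Ioc_mul_le_of_antitone (norm_sum_Ioc_character_le hχ)
        (g := lambertGap x) (M := 0) (N := N) (lambertGap_nonneg hx hx1)
        (fun n hn ↦ lambertGap_succ_le hx hx1 hn) (Nat.zero_le _)
      rw [zero_add, lambertGap_one hx1, mul_one] at this
      refine le_of_eq_of_le (congrArg _ ?_) this
      rw [sum_mul, hF, ← sum_sub_distrib]
      refine sum_congr rfl fun n _ ↦ ?_
      rw [lambertGap]
      push_cast
      ring
    have h2 : ‖F - G‖ ≤ N * (x ^ N / (1 - x)) := norm_lambert_sub_sum_le hx hx1 χ N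
    have h3 : (2 * q : ℝ) ≤ G.re := by
      have hterm : ∀ n, 0 ≤ (χ.zetaMul n * ((x ^ n : ℝ) : ℂ)).re := by
        intro n
        rw [Complex.re_mul_ofReal]
        have := (Complex.le_def.1 (DirichletCharacter.zetaMul_nonneg hχ2 n)).1
        exact mul_nonneg this (by positivity)
      rw [hG, Complex.re_sum]
      have hinj : Set.InjOn (fun k : ℕ ↦ k ^ 2) (Ioc 0 (4 * q) : Finset ℕ) :=
        fun a _ b _ h ↦ Nat.pow_left_injective (by norm_num) h
      calc (2 * q : ℝ) = ∑ k ∈ Ioc 0 (4 * q), (1 / 2 : ℝ) := by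
            simp
            ring
        _ ≤ ∑ k ∈ Ioc 0 (4 * q), (χ.zetaMul (k ^ 2) * ((x ^ (k ^ 2) : ℝ) : ℂ)).re := by
            refine sum_le_sum fun k hk ↦ ?_
            rw [mem_Ioc] at hk
            rw [Complex.re_mul_ofReal]
            have ha := (Complex.le_def.1 (one_le_zetaMul_sq hχ2 hk.1.ne')).1
            have hb : 1 / 2 ≤ x ^ (k ^ 2) := by
              have hbern := one_add_mul_le_pow (a := x - 1) (by linarith) (k ^ 2)
              rw [add_sub_cancel] at hbern
              refine le_trans ?_ hbern
              have hkq : (k : ℝ) ≤ 4 * q := by exact_mod_cast hk.2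
              have hk2 : (k : ℝ) ^ 2 ≤ (4 * q) ^ 2 := by gcongr
              have : (k : ℝ) ^ 2 * (1 / (2 * (4 * q) ^ 2)) ≤ 1 / 2 := by
                rw [mul_one_div, div_le_div_iff₀ (by positivity) (by norm_num)]
                linarith
              push_cast
              rw [hxdef]
              linarith
            calc (1 / 2 : ℝ) ≤ 1 * x ^ (k ^ 2) := by linarith
              _ ≤ _ := by gcongr; simpa using ha
        _ = ∑ n ∈ (Ioc 0 (4 * q)).image (fun k ↦ k ^ 2), (χ.zetaMul n * ((x ^ n : ℝ) : ℂ)).re := by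
            rw [sum_image hinj]
        _ ≤ _ := by
            refine sum_le_sum_of_subset_of_nonneg ?_ fun n _ _ ↦ hterm n
            intro n hn
            obtain ⟨k, hk, rfl⟩ := mem_image.1 hn
            rw [mem_Ioc] at hk ⊢
            exact ⟨by have := hk.1; positivity, (Nat.pow_le_pow_left hk.2 2).trans hN⟩
    have h4 : ‖G‖ ≤ ‖F‖ + ‖F - G‖ := by
      have := norm_sub_norm_le G F
      rw [norm_sub_rev] at this
      linarith
    have h5 : ‖F‖ ≤ ‖S‖ * (1 / (1 - x)) + q := by
      have h6 : ‖S * ((1 / (1 - x) : ℝ) : ℂ)‖ = ‖S‖ * (1 / (1 - x)) := by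
        rw [norm_mul, Complex.norm_real, Real.norm_of_nonneg (by positivity)]
      have := norm_sub_norm_le F (S * ((1 / (1 - x) : ℝ) : ℂ))
      rw [norm_sub_rev] at this
      linarith
    have h7 := Complex.re_le_norm G
    linarith
  have hlim : Tendsto (fun N : ℕ ↦
      ‖∑ n ∈ Ioc 0 N, χ (n : ZMod q) * ((1 / n : ℝ) : ℂ)‖ * (1 / (1 - x))
        + N * (x ^ N / (1 - x))) atTop (𝓝 (‖l‖ * (1 / (1 - x)) + 0 / (1 - x))) := by
    refine (hl.tendsto.norm.mul_const _).add ?_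
    refine ((tendsto_self_mul_const_pow_of_lt_one hx.le hx1).div_const (1 - x)).congr fun n ↦ ?_
    ring
  have hfin := ge_of_tendsto hlim (eventually_atTop.2 ⟨_, key⟩)
  have hx2 : 1 / (1 - x) = 2 * (4 * q) ^ 2 := by
    rw [hxdef, sub_sub_cancel, one_div_one_div]
  rw [hx2, zero_div, add_zero] at hfin
  rw [div_le_iff₀ (by positivity)]
  have : (q : ℝ) * 1 ≤ q * (‖l‖ * (32 * q)) := by linarith
  exact le_of_mul_le_mul_left this (by linarith)

open scoped LSeries.notation

lemma tendsto_sum_LSeries {q : ℕ} (χ : DirichletCharacter ℂ q) {t : ℝ} (ht : 0 < t) :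
    Tendsto (fun N : ℕ ↦ ∑ n ∈ Ioc 0 N, χ (n : ZMod q) * (((n : ℝ) ^ (-(1 + t)) : ℝ) : ℂ)) atTop
      (𝓝 (L ↗χ (1 + t))) := by
  have hs : 1 < (1 + t : ℂ).re := by simpa
  have h := (DirichletCharacter.LSeriesSummable_of_one_lt_re χ hs).hasSum.tendsto_sum_nat
  refine ((tendsto_add_atTop_iff_nat 1).2 h).congr fun N ↦ ?_
  induction N with
  | zero => simp
  | succ N ih =>
    rw [sum_range_succ, ih, sum_Ioc_succ_top (Nat.zero_le N), LSeries.term_of_ne_zero (by simp),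
      div_eq_mul_inv, Real.rpow_neg (by positivity), Complex.ofReal_inv,
      Complex.ofReal_cpow (by positivity)]
    push_cast
    rfl

lemma log_div_succ_le {n : ℕ} (hn : 0 < n) :
    Real.log (n + 1) - Real.log n ≤ 1 / n := by
  have hn' : (0 : ℝ) < n := by exact_mod_cast hn
  rw [← Real.log_div (by positivity) (by positivity)]
  have := Real.log_le_sub_one_of_pos (x := ((n : ℝ) + 1) / n) (by positivity)
  refine this.trans_eq ?_
  field_simp
  ring

lemma one_div_succ_le_log {n : ℕ} (hn : 0 < n) :
    1 / ((n : ℝ) + 1) ≤ Real.log (n + 1) - Real.log n := by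
  have hn' : (0 : ℝ) < n := by exact_mod_cast hn
  have := Real.log_le_sub_one_of_pos (x := (n : ℝ) / (n + 1)) (by positivity)
  rw [Real.log_div (by positivity) (by positivity)] at this
  have h2 : (n : ℝ) / (n + 1) - 1 = - (1 / (n + 1)) := by
    field_simp
    ring
  linarith

lemma rpow_neg_eq_exp {x t : ℝ} (hx : 0 < x) : x ^ (-t) = Real.exp (-(t * Real.log x)) := by
  rw [Real.rpow_def_of_pos hx]
  ring_nf

lemma rpow_neg_one_add {x t : ℝ} (hx : 0 < x) : x ^ (-(1 + t)) = 1 / x * x ^ (-t) := by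
  rw [neg_add, Real.rpow_add hx, Real.rpow_neg_one, one_div]

lemma abs_sub_rpow_succ_le {t : ℝ} (ht : 0 < t) {n : ℕ} (hn : 0 < n) :
    |(1 / (n : ℝ) - (n : ℝ) ^ (-(1 + t)))
      - (1 / ((n + 1 : ℕ) : ℝ) - ((n + 1 : ℕ) : ℝ) ^ (-(1 + t)))|
      ≤ t * ((Real.log n + 2) / n - (Real.log (n + 1 : ℕ) + 2) / (n + 1 : ℕ)) := by
  have hn' : (0 : ℝ) < n := by exact_mod_cast hn
  have hn1 : (1 : ℝ) ≤ n := by exact_mod_cast hn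
  have hup := log_div_succ_le hn
  have hlow := one_div_succ_le_log hn
  push_cast
  rw [rpow_neg_one_add hn', rpow_neg_one_add (by positivity)]
  set a := (n : ℝ) ^ (-t) with ha
  set b := ((n : ℝ) + 1) ^ (-t) with hb
  set u := Real.log n
  set v := Real.log (n + 1)
  have hu : 0 ≤ u := Real.log_nonneg hn1
  have ha1 : 1 - a ≤ t * u := by
    rw [ha, rpow_neg_eq_exp hn']
    have := Real.add_one_le_exp (-(t * u))
    linarith
  have ha0 : a ≤ 1 := Real.rpow_le_one_of_one_le_of_nonpos hn1 (by linarith)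
  have hba : b ≤ a := Real.rpow_le_rpow_of_nonpos hn' (by linarith) (by linarith)
  have hab : a - b ≤ t * (1 / n) := by
    have h1 : b = a * Real.exp (-(t * (v - u))) := by
      rw [hb, ha, rpow_neg_eq_exp hn', rpow_neg_eq_exp (by positivity), ← Real.exp_add]
      congr 1
      ring
    have h2 := Real.add_one_le_exp (-(t * (v - u)))
    have h3 : 0 < a := Real.rpow_pos_of_pos hn' _
    have h4 : 1 - Real.exp (-(t * (v - u))) ≤ t * (1 / n) := by
      have : t * (v - u) ≤ t * (1 / n) := by gcongr
      linarith
    have h5 : 0 ≤ t * (1 / (n : ℝ)) := by positivity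
    rw [h1]
    nlinarith
  have e1 : 1 / (n : ℝ) - 1 / n * a - (1 / ((n : ℝ) + 1) - 1 / (n + 1) * b)
      = (1 - a) * (1 / (n * (n + 1))) - (a - b) * (1 / (n + 1)) := by
    field_simp
    ring
  have e2 : (u + 2) / n - (v + 2) / (n + 1)
      = (u + 2) * (1 / (n * (n + 1))) - (v - u) * (1 / (n + 1)) := by
    field_simp
    ring
  have e3 : (1 : ℝ) / n * (1 / (n + 1)) = 1 / (n * (n + 1)) := by
    field_simp
  have p1 : 0 < 1 / ((n : ℝ) * (n + 1)) := by positivity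
  have p2 : 0 < 1 / ((n : ℝ) + 1) := by positivity
  have m1 : (1 - a) * (1 / ((n : ℝ) * (n + 1))) ≤ t * u * (1 / (n * (n + 1))) := by gcongr
  have m2 : (a - b) * (1 / ((n : ℝ) + 1)) ≤ t * (1 / (n * (n + 1))) := by
    rw [← e3, ← mul_assoc]
    gcongr
  have m3 : (v - u) * (1 / ((n : ℝ) + 1)) ≤ 1 / (n * (n + 1)) := by
    rw [← e3]
    gcongr
  have m4 : 0 ≤ (1 - a) * (1 / ((n : ℝ) * (n + 1))) := mul_nonneg (by linarith) p1.le
  have m5 : 0 ≤ (a - b) * (1 / ((n : ℝ) + 1)) := mul_nonneg (by linarith) p2.le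
  have m6 : 0 ≤ u * (1 / ((n : ℝ) * (n + 1))) := by positivity
  have m7 := mul_le_mul_of_nonneg_left m3 ht.le
  have m8 := mul_nonneg ht.le m6
  rw [e1, e2, abs_le]
  constructor <;> nlinarith

lemma norm_sub_LSeries_le {q : ℕ} [NeZero q] {χ : DirichletCharacter ℂ q} (hχ : χ ≠ 1) {l : ℂ}
    (hl : IsValueAtOne χ l) {t : ℝ} (ht : 0 < t) : ‖l - L ↗χ (1 + t)‖ ≤ q * (2 * t) := by
  refine le_of_tendsto ((hl.tendsto.sub (tendsto_sum_LSeries χ ht)).norm) ?_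
  filter_upwards with N
  rw [← sum_sub_distrib]
  have h := norm_sum_Ioc_mul_le (norm_sum_Ioc_character_le hχ)
    (fun n ↦ 1 / (n : ℝ) - (n : ℝ) ^ (-(1 + t))) (Nat.zero_le N)
  simp only [Complex.ofReal_sub, mul_sub] at h
  refine h.trans ?_
  gcongr
  have h1 : ∑ n ∈ Ioc 0 N, |(1 / (n : ℝ) - (n : ℝ) ^ (-(1 + t)))
      - (1 / ((n + 1 : ℕ) : ℝ) - ((n + 1 : ℕ) : ℝ) ^ (-(1 + t)))|
      ≤ t * (2 - (Real.log (N + 1 : ℕ) + 2) / (N + 1 : ℕ)) := by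
    induction N with
    | zero => simp
    | succ N ih =>
      rw [sum_Ioc_succ_top (Nat.zero_le N)]
      have := abs_sub_rpow_succ_le ht (Nat.succ_pos N)
      have := ih (by
        have h := norm_sum_Ioc_mul_le (norm_sum_Ioc_character_le hχ)
          (fun n ↦ 1 / (n : ℝ) - (n : ℝ) ^ (-(1 + t))) (Nat.zero_le N)
        simpa only [Complex.ofReal_sub, mul_sub] using h)
      simp only [Nat.succ_eq_add_one] at *
      linarith
  have h2 : |1 / ((N + 1 : ℕ) : ℝ) - ((N + 1 : ℕ) : ℝ) ^ (-(1 + t))|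
      ≤ t * ((Real.log (N + 1 : ℕ) + 2) / (N + 1 : ℕ)) := by
    have hp : (0 : ℝ) < (N + 1 : ℕ) := by positivity
    have hp1 : (1 : ℝ) ≤ (N + 1 : ℕ) := by simp
    rw [rpow_neg_one_add hp]
    set M : ℝ := ((N + 1 : ℕ) : ℝ)
    have ha0 : M ^ (-t) ≤ 1 := Real.rpow_le_one_of_one_le_of_nonpos hp1 (by linarith)
    have ha1 : 1 - M ^ (-t) ≤ t * (Real.log M + 2) := by
      rw [rpow_neg_eq_exp hp]
      have := Real.add_one_le_exp (-(t * Real.log M))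
      linarith
    have e : 1 / M - 1 / M * M ^ (-t) = (1 - M ^ (-t)) / M := by ring
    rw [e, abs_of_nonneg (div_nonneg (by linarith) hp.le), ← mul_div_assoc]
    gcongr
  linarith

lemma norm_LSeries_le {q : ℕ} [NeZero q] {χ : DirichletCharacter ℂ q} (hχ : χ ≠ 1) {t : ℝ}
    (ht : 0 < t) : ‖L ↗χ (1 + t)‖ ≤ q := by
  refine le_of_tendsto (tendsto_sum_LSeries χ ht).norm (Eventually.of_forall fun N ↦ ?_)
  have := norm_sum_Ioc_mul_le_of_antitone (norm_sum_Ioc_character_le hχ)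
    (g := fun n : ℕ ↦ (n : ℝ) ^ (-(1 + t))) (M := 0) (N := N) (fun n ↦ by positivity)
    (fun n hn ↦ Real.rpow_le_rpow_of_nonpos (by exact_mod_cast hn) (by push_cast; linarith)
      (by linarith)) (Nat.zero_le _)
  simpa using this

lemma sum_rpow_le {t : ℝ} (ht : 0 < t) (N : ℕ) :
    ∑ n ∈ Ioc 0 (N + 1), (n : ℝ) ^ (-(1 + t)) ≤ 1 + 1 / t - ((N + 1 : ℕ) : ℝ) ^ (-t) / t := by
  induction N with
  | zero => simp
  | succ N ih =>
    rw [sum_Ioc_succ_top (Nat.zero_le _)]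
    have hp : (0 : ℝ) < (N + 1 : ℕ) := by positivity
    have hlow := one_div_succ_le_log (Nat.succ_pos N)
    simp only [Nat.succ_eq_add_one] at hlow
    have hcast : ((N + 1 + 1 : ℕ) : ℝ) = ((N + 1 : ℕ) : ℝ) + 1 := by push_cast; ring
    rw [hcast]
    set M : ℝ := ((N + 1 : ℕ) : ℝ)
    rw [rpow_neg_one_add (by positivity)]
    have h1 : M ^ (-t) = (M + 1) ^ (-t) * Real.exp (t * (Real.log (M + 1) - Real.log M)) := by
      rw [rpow_neg_eq_exp hp, rpow_neg_eq_exp (by positivity), ← Real.exp_add]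
      congr 1
      ring
    have h2 := Real.add_one_le_exp (t * (Real.log (M + 1) - Real.log M))
    have h3 : 0 < (M + 1) ^ (-t) := by positivity
    have h4 : (M + 1) ^ (-t) * (t * (1 / (M + 1)) + 1) ≤ M ^ (-t) := by
      rw [h1]
      gcongr
      refine le_trans ?_ h2
      gcongr
    have h5 : 1 / (M + 1) * (M + 1) ^ (-t) ≤ M ^ (-t) / t - (M + 1) ^ (-t) / t := by
      rw [← sub_div, le_div_iff₀ ht]
      linarith
    linarith

lemma norm_LSeries_one_le {q : ℕ} {t : ℝ} (ht : 0 < t) :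
    ‖L ↗(1 : DirichletCharacter ℂ q) (1 + t)‖ ≤ 1 + 1 / t := by
  refine le_of_tendsto (tendsto_sum_LSeries 1 ht).norm ?_
  filter_upwards [eventually_ge_atTop 1] with N hN
  obtain ⟨N, rfl⟩ := Nat.exists_eq_add_of_le' hN
  refine (norm_sum_le_of_le (f := _) (n := fun n : ℕ ↦ (n : ℝ) ^ (-(1 + t))) _ fun n _ ↦ ?_).trans
    ((sum_rpow_le ht N).trans ?_)
  · rw [norm_mul, Complex.norm_real, Real.norm_of_nonneg (by positivity)]
    exact mul_le_of_le_one_left (by positivity) (DirichletCharacter.norm_le_one _ _)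
  · have : 0 ≤ ((N + 1 : ℕ) : ℝ) ^ (-t) / t := by positivity
    linarith

lemma le_norm_of_sq_ne_one {q : ℕ} [NeZero q] {χ : DirichletCharacter ℂ q} (hχ : χ ≠ 1)
    (hχ2 : χ ^ 2 ≠ 1) {l : ℂ} (hl : IsValueAtOne χ l) : 1 / (1025 * q ^ 4) ≤ ‖l‖ := by
  have hq : (1 : ℝ) ≤ q := by exact_mod_cast Nat.one_le_iff_ne_zero.2 (NeZero.ne q)
  set t : ℝ := 1 / (2049 * q ^ 5) with htdef
  have ht : 0 < t := by positivity
  have hq5 : (1 : ℝ) ≤ q ^ 5 := one_le_pow₀ hq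
  have ht1 : t ≤ 1 := by
    rw [htdef, div_le_one (by positivity)]
    linarith
  have h0 := DirichletCharacter.norm_LSeries_product_ge_one (χ := χ) ht 0
  simp only [Complex.ofReal_zero, mul_zero, add_zero, norm_mul, norm_pow] at h0
  have h1 : ‖L ↗(1 : DirichletCharacter ℂ q) (1 + t)‖ ≤ 2 / t := by
    refine (norm_LSeries_one_le ht).trans ?_
    have : 1 ≤ 1 / t := by rwa [le_div_iff₀ ht, one_mul]
    rw [show 2 / t = 1 / t + 1 / t by ring]
    linarith
  have h2 : ‖L ↗(χ ^ 2 :) (1 + t)‖ ≤ q := norm_LSeries_le hχ2 ht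
  by_contra! hcon
  have h3 : 1 / (1025 * (q : ℝ) ^ 4) ≤ q * (2 * t) := by
    have e : q * (2 * t) = 2 / (2049 * (q : ℝ) ^ 4) := by
      rw [htdef]
      field_simp
    rw [e, div_le_div_iff₀ (by positivity) (by positivity)]
    nlinarith [one_le_pow₀ hq (n := 4)]
  have h4 : ‖L ↗χ (1 + t)‖ ≤ 4 * q * t := by
    have := norm_sub_LSeries_le hχ hl ht
    have h5 := norm_sub_norm_le (L ↗χ (1 + t)) l
    rw [norm_sub_rev] at h5
    linarith
  have h6 : (1 : ℝ) ≤ (2 / t) ^ 3 * (4 * q * t) ^ 4 * q := by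
    refine h0.le.trans ?_
    gcongr
  have h7 : (2 / t) ^ 3 * (4 * q * t) ^ 4 * q = 2048 / 2049 := by
    rw [htdef]
    field_simp
    norm_num
  norm_num [h7] at h6

lemma le_norm_of_isValueAtOne {q : ℕ} [NeZero q] {χ : DirichletCharacter ℂ q} (hχ : χ ≠ 1) {l : ℂ}
    (hl : IsValueAtOne χ l) : 1 / (1025 * q ^ 4) ≤ ‖l‖ := by
  by_cases h : χ ^ 2 = 1
  · refine le_trans ?_ (le_norm_of_sq_eq_one hχ h hl)
    have hq : (1 : ℝ) ≤ q := by exact_mod_cast Nat.one_le_iff_ne_zero.2 (NeZero.ne q)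
    have : (q : ℝ) ≤ q ^ 4 := le_self_pow₀ hq (by norm_num)
    gcongr
    norm_num
  · exact le_norm_of_sq_ne_one hχ h hl

lemma norm_sum_character_mul_log_div_le {q : ℕ} [NeZero q] {χ : DirichletCharacter ℂ q}
    (hχ : χ ≠ 1) (N : ℕ) :
    ‖∑ n ∈ Ioc 0 N, χ (n : ZMod q) * ((Real.log n / n : ℝ) : ℂ)‖ ≤ 2 * q := by
  have hq : (1 : ℝ) ≤ q := by exact_mod_cast Nat.one_le_iff_ne_zero.2 (NeZero.ne q)
  have hle : ∀ n : ℕ, Real.log n / n ≤ 1 := fun n ↦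
    div_le_one_of_le₀ (Real.log_le_self (by positivity)) (by positivity)
  have h2 : ‖χ ((2 : ℕ) : ZMod q) * ((Real.log (2 : ℕ) / (2 : ℕ) : ℝ) : ℂ)‖ ≤ 1 := by
    rw [norm_mul, Complex.norm_real,
      Real.norm_of_nonneg (div_nonneg (Real.log_natCast_nonneg _) (by positivity))]
    exact mul_le_one₀ (DirichletCharacter.norm_le_one _ _)
      (div_nonneg (Real.log_natCast_nonneg _) (by positivity)) (hle 2)
  rcases Nat.lt_or_ge N 2 with hN | hN
  · interval_cases N
    · simp
    · simp
  · rw [← sum_Ioc_consecutive _ (Nat.zero_le 2) hN]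
    have h3 := norm_sum_Ioc_mul_le_of_antitone (norm_sum_Ioc_character_le hχ)
      (g := fun n : ℕ ↦ Real.log n / n) (M := 2) (N := N)
      (fun n ↦ div_nonneg (Real.log_natCast_nonneg _) (by positivity)) (fun n hn ↦ by
        have hn3 : (3 : ℝ) ≤ n := by exact_mod_cast hn
        have he := Real.exp_one_lt_three
        refine Real.log_div_self_antitoneOn ?_ ?_ ?_
        · show Real.exp 1 ≤ n
          linarith
        · show Real.exp 1 ≤ (n + 1 : ℕ)
          push_cast
          linarith
        · push_cast
          linarith) hN
    have h4 : ∑ n ∈ Ioc (0 : ℕ) 2, χ (n : ZMod q) * ((Real.log n / n : ℝ) : ℂ)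
        = χ ((2 : ℕ) : ZMod q) * ((Real.log (2 : ℕ) / (2 : ℕ) : ℝ) : ℂ) := by
      rw [sum_Ioc_succ_top (by norm_num), sum_Ioc_succ_top (by norm_num)]
      simp
    rw [h4]
    refine (norm_add_le _ _).trans ?_
    have h5 : (q : ℝ) * (Real.log (2 + 1 : ℕ) / (2 + 1 : ℕ)) ≤ q * 1 := by
      gcongr
      exact hle _
    linarith

lemma norm_sum_character_mul_vonMangoldt_le {q : ℕ} [NeZero q] {χ : DirichletCharacter ℂ q}
    (hχ : χ ≠ 1) (N : ℕ) :
    ‖∑ n ∈ Ioc 0 N, χ (n : ZMod q) * ((Λ n / n : ℝ) : ℂ)‖ ≤ 8200 * q ^ 5 := by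
  have hq : (1 : ℝ) ≤ q := by exact_mod_cast Nat.one_le_iff_ne_zero.2 (NeZero.ne q)
  rcases Nat.eq_zero_or_pos N with rfl | hN
  · simp
  have hN' : (0 : ℝ) < N := by exact_mod_cast hN
  obtain ⟨l, hl⟩ := exists_sum_div_tail_le hχ
  set A := ∑ n ∈ Ioc 0 N, χ (n : ZMod q) * ((Λ n / n : ℝ) : ℂ) with hA
  set D := ∑ n ∈ Ioc 0 N, χ (n : ZMod q) * ((Real.log n / n : ℝ) : ℂ) with hD
  have hconv : D = ∑ d ∈ Ioc 0 N, χ (d : ZMod q) * ((Λ d / d : ℝ) : ℂ)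
      * ∑ k ∈ Ioc 0 (N / d), χ (k : ZMod q) * ((1 / k : ℝ) : ℂ) := by
    have := sum_Ioc_sum_divisors (fun d n ↦ χ (n : ZMod q) * ((Λ d / n : ℝ) : ℂ)) N
    refine Eq.trans ?_ (this.trans ?_)
    · refine sum_congr rfl fun n _ ↦ ?_
      rw [← ArithmeticFunction.vonMangoldt_sum, sum_div, Complex.ofReal_sum, mul_sum]
    · refine sum_congr rfl fun d _ ↦ ?_
      rw [mul_sum]
      refine sum_congr rfl fun k _ ↦ ?_
      push_cast
      rw [map_mul]
      ring
  have hψ : ∑ n ∈ Ioc 0 N, Λ n ≤ 6 * N := by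
    have h := Chebyshev.psi_le_const_mul_self (x := N) hN'.le
    have h4 : Real.log 4 ≤ 2 := by
      rw [show (4 : ℝ) = 2 ^ 2 by norm_num, Real.log_pow]
      have := Real.log_two_lt_d9
      push_cast
      linarith
    rw [Chebyshev.psi, Nat.floor_natCast] at h
    nlinarith
  have herr : ‖A * l - D‖ ≤ 6 * q := by
    rw [hconv, hA, sum_mul, ← sum_sub_distrib]
    calc _ ≤ ∑ d ∈ Ioc 0 N, Λ d * (q / N) := by
          refine norm_sum_le_of_le _ fun d hd ↦ ?_
          have hd0 : (0 : ℝ) < d := by exact_mod_cast (mem_Ioc.1 hd).1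
          rw [← mul_sub, norm_mul, norm_mul, Complex.norm_real, Real.norm_of_nonneg
            (div_nonneg ArithmeticFunction.vonMangoldt_nonneg (by positivity))]
          have h1 : (N : ℝ) ≤ d * ((N / d : ℕ) + 1) := by
            exact_mod_cast (Nat.lt_mul_div_succ N (mem_Ioc.1 hd).1).le
          have h2 := ArithmeticFunction.vonMangoldt_nonneg (n := d)
          calc _ ≤ 1 * (Λ d / d) * (q / ((N / d : ℕ) + 1)) := by
                gcongr
                · exact DirichletCharacter.norm_le_one _ _
                · exact hl _
            _ = Λ d * (q / (d * ((N / d : ℕ) + 1))) := by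
                field_simp
            _ ≤ Λ d * (q / N) := by gcongr
      _ = (∑ n ∈ Ioc 0 N, Λ n) * (q / N) := by rw [sum_mul]
      _ ≤ 6 * N * (q / N) := by gcongr
      _ = 6 * q := by field_simp
  have hD2 : ‖D‖ ≤ 2 * q := norm_sum_character_mul_log_div_le hχ N
  have hAl : ‖A‖ * ‖l‖ ≤ 8 * q := by
    rw [← norm_mul]
    have := norm_sub_norm_le (A * l) D
    linarith
  have hlow : 1 / (1025 * (q : ℝ) ^ 4) ≤ ‖l‖ := le_norm_of_isValueAtOne hχ hl
  have h1 : ‖A‖ * (1 / (1025 * (q : ℝ) ^ 4)) ≤ 8 * q :=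
    (mul_le_mul_of_nonneg_left hlow (norm_nonneg _)).trans hAl
  rw [mul_one_div, div_le_iff₀ (by positivity)] at h1
  linarith

lemma log_sub_one_le_sum_vonMangoldt_div {N : ℕ} (hN : 0 < N) :
    Real.log N - 1 ≤ ∑ n ∈ Ioc 0 N, Λ n / n := by
  have hN' : (0 : ℝ) < N := by exact_mod_cast hN
  have hstir := Stirling.le_log_factorial_stirling hN.ne'
  have h1 : 0 ≤ Real.log N := Real.log_natCast_nonneg N
  have h2 : 0 ≤ Real.log (2 * Real.pi) := Real.log_nonneg (by linarith [Real.pi_gt_three])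
  have h3 : Real.log (Nat.factorial N) = ∑ n ∈ Ioc 0 N, Real.log n := by
    clear hstir h1 hN' hN
    induction N with
    | zero => simp
    | succ N ih =>
      rw [sum_Ioc_succ_top (Nat.zero_le N), ← ih, Nat.factorial_succ, Nat.cast_mul,
        Real.log_mul (by positivity) (by positivity), add_comm]
  have h4 : ∑ n ∈ Ioc 0 N, Real.log n ≤ N * ∑ n ∈ Ioc 0 N, Λ n / n := by
    simp_rw [← ArithmeticFunction.vonMangoldt_sum]
    rw [sum_Ioc_sum_divisors (fun d _ ↦ Λ d), mul_sum]
    refine sum_le_sum fun d hd ↦ ?_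
    rw [sum_const, Nat.card_Ioc, nsmul_eq_mul, Nat.sub_zero]
    have := ArithmeticFunction.vonMangoldt_nonneg (n := d)
    calc ((N / d : ℕ) : ℝ) * Λ d ≤ (N / d : ℝ) * Λ d := by
          gcongr
          exact Nat.cast_div_le
      _ = _ := by ring
  have h5 : N * (Real.log N - 1) ≤ N * ∑ n ∈ Ioc 0 N, Λ n / n := by linarith
  exact le_of_mul_le_mul_left h5 hN'

lemma exists_sum_vonMangoldt_not_prime_le : ∃ W : ℝ, 0 ≤ W ∧ ∀ N : ℕ,
    ∑ n ∈ Ioc 0 N, (Λ n / n - if n.Prime then Real.log n / n else 0) ≤ W := by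
  have hs := ArithmeticFunction.vonMangoldt.summable_residueClass_non_primes_div (0 : ZMod 1)
  have hnn : ∀ n : ℕ, 0 ≤ (if n.Prime then 0 else
      ArithmeticFunction.vonMangoldt.residueClass (0 : ZMod 1) n) / n := by
    intro n
    have := ArithmeticFunction.vonMangoldt.residueClass_nonneg (0 : ZMod 1) n
    split_ifs <;> positivity
  refine ⟨_, tsum_nonneg hnn, fun N ↦ le_of_eq_of_le (sum_congr rfl fun n _ ↦ ?_)
    (hs.sum_le_tsum (Ioc 0 N) fun n _ ↦ hnn n)⟩
  have hr : ArithmeticFunction.vonMangoldt.residueClass (0 : ZMod 1) n = Λ n := by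
    rw [ArithmeticFunction.vonMangoldt.residueClass, Set.indicator_of_mem]
    exact Subsingleton.elim _ _
  rw [hr]
  split_ifs with h
  · simp [ArithmeticFunction.vonMangoldt_apply_prime h]
  · simp

lemma sum_log_div_prime_dvd_le {q : ℕ} (hq : q ≠ 0) (N : ℕ) :
    ∑ n ∈ Ioc 0 N, (if n.Prime ∧ n ∣ q then Real.log n / n else 0) ≤ q := by
  rw [← sum_filter]
  have hle : ∀ n : ℕ, Real.log n / n ≤ 1 := fun n ↦
    div_le_one_of_le₀ (Real.log_le_self (by positivity)) (by positivity)
  calc _ ≤ ∑ n ∈ (Ioc 0 N).filter (fun n ↦ n.Prime ∧ n ∣ q), (1 : ℝ) :=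
        sum_le_sum fun n _ ↦ hle n
    _ ≤ ∑ n ∈ q.divisors, (1 : ℝ) := by
        refine sum_le_sum_of_subset_of_nonneg (fun n hn ↦ ?_) fun _ _ _ ↦ zero_le_one
        exact Nat.mem_divisors.2 ⟨(mem_filter.1 hn).2.2, hq⟩
    _ ≤ q := by
        rw [sum_const, nsmul_eq_mul, mul_one]
        exact_mod_cast Nat.card_divisors_le_self q

/-- Mertens' first theorem in arithmetic progressions, lower bound with polynomial dependence on
the modulus. -/
lemma exists_log_sub_le_totient_mul_sum : ∃ C : ℝ, 1 ≤ C ∧ ∀ q : ℕ, 0 < q → ∀ N : ℕ, 0 < N →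
    Real.log N - C * q ^ 6 ≤ q.totient *
      ∑ n ∈ Ioc 0 N, (if n.Prime ∧ (n : ZMod q) = 1 then Real.log n / n else 0) := by
  obtain ⟨W, hW0, hW⟩ := exists_sum_vonMangoldt_not_prime_le
  refine ⟨8202 + 2 * W, by linarith, fun q hq0 N hN ↦ ?_⟩
  have : NeZero q := ⟨hq0.ne'⟩
  have hq : (1 : ℝ) ≤ q := by exact_mod_cast hq0
  set w : ℕ → ℝ := fun n ↦ if n.Prime then Real.log n / n else 0 with hw
  have hw0 : ∀ n, 0 ≤ w n := fun n ↦ by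
    simp only [hw]
    split_ifs
    · exact div_nonneg (Real.log_natCast_nonneg _) (by positivity)
    · rfl
  have hwΛ : ∀ n, w n ≤ Λ n / n := fun n ↦ by
    simp only [hw]
    split_ifs with h
    · rw [ArithmeticFunction.vonMangoldt_apply_prime h]
    · exact div_nonneg ArithmeticFunction.vonMangoldt_nonneg (by positivity)
  set P : DirichletCharacter ℂ q → ℂ := fun χ ↦ ∑ n ∈ Ioc 0 N, χ (n : ZMod q) * (w n : ℂ) with hP
  have hne : ∀ χ : DirichletCharacter ℂ q, χ ≠ 1 → -(8200 * (q : ℝ) ^ 5 + W) ≤ (P χ).re := by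
    intro χ hχ
    have h1 := norm_sum_character_mul_vonMangoldt_le hχ N
    have h2 : ‖∑ n ∈ Ioc 0 N, χ (n : ZMod q) * ((Λ n / n : ℝ) : ℂ) - P χ‖ ≤ W := by
      rw [hP, ← sum_sub_distrib]
      refine (norm_sum_le_of_le _ fun n _ ↦ ?_).trans (hW N)
      rw [← mul_sub, ← Complex.ofReal_sub, norm_mul, Complex.norm_real,
        Real.norm_of_nonneg (sub_nonneg.2 (hwΛ n))]
      exact mul_le_of_le_one_left (sub_nonneg.2 (hwΛ n)) (DirichletCharacter.norm_le_one _ _)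
    have h3 := norm_sub_norm_le (P χ) (∑ n ∈ Ioc 0 N, χ (n : ZMod q) * ((Λ n / n : ℝ) : ℂ))
    rw [norm_sub_rev] at h3
    have h4 := (abs_le.1 (Complex.abs_re_le_norm (P χ))).1
    linarith
  have hone : Real.log N - 1 - W - q ≤ (P 1).re := by
    have h1 := log_sub_one_le_sum_vonMangoldt_div hN
    have h2 := hW N
    have h3 := sum_log_div_prime_dvd_le hq0.ne' N
    rw [sum_sub_distrib] at h2
    have h4 : ∑ n ∈ Ioc 0 N, w n
        - ∑ n ∈ Ioc 0 N, (if n.Prime ∧ n ∣ q then Real.log n / n else 0) ≤ (P 1).re := by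
      rw [hP, Complex.re_sum, ← sum_sub_distrib]
      refine sum_le_sum fun n _ ↦ ?_
      rw [Complex.re_mul_ofReal]
      by_cases hu : IsUnit (n : ZMod q)
      · rw [MulChar.one_apply hu]
        simp only [Complex.one_re, one_mul, sub_le_self_iff]
        split_ifs
        · exact div_nonneg (Real.log_natCast_nonneg _) (by positivity)
        · rfl
      · rw [MulChar.map_nonunit _ hu]
        by_cases hp : n.Prime
        · have : n ∣ q := by
            rw [ZMod.isUnit_iff_coprime] at hu
            by_contra hnd
            exact hu ((Nat.Prime.coprime_iff_not_dvd hp).2 hnd)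
          simp [hw, hp, this]
        · simp [hw, hp]
    linarith
  have horth : (q.totient : ℝ) *
      ∑ n ∈ Ioc 0 N, (if n.Prime ∧ (n : ZMod q) = 1 then Real.log n / n else 0)
      = ∑ χ : DirichletCharacter ℂ q, (P χ).re := by
    rw [← Complex.re_sum, hP, sum_comm]
    simp_rw [← sum_mul, DirichletCharacter.sum_characters_eq]
    rw [Complex.re_sum, mul_sum]
    refine sum_congr rfl fun n _ ↦ ?_
    rw [Complex.re_mul_ofReal]
    simp only [hw]
    split_ifs <;> simp_all
  have hcard : (Fintype.card (DirichletCharacter ℂ q) : ℝ) ≤ q := by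
    rw [← Nat.card_eq_fintype_card, DirichletCharacter.card_eq_totient_of_hasEnoughRootsOfUnity]
    exact_mod_cast Nat.totient_le q
  rw [horth, ← add_sum_erase _ _ (mem_univ (1 : DirichletCharacter ℂ q))]
  have hrest : -(q * (8200 * (q : ℝ) ^ 5 + W))
      ≤ ∑ χ ∈ univ.erase (1 : DirichletCharacter ℂ q), (P χ).re := by
    have h1 := card_nsmul_le_sum (univ.erase (1 : DirichletCharacter ℂ q)) (fun χ ↦ (P χ).re) _
      fun χ hχ ↦ hne χ (ne_of_mem_erase hχ)
    rw [nsmul_eq_mul] at h1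
    refine le_trans ?_ h1
    have h2 : (#(univ.erase (1 : DirichletCharacter ℂ q)) : ℝ) ≤ q := by
      refine le_trans ?_ hcard
      exact_mod_cast card_le_univ _
    have h3 : 0 ≤ 8200 * (q : ℝ) ^ 5 + W := by positivity
    nlinarith
  have h6 : (1 : ℝ) ≤ q ^ 6 := one_le_pow₀ hq
  have h7 : (q : ℝ) ≤ q ^ 6 := le_self_pow₀ hq (by norm_num)
  nlinarith [mul_le_mul_of_nonneg_left h6 hW0, mul_le_mul_of_nonneg_left h7 hW0]

lemma log_max_sub_le {C u v : ℝ} (hC : 1 ≤ C) (hv : C ≤ v) (huv : v ≤ u) (h1 : u - v ≤ 1) :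
    Real.log u - Real.log v - (1 / v - 1 / u) ≤ (u - v) / u := by
  have hv0 : 0 < v := by linarith
  have hu0 : 0 < u := by linarith
  have h2 : Real.log u - Real.log v ≤ u / v - 1 := by
    rw [← Real.log_div hu0.ne' hv0.ne']
    exact Real.log_le_sub_one_of_pos (by positivity)
  have h3 : u / v - 1 - (1 / v - 1 / u) - (u - v) / u = (u - v) * (u - v - 1) / (u * v) := by
    field_simp
    ring
  have h4 : (u - v) * (u - v - 1) / (u * v) ≤ 0 :=
    div_nonpos_of_nonpos_of_nonneg
      (mul_nonpos_of_nonneg_of_nonpos (by linarith) (by linarith)) (by positivity)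
  linarith

/-- Partial summation: Mertens' first theorem implies a lower bound of the second. -/
lemma log_log_sub_le_sum_div_log {a : ℕ → ℝ} (ha : ∀ n, 0 ≤ a n) (ha1 : a 1 = 0) {C : ℝ}
    (hC : 1 ≤ C) {X : ℕ} (hX : 1 ≤ X)
    (h : ∀ n : ℕ, 1 ≤ n → Real.log n - C ≤ ∑ k ∈ Ioc 0 n, a k) :
    Real.log (max C (Real.log X)) - Real.log C - 2 ≤ ∑ n ∈ Ioc 0 X, a n / Real.log n := by
  set w : ℕ → ℝ := fun n ↦ max C (Real.log n) with hw
  have hwC : ∀ n, C ≤ w n := fun n ↦ le_max_left _ _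
  have hw0 : ∀ n, 0 < w n := fun n ↦ by linarith [hwC n]
  have hwmono : ∀ n, 1 ≤ n → w n ≤ w (n + 1) := fun n hn ↦ by
    refine max_le_max le_rfl (Real.log_le_log (by exact_mod_cast hn) ?_)
    push_cast
    linarith
  have hstep : ∀ n : ℕ, 1 ≤ n → Real.log (n + 1 : ℕ) - Real.log n ≤ 1 := fun n hn ↦ by
    rw [Nat.cast_succ]
    refine (log_div_succ_le hn).trans ?_
    exact div_le_one_of_le₀ (by exact_mod_cast hn) (by positivity)
  have hwstep : ∀ n, 1 ≤ n → w (n + 1) - w n ≤ Real.log (n + 1 : ℕ) - Real.log n := fun n hn ↦ by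
    have h2 : Real.log n ≤ Real.log (n + 1 : ℕ) :=
      Real.log_le_log (by exact_mod_cast hn) (by push_cast; linarith)
    have h3 : w (n + 1) ≤ w n + (Real.log (n + 1 : ℕ) - Real.log n) := by
      refine max_le ?_ ?_
      · linarith [hwC n]
      · linarith [le_max_right C (Real.log n)]
    linarith
  have key : ∀ n, 1 ≤ n → Real.log (w n) - Real.log C - 1 / C + 1 / w n - 1
      + (∑ k ∈ Ioc 0 n, a k - (Real.log n - C)) / w n ≤ ∑ k ∈ Ioc 0 n, a k / w k := by
    intro n hn
    induction n, hn using Nat.le_induction with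
    | base =>
      have h1 : w 1 = C := by
        simp only [hw, Nat.cast_one, Real.log_one]
        exact max_eq_left (by linarith)
      have hC0 : C ≠ 0 := by linarith
      simp [h1, ha1, hC0]
    | succ n hn ih =>
      rw [sum_Ioc_succ_top (Nat.zero_le n), sum_Ioc_succ_top (Nat.zero_le n)]
      set T := ∑ k ∈ Ioc 0 n, a k with hT
      have h1 := h n hn
      have h2 : (T - (Real.log n - C)) / w (n + 1) ≤ (T - (Real.log n - C)) / w n :=
        div_le_div_of_nonneg_left (by linarith) (hw0 n) (hwmono n hn)
      have h3 := log_max_sub_le hC (hwC n) (hwmono n hn) ((hwstep n hn).trans (hstep n hn))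
      have h4 : (w (n + 1) - w n) / w (n + 1)
          ≤ (Real.log (n + 1 : ℕ) - Real.log n) / w (n + 1) :=
        div_le_div_of_nonneg_right (hwstep n hn) (hw0 _).le
      have h5 : (T + a (n + 1) - (Real.log (n + 1 : ℕ) - C)) / w (n + 1)
          = (T - (Real.log n - C)) / w (n + 1) + a (n + 1) / w (n + 1)
            - (Real.log (n + 1 : ℕ) - Real.log n) / w (n + 1) := by ring
      rw [h5]
      linarith
  have h1 := key X hX
  have h2 : 0 ≤ (∑ k ∈ Ioc 0 X, a k - (Real.log X - C)) / w X :=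
    div_nonneg (by linarith [h X hX]) (hw0 X).le
  have h3 : 0 ≤ 1 / w X := (one_div_pos.2 (hw0 X)).le
  have h4 : 1 / C ≤ 1 := div_le_one_of_le₀ hC (by linarith)
  have h5 : ∑ k ∈ Ioc 0 X, a k / w k ≤ ∑ k ∈ Ioc 0 X, a k / Real.log k := by
    refine sum_le_sum fun k hk ↦ ?_
    rcases (Nat.succ_le_of_lt (mem_Ioc.1 hk).1).eq_or_lt with rfl | hk2
    · simp [ha1]
    · exact div_le_div_of_nonneg_left (ha k) (Real.log_pos (by exact_mod_cast hk2))
        (le_max_right _ _)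
  linarith

lemma sum_log_div_sq_le (N : ℕ) : ∑ n ∈ Ioc 0 N, Real.log n / (n : ℝ) ^ 2 ≤ 4 := by
  have key : ∀ N : ℕ, ∑ n ∈ Ioc 0 N, Real.log n / (n : ℝ) ^ 2
      ≤ 4 - (Real.log (N + 1) + 2) / (N + 1) := by
    intro N
    induction N with
    | zero => norm_num
    | succ n ih =>
      rw [sum_Ioc_succ_top (Nat.zero_le n)]
      have h1 : Real.log ((n : ℝ) + 1 + 1) - Real.log (n + 1) ≤ 1 / (n + 1) := by
        have := log_div_succ_le (n := n + 1) (by omega)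
        push_cast at this
        exact this
      have h0 : 0 ≤ Real.log ((n : ℝ) + 1) := Real.log_nonneg (by linarith [n.cast_nonneg (α := ℝ)])
      have hn : (0 : ℝ) ≤ n := n.cast_nonneg
      have h2 : Real.log ((n : ℝ) + 1) ≤ n :=
        (Real.log_le_sub_one_of_pos (by positivity)).trans_eq (by ring)
      push_cast
      set x : ℝ := n + 1 with hx
      have hx0 : 0 < x := by positivity
      have h3 : (Real.log (x + 1) + 2) / (x + 1) ≤ (Real.log x + 1 / x + 2) / (x + 1) := by
        gcongr
        linarith
      have h4 : (Real.log x + 2) / x - (Real.log x + 1 / x + 2) / (x + 1) - Real.log x / x ^ 2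
          = (x - Real.log x) / (x ^ 2 * (x + 1)) := by
        field_simp
        ring
      have h5 : 0 ≤ (x - Real.log x) / (x ^ 2 * (x + 1)) :=
        div_nonneg (by linarith) (by positivity)
      linarith
  have := key N
  have h0 : 0 ≤ Real.log ((N : ℝ) + 1) := Real.log_nonneg (by linarith [N.cast_nonneg (α := ℝ)])
  have : 0 ≤ (Real.log ((N : ℝ) + 1) + 2) / (N + 1) := by positivity
  linarith

lemma sum_one_div_le (N : ℕ) (hN : 1 ≤ N) : ∑ n ∈ Ioc 0 N, (1 : ℝ) / n ≤ 1 + Real.log N := by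
  induction N, hN using Nat.le_induction with
  | base => simp
  | succ n hn ih =>
    rw [sum_Ioc_succ_top (Nat.zero_le n)]
    have := one_div_succ_le_log hn
    push_cast at *
    linarith

lemma sum_log_prime_dvd_le {u : ℕ} (hu : 0 < u) :
    ∑ p ∈ u.primeFactors, Real.log p ≤ Real.log u := by
  rw [← Real.log_prod fun p hp ↦ by
    exact_mod_cast (Nat.prime_of_mem_primeFactors hp).ne_zero]
  refine Real.log_le_log (prod_pos fun p hp ↦ by
    exact_mod_cast (Nat.prime_of_mem_primeFactors hp).pos) ?_
  rw [← Nat.cast_prod]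
  exact_mod_cast Nat.le_of_dvd hu (Nat.prod_primeFactors_dvd u)

lemma sum_log_div_prime_dvd_le_of_pos {u : ℕ} (hu : 0 < u) {y : ℕ} (hy : 1 ≤ y) (X : ℕ) :
    ∑ n ∈ Ioc 0 X, (if n.Prime ∧ n ∣ u then Real.log n / n else 0)
      ≤ Real.log y * (1 + Real.log y) + Real.log u / y := by
  have hy0 : (0 : ℝ) < y := by exact_mod_cast hy
  have hly : 0 ≤ Real.log y := Real.log_natCast_nonneg y
  have hnn : ∀ n : ℕ, 0 ≤ Real.log n / n := fun n ↦
    div_nonneg (Real.log_natCast_nonneg n) (by positivity)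
  rw [← sum_filter]
  calc _ ≤ ∑ p ∈ u.primeFactors, Real.log p / p := by
        refine sum_le_sum_of_subset_of_nonneg (fun n hn ↦ ?_) fun n _ _ ↦ hnn n
        exact Nat.mem_primeFactors.2 ⟨(mem_filter.1 hn).2.1, (mem_filter.1 hn).2.2, hu.ne'⟩
    _ ≤ ∑ p ∈ u.primeFactors,
          ((if p ∈ Ioc 0 y then Real.log y * (1 / p) else 0) + Real.log p / y) := by
        refine sum_le_sum fun p hp ↦ ?_
        have hp0 := (Nat.prime_of_mem_primeFactors hp).pos
        have hp0' : (0 : ℝ) < p := by exact_mod_cast hp0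
        have hlp : 0 ≤ Real.log p := Real.log_natCast_nonneg p
        split_ifs with h
        · have h1 : Real.log p ≤ Real.log y :=
            Real.log_le_log hp0' (by exact_mod_cast (mem_Ioc.1 h).2)
          have h2 : 0 ≤ Real.log p / y := by positivity
          have h3 : Real.log p / p ≤ Real.log y / p := by gcongr
          rw [mul_one_div]
          linarith
        · have h1 : (y : ℝ) ≤ p := by
            rw [mem_Ioc] at h
            have : y ≤ p := by omega
            exact_mod_cast this
          rw [zero_add]
          gcongr
    _ ≤ ∑ n ∈ Ioc 0 y, Real.log y * (1 / n) + (∑ p ∈ u.primeFactors, Real.log p) / y := by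
        rw [sum_add_distrib, ← sum_filter, sum_div]
        refine add_le_add (sum_le_sum_of_subset_of_nonneg
          (fun n hn ↦ (mem_filter.1 hn).2) fun n _ _ ↦ ?_) le_rfl
        positivity
    _ ≤ _ := by
        rw [← mul_sum]
        gcongr
        · exact sum_one_div_le y hy
        · exact sum_log_prime_dvd_le hu

lemma natCast_zmod_eq_one_iff {m : ℕ} (hm : 2 ≤ m) (n : ℕ) : (n : ZMod m) = 1 ↔ n % m = 1 := by
  rw [← Nat.cast_one, ZMod.natCast_eq_natCast_iff', Nat.mod_eq_of_lt hm]

/-- Mertens' first theorem in arithmetic progressions with finitely many primes removed and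
second order terms subtracted. -/
lemma exists_log_sub_le_sum_not_dvd : ∃ K : ℝ, 1 ≤ K ∧ ∀ (M : ℝ) (m u y n : ℕ), 1 ≤ M →
    2 ≤ m → (m : ℝ) ≤ M → 0 < u → 1 ≤ y → Real.log y ≤ M → Real.log u ≤ 2 * y → 1 ≤ n →
    Real.log n - K * M ^ 6 ≤ ∑ k ∈ Ioc 0 n, (m.totient : ℝ) *
      (if k.Prime ∧ k % m = 1 ∧ ¬ k ∣ u then Real.log k * (1 / k - 1 / (k : ℝ) ^ 2) else 0) := by
  obtain ⟨C, hC1, hC⟩ := exists_log_sub_le_totient_mul_sum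
  refine ⟨C + 10, by linarith, fun M m u y n hM hm hmM hu hy hyM huy hn ↦ ?_⟩
  have hy0 : (0 : ℝ) < y := by exact_mod_cast hy
  have h1 := hC m (by omega) n hn
  have h2 := sum_log_div_sq_le n
  have h3 := sum_log_div_prime_dvd_le_of_pos hu hy n
  have h4 : Real.log u / y ≤ 2 := (div_le_iff₀ hy0).2 huy
  have hly : 0 ≤ Real.log y := Real.log_natCast_nonneg y
  have h5 : Real.log y * (1 + Real.log y) ≤ M * (1 + M) := by gcongr
  have hφ : (m.totient : ℝ) ≤ M := by
    refine le_trans ?_ hmM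
    exact_mod_cast Nat.totient_le m
  rw [← mul_sum]
  have hterm : ∑ k ∈ Ioc 0 n, (if k.Prime ∧ (k : ZMod m) = 1 then Real.log k / k else 0)
      - ∑ k ∈ Ioc 0 n, Real.log k / (k : ℝ) ^ 2
      - ∑ k ∈ Ioc 0 n, (if k.Prime ∧ k ∣ u then Real.log k / k else 0)
      ≤ ∑ k ∈ Ioc 0 n, (if k.Prime ∧ k % m = 1 ∧ ¬ k ∣ u then
          Real.log k * (1 / k - 1 / (k : ℝ) ^ 2) else 0) := by
    rw [← sum_sub_distrib, ← sum_sub_distrib]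
    refine sum_le_sum fun k _ ↦ ?_
    simp only [natCast_zmod_eq_one_iff hm]
    have ha : 0 ≤ Real.log k / k := div_nonneg (Real.log_natCast_nonneg k) (by positivity)
    have hb : 0 ≤ Real.log k / (k : ℝ) ^ 2 :=
      div_nonneg (Real.log_natCast_nonneg k) (by positivity)
    have hc : Real.log k * (1 / k - 1 / (k : ℝ) ^ 2) = Real.log k / k - Real.log k / (k : ℝ) ^ 2 := by
      ring
    rw [hc]
    by_cases hp : k.Prime <;> by_cases hk : k % m = 1 <;> by_cases hd : k ∣ u <;>
      simp only [hp, hk, hd, and_true, and_false, not_true_eq_false,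
        not_false_eq_true, if_true, if_false] <;> linarith
  have h6 : ∑ k ∈ Ioc 0 n, Real.log k / (k : ℝ) ^ 2
      + ∑ k ∈ Ioc 0 n, (if k.Prime ∧ k ∣ u then Real.log k / k else 0)
      ≤ 6 + M * (1 + M) := by linarith
  have h7 := mul_le_mul_of_nonneg_left hterm (Nat.cast_nonneg (α := ℝ) m.totient)
  have h8 : (m.totient : ℝ) * (∑ k ∈ Ioc 0 n, Real.log k / (k : ℝ) ^ 2
      + ∑ k ∈ Ioc 0 n, (if k.Prime ∧ k ∣ u then Real.log k / k else 0))
      ≤ M * (6 + M * (1 + M)) :=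
    (mul_le_mul_of_nonneg_left h6 (Nat.cast_nonneg _)).trans
      (mul_le_mul_of_nonneg_right hφ (by positivity))
  have h9 : C * (m : ℝ) ^ 6 ≤ C * M ^ 6 := by gcongr
  have e1 : M ≤ M ^ 6 := le_self_pow₀ hM (by norm_num)
  have e2 : M ^ 2 ≤ M ^ 6 := pow_le_pow_right₀ hM (by norm_num)
  have e3 : M ^ 3 ≤ M ^ 6 := pow_le_pow_right₀ hM (by norm_num)
  nlinarith

lemma exists_pow_le_lt {k N : ℕ} (hk : k ≠ 0) (hN : 1 ≤ N) :
    ∃ X : ℕ, 1 ≤ X ∧ N < (X + 1) ^ k ∧ ∀ p : ℕ, p ^ k ≤ N ↔ p ≤ X := by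
  have h1 : ∀ p : ℕ, p ^ k ≤ N → p ≤ N := fun p hp ↦ (Nat.le_self_pow hk p).trans hp
  have h0 : (1 : ℕ) ^ k ≤ N := by simpa using hN
  refine ⟨Nat.findGreatest (fun p ↦ p ^ k ≤ N) N, Nat.le_findGreatest hN h0, ?_, fun p ↦
    ⟨fun hp ↦ Nat.le_findGreatest (h1 p hp) hp, fun hp ↦ ?_⟩⟩
  · by_contra! h
    have := Nat.le_findGreatest (P := fun p ↦ p ^ k ≤ N) (h1 _ h) h
    omega
  · exact (Nat.pow_le_pow_left hp k).trans
      (Nat.findGreatest_spec (P := fun p ↦ p ^ k ≤ N) hN h0)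

end DirichletLower

open DirichletLower

/-- There is a constant `E > 0`, depending only on `s`, such that for every integer `N` with
`log log log N > 2` and `N > (log log N)^(6s+6)`, every integer `m` with
`2 ≤ m ≤ log log N`, and every positive integer `u ≤ √N`, one has
`φ(m) · Σ (1/p − 1/p²) ≥ log log N − E·log log log N`, the sum being over primes
`p ≤ N^(1/(3s))` (equivalently, `p^(3s) ≤ N`) with `p ≡ 1 (mod m)` and `p ∤ u`. -/
theorem exists_const_totient_sum_lower (s : ℕ) (hs : 1 ≤ s) :
    ∃ E : ℝ, 0 < E ∧ ∀ N : ℕ,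
      2 < Real.log (Real.log (Real.log N)) →
      (N : ℝ) > (Real.log (Real.log N)) ^ (6 * s + 6) →
      ∀ m : ℕ, 2 ≤ m → (m : ℝ) ≤ Real.log (Real.log N) →
      ∀ u : ℕ, 0 < u → (u : ℝ) ≤ Real.sqrt N →
        (m.totient : ℝ) *
            ∑ p ∈ (Finset.range (N + 1)).filter
                (fun p => p.Prime ∧ p ^ (3 * s) ≤ N ∧ p % m = 1 ∧ ¬ p ∣ u),
              ((1 : ℝ) / p - 1 / (p : ℝ) ^ 2) ≥
          Real.log (Real.log N) - E * Real.log (Real.log (Real.log N)) := by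
  obtain ⟨K, hK1, hK⟩ := exists_log_sub_le_sum_not_dvd
  have hs' : (1 : ℝ) ≤ s := by exact_mod_cast hs
  have hlogs : 0 ≤ Real.log (6 * s) := Real.log_nonneg (by linarith)
  have hlogK : 0 ≤ Real.log K := Real.log_nonneg hK1
  refine ⟨Real.log (6 * s) + Real.log K + 8, by positivity, fun N hN _ m hm hmM u hu huN ↦ ?_⟩
  have hNpos : 1 ≤ N := by
    by_contra! h
    interval_cases N
    norm_num at hN
  have hlogN : 0 ≤ Real.log N := Real.log_natCast_nonneg N
  set M := Real.log (Real.log N) with hM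
  have hM2 : (2 : ℝ) ≤ M := le_trans (by exact_mod_cast hm) hmM
  have hz : M ≤ Real.log N := Real.log_le_self hlogN
  set L := Real.log M with hL
  set y := ⌊Real.log N⌋₊ with hy
  have hy1 : 1 ≤ y := Nat.le_floor (by push_cast; linarith)
  have hyle : (y : ℝ) ≤ Real.log N := Nat.floor_le hlogN
  have hylt : Real.log N < y + 1 := Nat.lt_floor_add_one _
  have hy1' : (1 : ℝ) ≤ y := by exact_mod_cast hy1
  have hyM : Real.log y ≤ M := Real.log_le_log (by linarith) hyle
  have huN' : (u : ℝ) ≤ N := by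
    refine huN.trans (Real.sqrt_le_self_iff.2 (Or.inr ?_))
    exact_mod_cast hNpos
  have hlu : Real.log u ≤ 2 * y := by
    have : Real.log u ≤ Real.log N := Real.log_le_log (by exact_mod_cast hu) huN'
    linarith
  obtain ⟨X, hX1, hXN, hX⟩ := exists_pow_le_lt (k := 3 * s) (by omega) hNpos
  set a : ℕ → ℝ := fun k ↦ (m.totient : ℝ) *
    (if k.Prime ∧ k % m = 1 ∧ ¬ k ∣ u then Real.log k * (1 / k - 1 / (k : ℝ) ^ 2) else 0) with ha
  have hann : ∀ n, 0 ≤ a n := by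
    intro n
    simp only [ha]
    split_ifs with h
    · have hn1 : (1 : ℝ) ≤ n := by exact_mod_cast h.1.one_le
      have h1 : 1 / (n : ℝ) ^ 2 ≤ 1 / n :=
        one_div_le_one_div_of_le (by linarith) (le_self_pow₀ hn1 (by norm_num))
      exact mul_nonneg (Nat.cast_nonneg _)
        (mul_nonneg (Real.log_natCast_nonneg n) (sub_nonneg.2 h1))
    · simp
  have ha1 : a 1 = 0 := by simp [ha]
  have hM6 : 1 ≤ M ^ 6 := one_le_pow₀ (by linarith)
  have hmain := log_log_sub_le_sum_div_log hann ha1 (C := K * M ^ 6) (by nlinarith) hX1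
    fun n hn ↦ hK M m u y n (by linarith) hm hmM hu hy1 hyM hlu hn
  have hsum : ∑ n ∈ Finset.Ioc 0 X, a n / Real.log n = (m.totient : ℝ) *
      ∑ p ∈ (Finset.range (N + 1)).filter
        (fun p => p.Prime ∧ p ^ (3 * s) ≤ N ∧ p % m = 1 ∧ ¬ p ∣ u),
          ((1 : ℝ) / p - 1 / (p : ℝ) ^ 2) := by
    rw [Finset.mul_sum]
    symm
    refine Finset.sum_subset_zero_on_sdiff (fun p hp ↦ ?_) (fun p hp ↦ ?_) fun p hp ↦ ?_
    · obtain ⟨-, hp1, hp2, -⟩ := Finset.mem_filter.1 hp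
      exact Finset.mem_Ioc.2 ⟨hp1.pos, (hX p).1 hp2⟩
    · obtain ⟨hp1, hp2⟩ := Finset.mem_sdiff.1 hp
      have hpX := (hX p).2 (Finset.mem_Ioc.1 hp1).2
      have hpN : p < N + 1 :=
        Nat.lt_succ_of_le ((Nat.le_self_pow (by omega) p).trans hpX)
      have : ¬ (p.Prime ∧ p % m = 1 ∧ ¬ p ∣ u) := fun h ↦
        hp2 (Finset.mem_filter.2 ⟨Finset.mem_range.2 hpN, h.1, hpX, h.2⟩)
      simp only [ha, if_neg this, mul_zero, zero_div]
    · obtain ⟨-, hp1, -, hp2⟩ := Finset.mem_filter.1 hp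
      have hlp : Real.log p ≠ 0 := (Real.log_pos (by exact_mod_cast hp1.one_lt)).ne'
      simp only [ha, if_pos (And.intro hp1 hp2)]
      field_simp
  rw [hsum] at hmain
  have hlogX : Real.log N / (6 * s) ≤ max (K * M ^ 6) (Real.log X) := by
    have h1 : Real.log N ≤ 3 * s * Real.log (X + 1) := by
      have : Real.log N ≤ Real.log (((X + 1) ^ (3 * s) : ℕ) : ℝ) :=
        Real.log_le_log (by exact_mod_cast hNpos) (by exact_mod_cast hXN.le)
      rw [Nat.cast_pow, Real.log_pow] at this
      push_cast at this
      exact this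
    have h2 : Real.log (X + 1) ≤ Real.log X + 1 := by
      have h3 := log_div_succ_le hX1
      have h4 : (1 : ℝ) / X ≤ 1 := div_le_one_of_le₀ (by exact_mod_cast hX1) (by positivity)
      linarith
    have h5 := le_max_left (K * M ^ 6) (Real.log X)
    have h6 := le_max_right (K * M ^ 6) (Real.log X)
    rw [div_le_iff₀ (by positivity)]
    have h7 : Real.log (X + 1) ≤ 2 * max (K * M ^ 6) (Real.log X) := by nlinarith
    nlinarith
  have hlog1 : M - Real.log (6 * s) ≤ Real.log (max (K * M ^ 6) (Real.log X)) := by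
    rw [hM, ← Real.log_div (by linarith) (by positivity)]
    exact Real.log_le_log (div_pos (by linarith) (by positivity)) hlogX
  have hlog2 : Real.log (K * M ^ 6) = Real.log K + 6 * L := by
    rw [Real.log_mul (by linarith) (by positivity), Real.log_pow, Nat.cast_ofNat]
  nlinarith
end

section
/- One has 3·Υ·Σ_{t ≥ 3, t odd} f(t)·γ*(t) ≤ Σ_{t=2}^∞ f(t)·γ*(t) ≤ (3·(2^s − 1) + 27/2)·Υ·Σ_{t ≥ 3, t odd} f(t)·γ*(t), where the middle sum is over all integers t ≥ 2 and the outer sums are over odd integers t ≥ 3 (all these series converge). -/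
open scoped BigOperators

/-- `gammaStar s t` is the number of `s`-tuples `(a_1, …, a_s)` of integers, each `a_i > 1`,
with `lcm(a_1, …, a_s) = t`. -/
noncomputable def gammaStar (s t : ℕ) : ℕ :=
  Nat.card {a : Fin s → ℕ // (∀ i, 1 < a i) ∧ Finset.univ.lcm a = t}

/-- `rad t` is the radical of `t`: the product of the distinct primes dividing `t`. -/
def rad (t : ℕ) : ℕ := ∏ p ∈ t.primeFactors, p

/-- `f t = 1 / (t · t₀ · φ(t))` where `t₀` is the radical of `t`. -/
noncomputable def f (t : ℕ) : ℝ := 1 / ((t : ℝ) * (rad t : ℝ) * (t.totient : ℝ))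

/-- `Υ s = Σ_{r=1}^∞ r^s / 4^r` (reindexed as a `tsum` over `r : ℕ`). -/
noncomputable def upsilon (s : ℕ) : ℝ := ∑' r : ℕ, ((r : ℝ) + 1) ^ s / 4 ^ (r + 1)

open scoped Finset

/-- The divisor bound: the `k`-th power of the number of divisors of `n` is at most linear
in `n`. -/
theorem exists_card_divisors_pow_le (k : ℕ) :
    ∃ C : ℝ, 0 ≤ C ∧ ∀ n : ℕ, n ≠ 0 → (#n.divisors : ℝ) ^ k ≤ C * n := by
  obtain ⟨B, hB1, hB⟩ : ∃ B : ℝ, 1 ≤ B ∧ ∀ r : ℕ, ((r : ℝ) + 1) ^ k ≤ B * 2 ^ r := by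
    have hsum := summable_pow_mul_geometric_of_norm_lt_one (R := ℝ) k (r := 1 / 2) (by norm_num)
    refine ⟨max 1 (2 * ∑' n : ℕ, (n : ℝ) ^ k * (1 / 2) ^ n), le_max_left _ _, fun r => ?_⟩
    have h := hsum.le_tsum (r + 1) fun j _ => by positivity
    have h2 : ((r : ℝ) + 1) ^ k = 2 * (((r + 1 : ℕ) : ℝ) ^ k * (1 / 2) ^ (r + 1)) * 2 ^ r := by
      rw [one_div, inv_pow, pow_succ]
      push_cast
      field_simp
    rw [h2]
    gcongr
    exact le_max_of_le_right (by linarith)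
  refine ⟨B ^ (2 ^ k), by positivity, fun n hn => ?_⟩
  have hterm : ∀ p ∈ n.primeFactors, ((n.factorization p : ℝ) + 1) ^ k ≤
      (if p < 2 ^ k then B else 1) * (p : ℝ) ^ n.factorization p := by
    intro p hp
    have hp2 : (2 : ℝ) ≤ p := by exact_mod_cast (Nat.prime_of_mem_primeFactors hp).two_le
    split_ifs with h
    · refine (hB _).trans ?_
      gcongr
    · have h2 : ((n.factorization p : ℝ) + 1) ≤ 2 ^ n.factorization p := by
        exact_mod_cast Nat.lt_two_pow_self
      calc ((n.factorization p : ℝ) + 1) ^ k ≤ (2 ^ n.factorization p) ^ k := by gcongr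
        _ = (2 ^ k) ^ n.factorization p := pow_right_comm _ _ _
        _ ≤ (p : ℝ) ^ n.factorization p := by
          gcongr
          exact_mod_cast not_lt.1 h
        _ = _ := (one_mul _).symm
  have hprod : (n : ℝ) = ∏ p ∈ n.primeFactors, (p : ℝ) ^ n.factorization p := by
    conv_lhs => rw [← Nat.prod_factorization_pow_eq_self hn]
    simp [Finsupp.prod]
  calc (#n.divisors : ℝ) ^ k = ∏ p ∈ n.primeFactors, ((n.factorization p : ℝ) + 1) ^ k := by
        rw [Nat.card_divisors hn, Finset.prod_pow]
        push_cast
        rfl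
    _ ≤ ∏ p ∈ n.primeFactors, ((if p < 2 ^ k then B else 1) * (p : ℝ) ^ n.factorization p) :=
        Finset.prod_le_prod (fun _ _ => by positivity) hterm
    _ = B ^ #{p ∈ n.primeFactors | p < 2 ^ k} * n := by
        rw [Finset.prod_mul_distrib, ← hprod, Finset.prod_ite]
        simp
    _ ≤ B ^ (2 ^ k) * n := by
        gcongr
        calc #{p ∈ n.primeFactors | p < 2 ^ k} ≤ #(Finset.range (2 ^ k)) :=
              Finset.card_le_card fun p hp => by simp_all
            _ = 2 ^ k := Finset.card_range _

theorem f_nonneg (t : ℕ) : 0 ≤ f t := by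
  unfold f
  positivity

theorem f_le_one_div_sq (t : ℕ) : f t ≤ 1 / (t : ℝ) ^ 2 := by
  rcases Nat.eq_zero_or_pos t with rfl | ht
  · simp [f]
  have h : t ≤ rad t * t.totient := by
    rw [mul_comm, rad, Nat.totient_mul_prod_primeFactors]
    exact Nat.le_mul_of_pos_right _ (Finset.prod_pos fun p hp =>
      Nat.sub_pos_of_lt (Nat.prime_of_mem_primeFactors hp).one_lt)
  have h' : (t : ℝ) ≤ rad t * t.totient := by exact_mod_cast h
  have ht' : (0 : ℝ) < t := by exact_mod_cast ht
  unfold f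
  rw [mul_assoc, sq]
  gcongr

theorem f_two_pow_mul {u : ℕ} (hu : Odd u) (r : ℕ) : f (2 ^ r * u) = f u / 4 ^ r := by
  rcases r with _ | r
  · simp
  have hc : (2 ^ (r + 1)).Coprime u := (Nat.coprime_two_left.2 hu).pow_left _
  have hrad : rad (2 ^ (r + 1) * u) = 2 * rad u := by
    rw [rad, hc.primeFactors_mul, Finset.prod_union hc.disjoint_primeFactors,
      Nat.primeFactors_prime_pow (by simp) Nat.prime_two, Finset.prod_singleton, rad]
  have htot : (2 ^ (r + 1) * u).totient = 2 ^ r * u.totient := by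
    rw [Nat.totient_mul hc, Nat.totient_prime_pow_succ Nat.prime_two]
    simp
  have h4 : (4 : ℝ) ^ (r + 1) = 2 ^ (r + 1) * 2 * 2 ^ r := by
    rw [show (4 : ℝ) = 2 * 2 by norm_num, mul_pow, pow_succ]
    ring
  rw [f, hrad, htot, f, h4, div_div]
  push_cast
  congr 1
  ring

/-- The `s`-tuples of integers greater than `1` with least common multiple `t`. -/
def properTuples (s t : ℕ) : Set (Fin s → ℕ) := {a | (∀ i, 1 < a i) ∧ Finset.univ.lcm a = t}

/-- The `s`-tuples of natural numbers with least common multiple `t`. -/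
def lcmTuples (s t : ℕ) : Set (Fin s → ℕ) := {a | Finset.univ.lcm a = t}

/-- The `s`-tuples of natural numbers with maximum `r`. -/
def maxTuples (s r : ℕ) : Set (Fin s → ℕ) := {e | Finset.univ.sup e = r}

section Counting

variable {s t r u : ℕ}

theorem gammaStar_eq_ncard (s t : ℕ) : gammaStar s t = (properTuples s t).ncard := rfl

theorem properTuples_subset_lcmTuples : properTuples s t ⊆ lcmTuples s t := fun _ h => h.2

theorem lcmTuples_subset_divisors (ht : t ≠ 0) :
    lcmTuples s t ⊆ (Fintype.piFinset fun _ : Fin s => t.divisors : Finset (Fin s → ℕ)) := by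
  intro a ha
  simp only [Finset.mem_coe, Fintype.mem_piFinset, Nat.mem_divisors]
  exact fun i => ⟨ha ▸ Finset.dvd_lcm (Finset.mem_univ i), ht⟩

theorem finite_lcmTuples (ht : t ≠ 0) : (lcmTuples s t).Finite :=
  (Finset.finite_toSet _).subset (lcmTuples_subset_divisors ht)

theorem finite_properTuples (ht : t ≠ 0) : (properTuples s t).Finite :=
  (finite_lcmTuples ht).subset properTuples_subset_lcmTuples

theorem gammaStar_le_card_divisors_pow (s : ℕ) (ht : t ≠ 0) :
    gammaStar s t ≤ #t.divisors ^ s := by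
  have h := Set.ncard_le_ncard
    (properTuples_subset_lcmTuples.trans (lcmTuples_subset_divisors (s := s) ht))
    (Finset.finite_toSet _)
  rwa [Set.ncard_coe_finset, Fintype.card_piFinset_const] at h

theorem maxTuples_eq_sdiff (hs : 1 ≤ s) (r : ℕ) :
    maxTuples s r = ((Fintype.piFinset fun _ : Fin s => Finset.range (r + 1)) \
      (Fintype.piFinset fun _ : Fin s => Finset.range r) : Finset (Fin s → ℕ)) := by
  have : Nonempty (Fin s) := ⟨⟨0, hs⟩⟩
  ext e
  simp only [maxTuples, Set.mem_ofPred_eq, Finset.coe_sdiff, Set.mem_sdiff, Finset.mem_coe,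
    Fintype.mem_piFinset, Finset.mem_range, Nat.lt_succ_iff]
  obtain ⟨i, -, hi⟩ := Finset.exists_mem_eq_sup Finset.univ Finset.univ_nonempty e
  have hle : ∀ j, e j ≤ Finset.univ.sup e := fun j => Finset.le_sup (Finset.mem_univ j)
  constructor
  · rintro rfl
    exact ⟨hle, fun h => (hi ▸ h i).false⟩
  · rintro ⟨h1, h2⟩
    push Not at h2
    obtain ⟨j, hj⟩ := h2
    exact le_antisymm (hi ▸ h1 i) (hj.trans (hle j))

theorem finite_maxTuples (hs : 1 ≤ s) (r : ℕ) : (maxTuples s r).Finite :=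
  maxTuples_eq_sdiff hs r ▸ Finset.finite_toSet _

theorem ncard_maxTuples (hs : 1 ≤ s) (r : ℕ) :
    ((maxTuples s r).ncard : ℝ) = ((r : ℝ) + 1) ^ s - (r : ℝ) ^ s := by
  rw [maxTuples_eq_sdiff hs, Set.ncard_coe_finset, Finset.cast_card_sdiff
    (Fintype.piFinset_subset _ _ fun _ => Finset.range_mono r.le_succ)]
  simp

theorem odd_lcm {b : Fin s → ℕ} (hb : ∀ i, Odd (b i)) : Odd (Finset.univ.lcm b) := by
  have hprod : Odd (∏ i, b i) := Nat.coprime_two_left.1 <|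
    Nat.Coprime.prod_right fun i _ => Nat.coprime_two_left.2 (hb i)
  exact hprod.of_dvd_nat (Finset.lcm_dvd fun i hi => Finset.dvd_prod_of_mem b hi)

theorem lcm_two_pow_mul (hs : 1 ≤ s) (e b : Fin s → ℕ) (hb : ∀ i, Odd (b i)) :
    Finset.univ.lcm (fun i => 2 ^ e i * b i) = 2 ^ Finset.univ.sup e * Finset.univ.lcm b := by
  have : Nonempty (Fin s) := ⟨⟨0, hs⟩⟩
  refine Nat.dvd_antisymm (Finset.lcm_dvd fun i hi =>
    mul_dvd_mul (pow_dvd_pow 2 (Finset.le_sup hi)) (Finset.dvd_lcm hi)) ?_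
  have hdvd : ∀ i, 2 ^ e i * b i ∣ Finset.univ.lcm (fun i => 2 ^ e i * b i) := fun i =>
    Finset.dvd_lcm (f := fun i => 2 ^ e i * b i) (Finset.mem_univ i)
  refine Nat.Coprime.mul_dvd_of_dvd_of_dvd ((Nat.coprime_two_left.2 (odd_lcm hb)).pow_left _) ?_ ?_
  · obtain ⟨i, -, hi⟩ := Finset.exists_mem_eq_sup Finset.univ Finset.univ_nonempty e
    exact hi ▸ (dvd_mul_right _ _).trans (hdvd i)
  · exact Finset.lcm_dvd fun i _ => (dvd_mul_left _ _).trans (hdvd i)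

theorem two_pow_mul_odd_inj {a b v : ℕ} (hu : Odd u) (hv : Odd v)
    (h : 2 ^ a * u = 2 ^ b * v) : a = b ∧ u = v := by
  have hdvd : ∀ {a b u v : ℕ}, Odd v → 2 ^ a * u = 2 ^ b * v → 2 ^ a ∣ 2 ^ b := fun hv h =>
    ((Nat.coprime_two_left.2 hv).pow_left _).dvd_of_dvd_mul_right (h ▸ dvd_mul_right _ _)
  have hab : a = b := Nat.pow_right_injective le_rfl
    (Nat.dvd_antisymm (hdvd hv h) (hdvd hu h.symm))
  subst hab
  exact ⟨rfl, Nat.eq_of_mul_eq_mul_left (by positivity) h⟩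

theorem odd_of_mem_lcmTuples (hu : Odd u) {b : Fin s → ℕ} (hb : b ∈ lcmTuples s u) (i : Fin s) :
    Odd (b i) :=
  hu.of_dvd_nat (hb ▸ Finset.dvd_lcm (Finset.mem_univ i))

theorem ncard_maxTuples_mul_gammaStar_le (hs : 1 ≤ s) (hu : Odd u) (r : ℕ) :
    (maxTuples s r).ncard * gammaStar s u ≤ gammaStar s (2 ^ r * u) := by
  rw [gammaStar_eq_ncard, gammaStar_eq_ncard, ← Set.ncard_prod]
  refine Set.ncard_le_ncard_of_injOn (fun x i => 2 ^ x.1 i * x.2 i) ?_ ?_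
    (finite_properTuples (mul_ne_zero (by positivity) hu.pos.ne'))
  · rintro ⟨e, b⟩ ⟨he, hb⟩
    refine ⟨fun i => (hb.1 i).trans_le (Nat.le_mul_of_pos_left _ (by positivity)), ?_⟩
    rw [lcm_two_pow_mul hs e b (odd_of_mem_lcmTuples hu hb.2), he, hb.2]
  · rintro ⟨e, b⟩ ⟨he, hb⟩ ⟨e', b'⟩ ⟨he', hb'⟩ h
    have h' := fun i => two_pow_mul_odd_inj (odd_of_mem_lcmTuples hu hb.2 i)
      (odd_of_mem_lcmTuples hu hb'.2 i) (congrFun h i)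
    exact Prod.ext (funext fun i => (h' i).1) (funext fun i => (h' i).2)

theorem gammaStar_two_pow_mul_le (hs : 1 ≤ s) (hu : Odd u) (r : ℕ) :
    gammaStar s (2 ^ r * u) ≤ (maxTuples s r).ncard * (lcmTuples s u).ncard := by
  rw [gammaStar_eq_ncard, ← Set.ncard_prod]
  have hself : ∀ a : Fin s → ℕ, (fun i => 2 ^ (a i).factorization 2 *
      (a i / 2 ^ (a i).factorization 2)) = a :=
    fun a => funext fun i => Nat.ordProj_mul_ordCompl_eq_self (a i) 2
  refine Set.ncard_le_ncard_of_injOn (fun a => (fun i => (a i).factorization 2,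
    fun i => a i / 2 ^ (a i).factorization 2)) ?_ ?_
    ((finite_maxTuples hs r).prod (finite_lcmTuples hu.pos.ne'))
  · intro a ha
    have hodd : ∀ i, Odd (a i / 2 ^ (a i).factorization 2) := fun i =>
      Nat.coprime_two_left.1 (Nat.coprime_ordCompl Nat.prime_two (by have := ha.1 i; lia))
    have h := lcm_two_pow_mul hs (fun i => (a i).factorization 2) _ hodd
    rw [hself a, ha.2] at h
    have h' := two_pow_mul_odd_inj hu (odd_lcm hodd) h
    exact ⟨h'.1.symm, h'.2.symm⟩
  · intro a _ a' _ h
    rw [← hself a, ← hself a']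
    simp only [Prod.mk.injEq] at h
    funext i
    exact congrArg₂ (fun x y => 2 ^ x * y) (congrFun h.1 i) (congrFun h.2 i)

theorem gammaStar_two_pow_succ_le (hs : 1 ≤ s) (r : ℕ) :
    gammaStar s (2 ^ (r + 1)) ≤ (maxTuples s r).ncard := by
  have key : ∀ a ∈ properTuples s (2 ^ (r + 1)), ∀ i,
      a i = 2 ^ ((a i).factorization 2 - 1 + 1) := by
    intro a ha i
    have hdvd : a i ∣ 2 ^ (r + 1) := ha.2 ▸ Finset.dvd_lcm (Finset.mem_univ i)
    obtain ⟨k, -, hk⟩ := (Nat.dvd_prime_pow Nat.prime_two).1 hdvd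
    have hk0 : k ≠ 0 := by
      rintro rfl
      have := ha.1 i
      lia
    rw [hk, Nat.Prime.factorization_pow Nat.prime_two, Finsupp.single_eq_same,
      Nat.sub_add_cancel (Nat.one_le_iff_ne_zero.2 hk0)]
  refine Set.ncard_le_ncard_of_injOn (fun a i => (a i).factorization 2 - 1) ?_ ?_
    (finite_maxTuples hs r)
  · intro a ha
    have : Nonempty (Fin s) := ⟨⟨0, hs⟩⟩
    have h := lcm_two_pow_mul hs (fun i => (a i).factorization 2 - 1 + 1) 1 fun _ => odd_one
    have hlcm : Finset.univ.lcm (1 : Fin s → ℕ) = 1 :=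
      Nat.dvd_one.1 (Finset.lcm_dvd fun _ _ => dvd_rfl)
    simp only [Pi.one_apply, mul_one, hlcm, ← key a ha] at h
    have hsup := Nat.pow_right_injective le_rfl (ha.2.symm.trans h)
    exact Nat.succ_injective <| (Finset.apply_sup_eq_sup_comp_of_nonempty (g := Nat.succ)
      (fun _ _ h => Nat.succ_le_succ h) Finset.univ_nonempty).trans hsup.symm
  · intro a ha a' ha' h
    funext i
    rw [key a ha i, key a' ha' i]
    exact congrArg (fun x => 2 ^ (x + 1)) (congrFun h i)

theorem ncard_lcmTuples_le (hu : 1 < u) :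
    (lcmTuples s u).ncard ≤ (2 ^ s - 1) * gammaStar s u := by
  have hcard : (2 ^ s - 1) = Set.ncard {S : Finset (Fin s) | S ≠ Finset.univ} := by
    have h : {S : Finset (Fin s) | S ≠ Finset.univ} =
        ({Finset.univ}ᶜ : Finset (Finset (Fin s))) := by
      ext S
      simp
    rw [h, Set.ncard_coe_finset, Finset.card_compl, Finset.card_singleton, Fintype.card_finset,
      Fintype.card_fin]
  rw [hcard, gammaStar_eq_ncard, ← Set.ncard_prod]
  have hu0 : u ≠ 0 := by lia
  refine Set.ncard_le_ncard_of_injOn (fun a => (({i | a i = 1} : Finset (Fin s)),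
    fun i => if a i = 1 then u else a i)) ?_ ?_
    ((Set.toFinite _).prod (finite_properTuples hu0))
  · intro a ha
    have hdvd : ∀ i, a i ∣ u := fun i => ha ▸ Finset.dvd_lcm (Finset.mem_univ i)
    have hne : ({i | a i = 1} : Finset (Fin s)) ≠ Finset.univ := by
      intro h
      have h1 : a = 1 := by
        funext i
        simpa using Finset.eq_univ_iff_forall.1 h i
      have : u ∣ 1 := ha ▸ Finset.lcm_dvd fun i _ => by simp [h1]
      exact hu.ne' (Nat.dvd_one.1 this)
    refine ⟨hne, fun i => ?_, Nat.dvd_antisymm (Finset.lcm_dvd fun i _ => ?_) ?_⟩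
    · have := Nat.pos_of_dvd_of_pos (hdvd i) (by lia)
      dsimp only
      split_ifs <;> lia
    · dsimp only
      split_ifs
      · exact dvd_rfl
      · exact hdvd i
    · conv_lhs => rw [← show Finset.univ.lcm a = u from ha]
      refine Finset.lcm_dvd fun i hi => ?_
      refine dvd_trans ?_ (Finset.dvd_lcm hi)
      dsimp only
      split_ifs with h
      · exact h ▸ one_dvd _
      · exact dvd_rfl
  · intro a _ a' _ h
    simp only [Prod.mk.injEq] at h
    funext i
    have h1 : a i = 1 ↔ a' i = 1 := by simpa using Finset.ext_iff.1 h.1 i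
    have h2 := congrFun h.2 i
    by_cases hi : a i = 1
    · rw [hi, h1.1 hi]
    · simpa [hi, mt h1.2 hi] using h2

end Counting

/-- The summand `f t * gammaStar s t`, restricted to `2 ≤ t`. -/
noncomputable def gammaTerm (s t : ℕ) : ℝ := if 2 ≤ t then f t * (gammaStar s t : ℝ) else 0

theorem gammaTerm_nonneg (s t : ℕ) : 0 ≤ gammaTerm s t := by
  unfold gammaTerm
  split_ifs
  · exact mul_nonneg (f_nonneg t) (Nat.cast_nonneg _)
  · exact le_rfl

theorem summable_gammaTerm (s : ℕ) : Summable (gammaTerm s) := by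
  obtain ⟨C, hC, h⟩ := exists_card_divisors_pow_le (s * 2)
  refine Summable.of_nonneg_of_le (gammaTerm_nonneg s) (fun t => ?_)
    ((Real.summable_one_div_nat_rpow.2 (by norm_num : (1 : ℝ) < 3 / 2)).mul_left √C)
  unfold gammaTerm
  split_ifs with ht
  · have ht' : (0 : ℝ) < t := by exact_mod_cast (by lia : 0 < t)
    have h1 : (gammaStar s t : ℝ) ≤ √C * √t := by
      rw [← Real.sqrt_mul hC]
      refine Real.le_sqrt_of_sq_le (le_trans ?_ (h t (by lia)))
      rw [pow_mul]
      gcongr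
      exact_mod_cast gammaStar_le_card_divisors_pow s (by lia)
    calc f t * (gammaStar s t : ℝ) ≤ 1 / (t : ℝ) ^ 2 * (√C * √t) := by
          gcongr
          exact f_le_one_div_sq t
      _ = √C * (1 / (t : ℝ) ^ (3 / 2 : ℝ)) := by
          have : (t : ℝ) ^ 2 = (t : ℝ) ^ (3 / 2 : ℝ) * √t := by
            rw [Real.sqrt_eq_rpow, ← Real.rpow_add ht', ← Real.rpow_natCast]
            norm_num
          rw [this]
          have : √(t : ℝ) ≠ 0 := by positivity
          have : (t : ℝ) ^ (3 / 2 : ℝ) ≠ 0 := by positivity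
          field_simp
  · positivity

theorem summable_upsilon (s : ℕ) : Summable fun r : ℕ => ((r : ℝ) + 1) ^ s / 4 ^ (r + 1) := by
  have h := (summable_nat_add_iff 1).2
    (summable_pow_mul_geometric_of_norm_lt_one (R := ℝ) s (r := 1 / 4) (by norm_num))
  refine h.congr fun r => ?_
  rw [one_div, inv_pow]
  push_cast
  rfl

theorem upsilon_nonneg (s : ℕ) : 0 ≤ upsilon s := tsum_nonneg fun _ => by positivity

theorem hasSum_ncard_maxTuples {s : ℕ} (hs : 1 ≤ s) :
    HasSum (fun r : ℕ => ((maxTuples s r).ncard : ℝ) / 4 ^ r) (3 * upsilon s) := by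
  have h : HasSum (fun r : ℕ => ((r : ℝ) + 1) ^ s / 4 ^ (r + 1)) (upsilon s) :=
    (summable_upsilon s).hasSum
  have h' : HasSum (fun r : ℕ => (r : ℝ) ^ s / 4 ^ r) (upsilon s) := by
    rw [← hasSum_nat_add_iff' 1]
    simpa [zero_pow (by lia : s ≠ 0)] using h
  have hsub := (h.mul_left 4).sub h'
  rw [show 4 * upsilon s - upsilon s = 3 * upsilon s by ring] at hsub
  have heq : (fun r : ℕ => ((maxTuples s r).ncard : ℝ) / 4 ^ r) =
      fun r : ℕ => 4 * (((r : ℝ) + 1) ^ s / 4 ^ (r + 1)) - (r : ℝ) ^ s / 4 ^ r := by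
    funext r
    rw [ncard_maxTuples hs, pow_succ]
    field_simp
  rwa [heq]

theorem gammaTerm_two_pow_mul {s u : ℕ} (hu : Odd u) (h1 : 1 < u) (r : ℕ) :
    gammaTerm s (2 ^ r * u) = f u * ((gammaStar s (2 ^ r * u) : ℝ) / 4 ^ r) := by
  have h2 : 2 ≤ 2 ^ r * u := h1.trans_le (Nat.le_mul_of_pos_left _ (by positivity))
  rw [gammaTerm, if_pos h2,
    f_two_pow_mul hu, div_mul_eq_mul_div, mul_div_assoc]

theorem injective_two_pow_mul_odd :
    Function.Injective fun x : ℕ × ℕ => 2 ^ x.2 * (2 * x.1 + 1) := by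
  rintro ⟨k, r⟩ ⟨k', r'⟩ h
  have := two_pow_mul_odd_inj (odd_two_mul_add_one k) (odd_two_mul_add_one k') h
  ext <;> lia

theorem gammaTerm_eq_zero_of_notMem_range (s : ℕ) {t : ℕ}
    (ht : t ∉ Set.range fun x : ℕ × ℕ => 2 ^ x.2 * (2 * x.1 + 1)) : gammaTerm s t = 0 := by
  rcases eq_or_ne t 0 with rfl | ht0
  · simp [gammaTerm]
  · obtain ⟨r, m, ⟨k, rfl⟩, rfl⟩ := Nat.exists_eq_two_pow_mul_odd ht0
    exact absurd ⟨(k, r), rfl⟩ ht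

theorem summable_gammaTerm_prod (s : ℕ) :
    Summable fun x : ℕ × ℕ => gammaTerm s (2 ^ x.2 * (2 * x.1 + 1)) :=
  (summable_gammaTerm s).comp_injective injective_two_pow_mul_odd

theorem hasSum_gammaTerm (s : ℕ) :
    HasSum (fun k : ℕ => ∑' r : ℕ, gammaTerm s (2 ^ r * (2 * k + 1))) (∑' t, gammaTerm s t) := by
  have h := (summable_gammaTerm_prod s).hasSum
  rw [injective_two_pow_mul_odd.tsum_eq fun t ht => by_contra fun h =>
    ht (gammaTerm_eq_zero_of_notMem_range s h)] at h
  exact h.prod_fiberwise fun k => ((summable_gammaTerm_prod s).prod_factor k).hasSum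

theorem summable_gammaTerm_two_pow_mul (s k : ℕ) :
    Summable fun r : ℕ => gammaTerm s (2 ^ r * (2 * k + 1)) :=
  (summable_gammaTerm_prod s).prod_factor k

theorem tsum_gammaTerm_two_pow_le {s : ℕ} (hs : 1 ≤ s) :
    ∑' r : ℕ, gammaTerm s (2 ^ r * (2 * 0 + 1)) ≤ 3 / 4 * upsilon s := by
  rw [(summable_gammaTerm_two_pow_mul s 0).tsum_eq_zero_add]
  have h0 : gammaTerm s (2 ^ 0 * (2 * 0 + 1)) = 0 := by simp [gammaTerm]
  rw [h0, zero_add]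
  have h := (hasSum_ncard_maxTuples hs).div_const 4
  rw [show 3 / 4 * upsilon s = 3 * upsilon s / 4 by ring, ← h.tsum_eq]
  refine ((summable_nat_add_iff 1).2 (summable_gammaTerm_two_pow_mul s 0)).tsum_le_tsum
    (fun r => ?_) h.summable
  rw [mul_zero, zero_add, mul_one, gammaTerm, if_pos (Nat.le_self_pow (by lia) 2)]
  have hf : f (2 ^ (r + 1)) = 1 / 4 ^ (r + 1) := by
    have h1 : f 1 = 1 := by simp [f, rad]
    simpa [h1] using f_two_pow_mul odd_one (r + 1)
  rw [hf, div_div, ← pow_succ, one_div_mul_eq_div]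
  gcongr
  exact gammaStar_two_pow_succ_le hs r

theorem le_tsum_gammaTerm_two_pow_mul {s : ℕ} (hs : 1 ≤ s) {k : ℕ} (hk : k ≠ 0) :
    3 * upsilon s * gammaTerm s (2 * k + 1) ≤
      ∑' r : ℕ, gammaTerm s (2 ^ r * (2 * k + 1)) := by
  have h := (hasSum_ncard_maxTuples hs).mul_right (gammaTerm s (2 * k + 1))
  rw [← h.tsum_eq]
  refine h.summable.tsum_le_tsum (fun r => ?_) (summable_gammaTerm_two_pow_mul s k)
  rw [gammaTerm_two_pow_mul (odd_two_mul_add_one k) (by lia), gammaTerm, if_pos (by lia),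
    mul_left_comm, div_mul_eq_mul_div]
  gcongr
  · exact f_nonneg _
  · exact_mod_cast ncard_maxTuples_mul_gammaStar_le hs (odd_two_mul_add_one k) r

theorem tsum_gammaTerm_two_pow_mul_le {s : ℕ} (hs : 1 ≤ s) {k : ℕ} (hk : k ≠ 0) :
    ∑' r : ℕ, gammaTerm s (2 ^ r * (2 * k + 1)) ≤
      3 * (2 ^ s - 1) * upsilon s * gammaTerm s (2 * k + 1) := by
  have h := (hasSum_ncard_maxTuples hs).mul_right ((2 ^ s - 1) * gammaTerm s (2 * k + 1))
  rw [show 3 * (2 ^ s - 1) * upsilon s * gammaTerm s (2 * k + 1) =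
    3 * upsilon s * ((2 ^ s - 1) * gammaTerm s (2 * k + 1)) by ring, ← h.tsum_eq]
  refine (summable_gammaTerm_two_pow_mul s k).tsum_le_tsum (fun r => ?_) h.summable
  have hle : (gammaStar s (2 ^ r * (2 * k + 1)) : ℝ) ≤
      (maxTuples s r).ncard * ((2 ^ s - 1) * gammaStar s (2 * k + 1)) := by
    have h1 := (gammaStar_two_pow_mul_le hs (odd_two_mul_add_one k) r).trans
      (Nat.mul_le_mul_left _ (ncard_lcmTuples_le (by lia)))
    have h2 := Nat.cast_le (α := ℝ).2 h1
    rwa [Nat.cast_mul, Nat.cast_mul, Nat.cast_sub Nat.one_le_two_pow, Nat.cast_pow, Nat.cast_one,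
      Nat.cast_ofNat] at h2
  rw [gammaTerm_two_pow_mul (odd_two_mul_add_one k) (by lia), gammaTerm, if_pos (by lia)]
  calc f (2 * k + 1) * ((gammaStar s (2 ^ r * (2 * k + 1)) : ℝ) / 4 ^ r) ≤ f (2 * k + 1) *
        ((maxTuples s r).ncard * ((2 ^ s - 1) * gammaStar s (2 * k + 1)) / 4 ^ r) := by
        gcongr
        exact f_nonneg _
    _ = _ := by ring

theorem one_div_le_gammaTerm_three {s : ℕ} (hs : 1 ≤ s) : 1 / 18 ≤ gammaTerm s 3 := by
  have hf : f 3 = 1 / 18 := by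
    rw [f, rad, Nat.prime_three.primeFactors, Nat.totient_prime Nat.prime_three]
    norm_num
  have hγ : 1 ≤ gammaStar s 3 := by
    rw [gammaStar_eq_ncard, Nat.succ_le_iff,
      Set.ncard_pos (finite_properTuples (by simp))]
    refine ⟨fun _ => 3, fun _ => by simp, Nat.dvd_antisymm (Finset.lcm_dvd fun _ _ => dvd_rfl) ?_⟩
    exact Finset.dvd_lcm (f := fun _ : Fin s => 3) (Finset.mem_univ ⟨0, hs⟩)
  have hγ' : (1 : ℝ) ≤ gammaStar s 3 := by exact_mod_cast hγ
  rw [gammaTerm, if_pos (by simp), hf]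
  linarith

theorem hasSum_odd_gammaTerm (s : ℕ) :
    HasSum (fun t : ℕ => if 3 ≤ t ∧ Odd t then f t * (gammaStar s t : ℝ) else 0)
      (∑' k : ℕ, gammaTerm s (2 * (k + 1) + 1)) := by
  have hinj : Function.Injective fun k : ℕ => 2 * (k + 1) + 1 := fun a b h => by
    dsimp only at h
    lia
  rw [← hinj.hasSum_iff]
  · have heq : (fun t : ℕ => if 3 ≤ t ∧ Odd t then f t * (gammaStar s t : ℝ) else 0) ∘
        (fun k : ℕ => 2 * (k + 1) + 1) = fun k => gammaTerm s (2 * (k + 1) + 1) := by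
      funext k
      simp only [Function.comp_apply, gammaTerm]
      rw [if_pos ⟨by lia, odd_two_mul_add_one _⟩, if_pos (by lia)]
    rw [heq]
    exact ((summable_gammaTerm s).comp_injective hinj).hasSum
  · intro t ht
    refine if_neg fun ⟨h3, k, hk⟩ => ht ⟨k - 1, ?_⟩
    dsimp only
    lia

/-- All the relevant series converge, and
`3·Υ·Σ_{t ≥ 3, t odd} f(t)·γ*(t) ≤ Σ_{t=2}^∞ f(t)·γ*(t) ≤
(3·(2^s − 1) + 27/2)·Υ·Σ_{t ≥ 3, t odd} f(t)·γ*(t)`. -/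
theorem f_gammaStar_sum_bounds (s : ℕ) (hs : 1 ≤ s) :
    Summable (fun r : ℕ => ((r : ℝ) + 1) ^ s / 4 ^ (r + 1)) ∧
    Summable (fun t : ℕ => if 3 ≤ t ∧ Odd t then f t * (gammaStar s t : ℝ) else 0) ∧
    Summable (fun t : ℕ => if 2 ≤ t then f t * (gammaStar s t : ℝ) else 0) ∧
    3 * upsilon s *
        (∑' t : ℕ, if 3 ≤ t ∧ Odd t then f t * (gammaStar s t : ℝ) else 0) ≤
      (∑' t : ℕ, if 2 ≤ t then f t * (gammaStar s t : ℝ) else 0) ∧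
    (∑' t : ℕ, if 2 ≤ t then f t * (gammaStar s t : ℝ) else 0) ≤
      (3 * (2 ^ s - 1) + 27 / 2) * upsilon s *
        (∑' t : ℕ, if 3 ≤ t ∧ Odd t then f t * (gammaStar s t : ℝ) else 0) := by
  have hodd := hasSum_odd_gammaTerm s
  have htail : Summable fun k : ℕ => gammaTerm s (2 * (k + 1) + 1) :=
    (summable_gammaTerm s).comp_injective fun a b h => by lia
  have hΥ := upsilon_nonneg s
  have hsum := hasSum_gammaTerm s
  have hsplit := hsum.summable.tsum_eq_zero_add
  have hshift := (summable_nat_add_iff 1).2 hsum.summable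
  rw [hsum.tsum_eq] at hsplit
  refine ⟨summable_upsilon s, hodd.summable, summable_gammaTerm s, ?_, ?_⟩
  · rw [hodd.tsum_eq]
    change _ ≤ ∑' t, gammaTerm s t
    rw [hsplit, ← tsum_mul_left]
    have h0 : 0 ≤ ∑' r : ℕ, gammaTerm s (2 ^ r * (2 * 0 + 1)) :=
      tsum_nonneg fun _ => gammaTerm_nonneg s _
    have h1 := (htail.mul_left (3 * upsilon s)).tsum_le_tsum
      (fun k => le_tsum_gammaTerm_two_pow_mul hs k.succ_ne_zero) hshift
    linarith
  · rw [hodd.tsum_eq]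
    change ∑' t, gammaTerm s t ≤ _
    have h0 := tsum_gammaTerm_two_pow_le hs
    have h1 := hshift.tsum_le_tsum
      (fun k => tsum_gammaTerm_two_pow_mul_le hs k.succ_ne_zero)
      (htail.mul_left (3 * (2 ^ s - 1) * upsilon s))
    rw [tsum_mul_left] at h1
    have h3 : 1 / 18 ≤ ∑' k : ℕ, gammaTerm s (2 * (k + 1) + 1) :=
      (one_div_le_gammaTerm_three hs).trans (htail.le_tsum 0 fun _ _ => gammaTerm_nonneg s _)
    have h4 := mul_le_mul_of_nonneg_left h3 (mul_nonneg (by norm_num : (0 : ℝ) ≤ 27 / 2) hΥ)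
    rw [hsplit]
    linarith
end
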